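/- Let p ≥ 5 be a prime and t ≥ 2 an integer, and set n = p·t. Let x, y be positive integers with gcd(x, y) = 1 and let k, ℓ, m be non-negative integers such that it is not the case that k is even, ℓ is odd, m is odd and p = 5. If x² + 2^k·11^ℓ·19^m = y^n, then (x, y, k, ℓ, m, n) = (241, 3, 3, 2, 0, 10). -/

import Mathlib

/-- The Lucas sequence of the first kind. -/
def lucasU {R : Type*} [CommRing R] (T Q : R) : ℕ → R
  | 0 => 0
  | 1 => 1
  | n + 2 => T * lucasU T Q (n + 1) - Q * lucasU T Q n

/-- The Lucas sequence of the second kind. -/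
def lucasV {R : Type*} [CommRing R] (T Q : R) (n : ℕ) : R :=
  2 * lucasU T Q (n + 1) - T * lucasU T Q n

namespace Lucas

section CommRing

variable {R : Type*} [CommRing R] (T Q : R)

@[simp] theorem U_zero : lucasU T Q 0 = 0 := rfl
@[simp] theorem U_one : lucasU T Q 1 = 1 := rfl
theorem U_add_two (n : ℕ) :
    lucasU T Q (n + 2) = T * lucasU T Q (n + 1) - Q * lucasU T Q n := rfl
@[simp] theorem V_zero : lucasV T Q 0 = 2 := by simp [lucasV]
@[simp] theorem V_one : lucasV T Q 1 = T := by simp [lucasV, U_add_two]; ring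

theorem U_two : lucasU T Q 2 = T := by simp [U_add_two]
theorem U_three : lucasU T Q 3 = T ^ 2 - Q := by simp [U_add_two]; ring
theorem U_five : lucasU T Q 5 = T ^ 4 - 3 * T ^ 2 * Q + Q ^ 2 := by simp [U_add_two]; ring

theorem map_U {S : Type*} [CommRing S] (f : R →+* S) (n : ℕ) :
    f (lucasU T Q n) = lucasU (f T) (f Q) n := by
  induction n using Nat.twoStepInduction with
  | zero => simp
  | one => simp
  | more n h1 h2 => simp [U_add_two, h1, h2]

theorem U_add (m n : ℕ) :
    lucasU T Q (m + n + 1) =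
      lucasU T Q (m + 1) * lucasU T Q (n + 1) - Q * lucasU T Q m * lucasU T Q n := by
  induction n using Nat.twoStepInduction with
  | zero => simp
  | one => simp [U_add_two]; ring
  | more n h1 h2 =>
    rw [show m + (n + 2) + 1 = (m + n + 1) + 2 by ring, U_add_two, h1,
      show m + n + 1 + 1 = m + (n + 1) + 1 by ring, h2, U_add_two T Q (n + 1), U_add_two T Q n]
    ring

theorem U_norm (n : ℕ) :
    lucasU T Q (n + 1) ^ 2 - T * lucasU T Q (n + 1) * lucasU T Q n + Q * lucasU T Q n ^ 2
      = Q ^ n := by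
  induction n with
  | zero => simp
  | succ n ih => rw [pow_succ Q, ← ih, U_add_two]; ring

theorem V_sq (n : ℕ) :
    lucasV T Q n ^ 2 = (T ^ 2 - 4 * Q) * lucasU T Q n ^ 2 + 4 * Q ^ n := by
  rw [← U_norm T Q n, lucasV]; ring

theorem V_add_two (n : ℕ) :
    lucasV T Q (n + 2) = T * lucasV T Q (n + 1) - Q * lucasV T Q n := by
  simp only [lucasV, U_add_two]; ring

theorem U_add_two_mul (k m : ℕ) :
    lucasU T Q (k + 2 * m) = lucasV T Q m * lucasU T Q (k + m) - Q ^ m * lucasU T Q k := by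
  cases m with
  | zero => simp; ring
  | succ m =>
    have e1 := U_add T Q (k + m + 1) m
    rw [show k + m + 1 + m + 1 = k + 2 * (m + 1) by ring] at e1
    have e2 := U_add T Q k m
    rw [add_assoc] at e2
    have e3 := U_add T Q k (m + 1)
    rw [← add_assoc] at e3
    rw [e1, e3, add_assoc k m 1, e2, ← U_norm T Q (m + 1), lucasV]
    have e4 := U_add_two T Q m
    rw [e4]; ring

theorem U_mul (m n : ℕ) :
    lucasU T Q (m * n) = lucasU T Q m * lucasU (lucasV T Q m) (Q ^ m) n := by
  induction n using Nat.twoStepInduction with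
  | zero => simp
  | one => simp
  | more n h1 h2 =>
    rw [show m * (n + 2) = m * n + 2 * m by ring, U_add_two_mul, h1,
      show m * n + m = m * (n + 1) by ring, h2, U_add_two]
    ring

theorem U_odd_sub (h : ℕ) :
    lucasU T Q (2 * h + 1) - Q ^ h = lucasU T Q h * lucasV T Q (h + 1) := by
  rw [two_mul, U_add T Q h h, ← U_norm T Q h, lucasV, U_add_two]; ring

theorem U_neg (n : ℕ) : lucasU (-T) Q n = (-1) ^ (n + 1) * lucasU T Q n := by
  induction n using Nat.twoStepInduction with
  | zero => simp
  | one => simp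
  | more n h1 h2 => rw [U_add_two, U_add_two, h1, h2]; ring

theorem U_neg_odd {n : ℕ} (hn : Odd n) : lucasU (-T) Q n = lucasU T Q n := by
  rw [U_neg, (Even.neg_one_pow (by grind)), one_mul]

theorem V_mul (m n : ℕ) :
    lucasV T Q (m * n) = lucasV (lucasV T Q m) (Q ^ m) n := by
  induction n using Nat.twoStepInduction with
  | zero => simp
  | one => simp
  | more n h1 h2 =>
    rw [V_add_two, ← h1, ← h2]
    have e1 := U_add_two_mul T Q (m * n) m
    have e2 := U_add_two_mul T Q (m * n + 1) m
    rw [show m * (n + 2) = m * n + 2 * m by ring, show m * (n + 1) = m * n + m by ring]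
    simp only [lucasV] at *
    rw [e1, show m * n + 2 * m + 1 = m * n + 1 + 2 * m by ring, e2,
      show m * n + 1 + m = m * n + m + 1 by ring]
    ring

/-- Modulo the discriminant the Lucas sequence degenerates. -/
theorem U_of_disc_zero (a : R) (n : ℕ) :
    lucasU (2 * a) (a ^ 2) (n + 1) = (n + 1) * a ^ n := by
  induction n using Nat.twoStepInduction with
  | zero => simp
  | one => simp [U_add_two]; ring
  | more n h1 h2 =>
    rw [U_add_two, h2, h1]; push_cast; ring

end CommRing

theorem U_intCast_zmod (T Q : ℤ) (m n : ℕ) :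
    ((lucasU T Q n : ℤ) : ZMod m) = lucasU (T : ZMod m) (Q : ZMod m) n := by
  simpa using map_U T Q (Int.castRingHom (ZMod m)) n

/-- Consecutive terms cannot share a prime not dividing `Q`. -/
theorem dvd_U_gcd {ℓ : ℕ} (hℓ : ℓ.Prime) {T Q : ℤ} (hQ : ¬ (ℓ : ℤ) ∣ Q) (m n : ℕ)
    (hm : (ℓ : ℤ) ∣ lucasU T Q m) (hn : (ℓ : ℤ) ∣ lucasU T Q n) :
    (ℓ : ℤ) ∣ lucasU T Q (m.gcd n) := by
  have hp : Prime (ℓ : ℤ) := Nat.prime_iff_prime_int.mp hℓ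
  have key : ∀ a b : ℕ, (ℓ : ℤ) ∣ lucasU T Q a → (ℓ : ℤ) ∣ lucasU T Q (a + b) →
      (ℓ : ℤ) ∣ lucasU T Q b := by
    intro a b ha hab
    cases b with
    | zero => simp
    | succ b =>
      rw [← add_assoc, U_add] at hab
      have h1 : (ℓ : ℤ) ∣ lucasU T Q (a + 1) * lucasU T Q (b + 1) := by
        have := dvd_add hab ((ha.mul_left Q).mul_right (lucasU T Q b))
        simpa using this
      rcases hp.dvd_or_dvd h1 with h | h
      · exfalso
        have := U_norm T Q a
        have h2 : (ℓ : ℤ) ∣ Q ^ a := by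
          rw [← this]
          have e1 : (ℓ : ℤ) ∣ lucasU T Q (a + 1) ^ 2 := Dvd.dvd.pow h two_ne_zero
          have e2 : (ℓ : ℤ) ∣ lucasU T Q a ^ 2 := Dvd.dvd.pow ha two_ne_zero
          exact dvd_add (dvd_sub e1 (ha.mul_left _)) (e2.mul_left _)
        exact hQ (hp.dvd_of_dvd_pow h2)
      · exact h
  induction m, n using Nat.gcd.induction with
  | H0 n => simpa using hn
  | H1 m n hpos ih =>
    rw [Nat.gcd_rec]
    apply ih _ hm
    have : n = m * (n / m) + n % m := (Nat.div_add_mod n m).symm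
    apply key (m * (n / m)) (n % m)
    · rw [U_mul]; exact hm.mul_right _
    · rw [← this]; exact hn

end Lucas

/-- An ideal generated by a single regular element. -/
def RegPrincipal {A : Type*} [CommRing A] (I : Ideal A) : Prop :=
  ∃ c ∈ nonZeroDivisors A, I = Ideal.span {c}

namespace RegPrincipal

variable {A : Type*} [CommRing A] {I J : Ideal A}

theorem top : RegPrincipal (⊤ : Ideal A) :=
  ⟨1, one_mem _, by simp⟩

theorem mul (hI : RegPrincipal I) (hJ : RegPrincipal J) : RegPrincipal (I * J) := by
  obtain ⟨a, ha, rfl⟩ := hI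
  obtain ⟨b, hb, rfl⟩ := hJ
  exact ⟨a * b, mul_mem ha hb, Ideal.span_singleton_mul_span_singleton a b⟩

theorem pow (hI : RegPrincipal I) (n : ℕ) : RegPrincipal (I ^ n) := by
  obtain ⟨a, ha, rfl⟩ := hI
  exact ⟨a ^ n, pow_mem ha n, Ideal.span_singleton_pow a n⟩

theorem of_mul_right (h : RegPrincipal (I * J)) (hJ : RegPrincipal J) : RegPrincipal I := by
  obtain ⟨b, hb, rfl⟩ := hJ
  obtain ⟨c, hc, hI⟩ := h
  have hmem : c ∈ I * Ideal.span {b} := by rw [hI]; exact Ideal.mem_span_singleton_self c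
  obtain ⟨z, hz, rfl⟩ := Ideal.mem_mul_span_singleton.mp hmem
  refine ⟨z, (mul_mem_nonZeroDivisors.mp hc).1, le_antisymm ?_ ?_⟩
  · intro a ha
    have : a * b ∈ Ideal.span {z * b} := by
      rw [← hI]; exact Ideal.mul_mem_mul ha (Ideal.mem_span_singleton_self b)
    obtain ⟨r, hr⟩ := Ideal.mem_span_singleton.mp this
    rw [Ideal.mem_span_singleton]
    refine ⟨r, ?_⟩
    have h0 : (a - z * r) * b = 0 := by linear_combination hr
    have := (mem_nonZeroDivisors_iff_right.mp hb) _ h0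
    linear_combination this
  · rw [Ideal.span_singleton_le_iff_mem]; exact hz

theorem of_mul_left (h : RegPrincipal (I * J)) (hI : RegPrincipal I) : RegPrincipal J :=
  of_mul_right (by rwa [mul_comm]) hI

end RegPrincipal

namespace IdealPair

variable {A : Type*} [CommRing A]

theorem mem_span_four {a b c d x : A} (p q r s : A) (h : x = p * a + q * b + r * c + s * d) :
    x ∈ Ideal.span {a, b, c, d} := by
  rw [h]
  refine Ideal.add_mem _ (Ideal.add_mem _ (Ideal.add_mem _ ?_ ?_) ?_) ?_ <;>
    exact Ideal.mul_mem_left _ _ (Ideal.subset_span (by simp))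

theorem mul_eq_common {N N' σ τ u v w : A} (h : σ * τ = N * N')
    (hb : u * N + v * N' + w * (σ + τ) = 1) :
    Ideal.span {N, σ} * Ideal.span {N', σ} = Ideal.span {σ} := by
  rw [Ideal.span_pair_mul_span_pair]
  apply le_antisymm
  · rw [Ideal.span_le]
    rintro x hx
    simp only [Set.mem_insert_iff, Set.mem_singleton_iff] at hx
    rw [SetLike.mem_coe, Ideal.mem_span_singleton]
    rcases hx with rfl | rfl | rfl | rfl
    · exact ⟨τ, h.symm⟩
    · exact ⟨N, by ring⟩
    · exact ⟨N', by ring⟩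
    · exact ⟨σ, by ring⟩
  · rw [Ideal.span_singleton_le_iff_mem]
    exact mem_span_four w u v w (by linear_combination (-σ) * hb + w * h)

theorem mul_conj {N N' σ τ u v w : A} (h : σ * τ = N * N')
    (hb : u * N + v * N' + w * (σ + τ) = 1) :
    Ideal.span {N, σ} * Ideal.span {N, τ} = Ideal.span {N} := by
  rw [Ideal.span_pair_mul_span_pair]
  apply le_antisymm
  · rw [Ideal.span_le]
    rintro x hx
    simp only [Set.mem_insert_iff, Set.mem_singleton_iff] at hx
    rw [SetLike.mem_coe, Ideal.mem_span_singleton]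
    rcases hx with rfl | rfl | rfl | rfl
    · exact ⟨N, by ring⟩
    · exact ⟨τ, by ring⟩
    · exact ⟨σ, by ring⟩
    · exact ⟨N', h⟩
  · rw [Ideal.span_singleton_le_iff_mem]
    exact mem_span_four u w w v (by linear_combination (-N) * hb - v * h)

theorem mul_split {N₁ N₂ N' σ τ u v w : A} (h : σ * τ = N₁ * N₂ * N')
    (hb : u * N₁ + v * N₂ + w * (σ + τ) = 1) :
    Ideal.span {N₁, σ} * Ideal.span {N₂, σ} = Ideal.span {N₁ * N₂, σ} := by
  rw [Ideal.span_pair_mul_span_pair]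
  apply le_antisymm
  · rw [Ideal.span_le]
    rintro x hx
    simp only [Set.mem_insert_iff, Set.mem_singleton_iff] at hx
    rw [SetLike.mem_coe, Ideal.mem_span_pair]
    rcases hx with rfl | rfl | rfl | rfl
    · exact ⟨1, 0, by ring⟩
    · exact ⟨0, N₁, by ring⟩
    · exact ⟨0, N₂, by ring⟩
    · exact ⟨0, σ, by ring⟩
  · rw [Ideal.span_le]
    rintro x hx
    simp only [Set.mem_insert_iff, Set.mem_singleton_iff] at hx
    rcases hx with rfl | rfl
    · exact Ideal.subset_span (by simp)
    · exact mem_span_four (w * N') u v w (by linear_combination (-x) * hb + w * h)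

end IdealPair

theorem exists_bezout_three {a b c : ℤ}
    (h : ∀ p : ℕ, p.Prime → (p : ℤ) ∣ a → (p : ℤ) ∣ b → (p : ℤ) ∣ c → False) :
    ∃ u v w : ℤ, u * a + v * b + w * c = 1 := by
  have hg : Int.gcd a (Int.gcd b c) = 1 := by
    by_contra hne
    obtain ⟨p, hp, hpd⟩ := Nat.exists_prime_and_dvd hne
    have h1 : (p : ℤ) ∣ a := (Int.natCast_dvd_natCast.mpr hpd).trans (Int.gcd_dvd_left _ _)
    have h2 : (p : ℤ) ∣ (Int.gcd b c : ℤ) :=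
      (Int.natCast_dvd_natCast.mpr hpd).trans (Int.gcd_dvd_right _ _)
    exact h p hp h1 (h2.trans (Int.gcd_dvd_left _ _)) (h2.trans (Int.gcd_dvd_right _ _))
  refine ⟨Int.gcdA a (Int.gcd b c), Int.gcdB a (Int.gcd b c) * Int.gcdA b c,
    Int.gcdB a (Int.gcd b c) * Int.gcdB b c, ?_⟩
  have e1 := Int.gcd_eq_gcd_ab a (Int.gcd b c)
  have e2 := Int.gcd_eq_gcd_ab b c
  rw [hg] at e1
  push_cast at e1
  linear_combination (-Int.gcdB a (Int.gcd b c)) * e2 - e1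

/-- The order `ℤ[ω]` with `ω ^ 2 = t ω - n`. -/
abbrev QuadOrder (t n : ℤ) := QuadraticAlgebra ℤ (-n) t

/-- The ideal `(N, s + ω)` of `ℤ[ω]`. -/
def quadIdeal (t n N s : ℤ) : Ideal (QuadOrder t n) :=
  Ideal.span {⟨N, 0⟩, ⟨s, 1⟩}

/-- The order `ℤ[ω]` is maximal and imaginary, with unit group of order dividing four. -/
structure IsMaximalOrder (t n : ℤ) : Prop where
  disc : 4 ≤ 4 * n - t ^ 2
  regular : ∀ (p : ℕ) (N N' s : ℤ), p.Prime → N * N' = s ^ 2 + t * s + n →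
    (p : ℤ) ∣ N → (p : ℤ) ∣ N' → (p : ℤ) ∣ 2 * s + t → False

namespace QuadOrder

variable {t n : ℤ}

theorem mk_mul_mk (a b c d : ℤ) : (⟨a, b⟩ : QuadOrder t n) * ⟨c, d⟩ =
    ⟨a * c - n * b * d, a * d + b * c + t * b * d⟩ := by
  ext
  · simp; ring
  · simp

theorem re_one : (1 : QuadOrder t n).re = 1 := rfl

theorem im_one : (1 : QuadOrder t n).im = 0 := rfl

/-- The norm form of `ℤ[ω]`. -/
def nrm (x : QuadOrder t n) : ℤ := x.re ^ 2 + t * x.re * x.im + n * x.im ^ 2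

theorem nrm_mk (a b : ℤ) : nrm (⟨a, b⟩ : QuadOrder t n) = a ^ 2 + t * a * b + n * b ^ 2 := rfl

theorem nrm_mul (x y : QuadOrder t n) : nrm (x * y) = nrm x * nrm y := by
  simp [nrm]; ring

theorem nrm_one : nrm (1 : QuadOrder t n) = 1 := by simp [nrm, re_one, im_one]

theorem nrm_pow (x : QuadOrder t n) (k : ℕ) : nrm (x ^ k) = nrm x ^ k := by
  induction k with
  | zero => simp [nrm_one]
  | succ k ih => rw [pow_succ, pow_succ, nrm_mul, ih]

theorem four_mul_nrm (x : QuadOrder t n) :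
    4 * nrm x = (2 * x.re + t * x.im) ^ 2 + (4 * n - t ^ 2) * x.im ^ 2 := by
  simp [nrm]; ring

theorem mul_conj (x : QuadOrder t n) : x * ⟨x.re + t * x.im, -x.im⟩ = ⟨nrm x, 0⟩ := by
  ext <;> simp [nrm] <;> ring

variable (h : IsMaximalOrder t n)
include h

theorem nrm_nonneg (x : QuadOrder t n) : 0 ≤ nrm x := by
  have := four_mul_nrm x
  have := h.disc
  nlinarith [sq_nonneg (2 * x.re + t * x.im), sq_nonneg x.im]

theorem eq_zero_of_nrm (x : QuadOrder t n) (hx : nrm x = 0) : x = 0 := by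
  have h1 := four_mul_nrm x
  have h2 := h.disc
  have h3 : x.im = 0 := by
    by_contra h4
    have : 0 < x.im ^ 2 := by positivity
    nlinarith [sq_nonneg (2 * x.re + t * x.im)]
  have h4 : x.re = 0 := by
    simp [nrm, h3] at hx; exact hx
  ext <;> simp [h3, h4]

theorem mem_nonZeroDivisors_of_nrm (x : QuadOrder t n) (hx : nrm x ≠ 0) :
    x ∈ nonZeroDivisors (QuadOrder t n) := by
  rw [mem_nonZeroDivisors_iff_right]
  intro y hy
  apply eq_zero_of_nrm h
  have : nrm y * nrm x = 0 := by rw [← nrm_mul, hy]; simp [nrm]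
  exact (mul_eq_zero.mp this).resolve_right hx

theorem unit_pow_four (u v : QuadOrder t n) (huv : u * v = 1) : u ^ 4 = 1 := by
  have h1 : nrm u * nrm v = 1 := by rw [← nrm_mul, huv, nrm_one]
  have hu : nrm u = 1 := by
    rcases Int.mul_eq_one_iff_eq_one_or_neg_one.mp h1 with h2 | h2
    · exact h2.1
    · have := nrm_nonneg h u; omega
  have h2 := four_mul_nrm u
  have h3 := h.disc
  rw [hu] at h2
  have h5 : u.im ^ 2 ≤ 1 := by
    nlinarith [sq_nonneg (2 * u.re + t * u.im), sq_nonneg u.im]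
  have h6 : u.im = 0 ∨ u.im ^ 2 = 1 := by
    have h7 : 0 ≤ u.im ^ 2 := sq_nonneg _
    rcases (by omega : u.im ^ 2 = 0 ∨ u.im ^ 2 = 1) with h8 | h8
    · left; simpa using h8
    · exact Or.inr h8
  have hsq : u * u = 1 ∨ u * u = -1 := by
    rcases h6 with h6 | h6
    · left
      have h7 : u.re * u.re = 1 := by simp [nrm, h6] at hu; rcases hu with h | h <;> simp [h]
      ext <;> simp [h6, h7, re_one, im_one]
    · right
      have h8 : 2 * u.re + t * u.im = 0 := by
        have : (2 * u.re + t * u.im) ^ 2 ≤ 0 := by nlinarith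
        have := le_antisymm this (sq_nonneg _)
        simpa using this
      ext
      · simp [re_one]
        have := hu
        simp only [nrm] at this
        linear_combination (-1) * this + u.re * h8
      · simp [im_one]
        linear_combination u.im * h8
  calc u ^ 4 = (u * u) * (u * u) := by ring
    _ = 1 := by rcases hsq with h | h <;> rw [h] <;> ring

end QuadOrder

namespace QuadOrder

variable {t n : ℤ}

theorem span_pair_le {A : Type*} [CommRing A] {I : Ideal A} {a b : A} :
    Ideal.span {a, b} ≤ I ↔ a ∈ I ∧ b ∈ I := by
  rw [Ideal.span_le, Set.insert_subset_iff, Set.singleton_subset_iff]; rfl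

theorem quadIdeal_shift (N s k : ℤ) : quadIdeal t n N (s + k * N) = quadIdeal t n N s := by
  unfold quadIdeal
  apply le_antisymm
  · rw [span_pair_le]
    refine ⟨Ideal.subset_span (by simp), Ideal.mem_span_pair.mpr ⟨⟨k, 0⟩, 1, ?_⟩⟩
    rw [mk_mul_mk, one_mul]
    ext <;> simp; ring
  · rw [span_pair_le]
    refine ⟨Ideal.subset_span (by simp), Ideal.mem_span_pair.mpr ⟨⟨-k, 0⟩, 1, ?_⟩⟩
    rw [mk_mul_mk, one_mul]
    ext <;> simp

theorem quadIdeal_congr {N s s' : ℤ} (h : N ∣ s - s') : quadIdeal t n N s = quadIdeal t n N s' := by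
  obtain ⟨k, hk⟩ := h
  rw [show s = s' + k * N by linear_combination hk, quadIdeal_shift]

theorem quadIdeal_conj (N s : ℤ) :
    quadIdeal t n N (-s - t) = Ideal.span {(⟨N, 0⟩ : QuadOrder t n), ⟨s + t, -1⟩} := by
  unfold quadIdeal
  apply le_antisymm <;> rw [span_pair_le] <;>
    refine ⟨Ideal.subset_span (by simp), Ideal.mem_span_pair.mpr ⟨0, -1, ?_⟩⟩ <;>
    ext <;> simp <;> ring

theorem quadIdeal_one (s : ℤ) : quadIdeal t n 1 s = ⊤ := by
  rw [Ideal.eq_top_iff_one]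
  exact Ideal.subset_span (by left; rfl)

theorem mk_norm (s : ℤ) {N N' : ℤ} (hN : N * N' = s ^ 2 + t * s + n) :
    (⟨s, 1⟩ : QuadOrder t n) * ⟨s + t, -1⟩ = ⟨N, 0⟩ * ⟨N', 0⟩ := by
  rw [mk_mul_mk, mk_mul_mk]
  ext
  · simp; linear_combination -hN
  · simp

theorem bezout_cast {s N N' u v w : ℤ} (h : u * N + v * N' + w * (2 * s + t) = 1) :
    (⟨u, 0⟩ : QuadOrder t n) * ⟨N, 0⟩ + ⟨v, 0⟩ * ⟨N', 0⟩ + ⟨w, 0⟩ * (⟨s, 1⟩ + ⟨s + t, -1⟩) = 1 := by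
  simp only [mk_mul_mk]
  ext
  · simp [re_one]; linear_combination h
  · simp [im_one]

variable (h : IsMaximalOrder t n)
include h

theorem quadIdeal_mul_complement {N N' s : ℤ} (hN : N * N' = s ^ 2 + t * s + n) :
    quadIdeal t n N s * quadIdeal t n N' s = Ideal.span {⟨s, 1⟩} := by
  obtain ⟨u, v, w, hb⟩ := exists_bezout_three (a := N) (b := N') (c := 2 * s + t)
    (fun p hp h1 h2 h3 => h.regular p N N' s hp hN h1 h2 h3)
  exact IdealPair.mul_eq_common (mk_norm s hN) (bezout_cast hb)

theorem quadIdeal_mul_conj {N N' s : ℤ} (hN : N * N' = s ^ 2 + t * s + n) :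
    quadIdeal t n N s * quadIdeal t n N (-s - t) = Ideal.span {⟨N, 0⟩} := by
  obtain ⟨u, v, w, hb⟩ := exists_bezout_three (a := N) (b := N') (c := 2 * s + t)
    (fun p hp h1 h2 h3 => h.regular p N N' s hp hN h1 h2 h3)
  rw [quadIdeal_conj]
  exact IdealPair.mul_conj (mk_norm s hN) (bezout_cast hb)

theorem quadIdeal_split {N₁ N₂ N' s : ℤ} (hN : N₁ * N₂ * N' = s ^ 2 + t * s + n) :
    quadIdeal t n (N₁ * N₂) s = quadIdeal t n N₁ s * quadIdeal t n N₂ s := by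
  obtain ⟨u, v, w, hb⟩ := exists_bezout_three (a := N₁) (b := N₂) (c := 2 * s + t)
    (fun p hp h1 h2 h3 => h.regular p N₁ (N₂ * N') s hp (by linear_combination hN) h1
      (h2.mul_right _) h3)
  have e : (⟨s, 1⟩ : QuadOrder t n) * ⟨s + t, -1⟩ = ⟨N₁, 0⟩ * ⟨N₂, 0⟩ * ⟨N', 0⟩ := by
    rw [mk_norm s hN]; simp
  have := IdealPair.mul_split e (bezout_cast hb)
  unfold quadIdeal
  rw [this]; simp

theorem quadIdeal_pow {N N' s : ℤ} {r : ℕ} (hN : N ^ r * N' = s ^ 2 + t * s + n) :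
    quadIdeal t n (N ^ r) s = quadIdeal t n N s ^ r := by
  induction r generalizing N' with
  | zero => simp [quadIdeal_one, Ideal.one_eq_top]
  | succ r ih =>
    rw [pow_succ, pow_succ, quadIdeal_split h (N' := N') (by rw [← hN]; ring),
      ih (N' := N * N') (by rw [← hN]; ring)]

theorem regPrincipal_of_nrm {x : QuadOrder t n} (hx : nrm x ≠ 0) :
    RegPrincipal (Ideal.span {x}) :=
  ⟨x, mem_nonZeroDivisors_of_nrm h x hx, rfl⟩

theorem nrm_mk_one_pos (s : ℤ) : 0 < s ^ 2 + t * s + n := by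
  have := h.disc
  nlinarith [sq_nonneg (2 * s + t)]

theorem regPrincipal_complement {N N' s : ℤ} (hN : N * N' = s ^ 2 + t * s + n) :
    RegPrincipal (quadIdeal t n N s * quadIdeal t n N' s) := by
  rw [quadIdeal_mul_complement h hN]
  apply regPrincipal_of_nrm h
  have := nrm_mk_one_pos h s
  rw [nrm_mk]; intro h0; linarith

theorem regPrincipal_conj {N s : ℤ} (h0 : N ≠ 0) (hN : N ∣ s ^ 2 + t * s + n) :
    RegPrincipal (quadIdeal t n N s * quadIdeal t n N (-s - t)) := by
  obtain ⟨N', hN'⟩ := hN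
  rw [quadIdeal_mul_conj h hN'.symm]
  apply regPrincipal_of_nrm h
  simp [nrm_mk, h0]

theorem regPrincipal_pow_conj {N s : ℤ} (h0 : N ≠ 0) (hN : N ∣ s ^ 2 + t * s + n) {M : ℕ}
    (hp : RegPrincipal (quadIdeal t n N (-s - t) ^ M)) :
    RegPrincipal (quadIdeal t n N s ^ M) := by
  refine RegPrincipal.of_mul_right ?_ hp
  rw [← mul_pow]
  exact (regPrincipal_conj h h0 hN).pow M

/-- To bound the exponent of the class group it is enough to treat small primes. -/
theorem induction_on_norm {P : ℤ → ℤ → Prop}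
    (hone : ∀ s, P 1 s)
    (hcongr : ∀ N s s', N ∣ s - s' → P N s' → P N s)
    (hmul : ∀ N₁ N₂ s, 0 < N₁ → 0 < N₂ → N₁ * N₂ ∣ s ^ 2 + t * s + n → P N₁ s → P N₂ s →
      P (N₁ * N₂) s)
    (hcompl : ∀ N N' s, 0 < N → 0 < N' → N * N' = s ^ 2 + t * s + n → P N' s → P N s)
    (hsmall : ∀ (p : ℕ) (s : ℤ), p.Prime → 3 * (p : ℤ) ^ 2 ≤ 4 * n - t ^ 2 →
      (p : ℤ) ∣ s ^ 2 + t * s + n → P p s)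
    (N s : ℤ) (hN : 0 < N) (hd : N ∣ s ^ 2 + t * s + n) : P N s := by
  obtain ⟨k, rfl⟩ : ∃ k : ℕ, N = k := ⟨N.toNat, by omega⟩
  induction k using Nat.strong_induction_on generalizing s with
  | _ k ih =>
  by_cases h1 : k = 1
  · subst h1; exact hone s
  have hk0 : 0 < k := by omega
  by_cases hprime : k.Prime
  · by_cases hs : 3 * (k : ℤ) ^ 2 ≤ 4 * n - t ^ 2
    · exact hsmall k s hprime hs hd
    · push Not at hs
      -- recentre `s` so that `|2 s + t| ≤ k`
      obtain ⟨s', hs', hb1, hb2⟩ : ∃ s', (k : ℤ) ∣ s - s' ∧ -(k : ℤ) ≤ 2 * s' + t ∧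
          2 * s' + t ≤ k := by
        refine ⟨s - k * ((2 * s + t + k) / (2 * k)), ⟨(2 * s + t + k) / (2 * k), by ring⟩, ?_, ?_⟩
        · have := Int.mul_ediv_add_emod (2 * s + t + k) (2 * k)
          have := Int.emod_nonneg (2 * s + t + k) (b := 2 * k) (by omega)
          linarith
        · have := Int.mul_ediv_add_emod (2 * s + t + k) (2 * k)
          have := Int.emod_lt_of_pos (2 * s + t + k) (b := 2 * k) (by omega)
          linarith
      refine hcongr _ _ _ hs' ?_
      have hd' : (k : ℤ) ∣ s' ^ 2 + t * s' + n := by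
        have : s' ^ 2 + t * s' + n = s ^ 2 + t * s + n - (s - s') * (s + s' + t) := by ring
        rw [this]; exact dvd_sub hd (hs'.mul_right _)
      obtain ⟨N', hN'⟩ := hd'
      have hpos := nrm_mk_one_pos h s'
      have hk0' : (0 : ℤ) < k := by exact_mod_cast hk0
      have hN'0 : 0 < N' := by
        rw [hN'] at hpos; exact (mul_pos_iff_of_pos_left hk0').mp hpos
      have hlt : N' < k := by
        by_contra hge
        push Not at hge
        nlinarith
      refine hcompl _ _ _ hk0' hN'0 hN'.symm ?_
      obtain ⟨j, rfl⟩ : ∃ j : ℕ, N' = j := ⟨N'.toNat, by omega⟩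
      exact ih j (by exact_mod_cast hlt) s' hN'0 ⟨k, by rw [hN']; ring⟩
  · obtain ⟨a, b, ha, hb, rfl⟩ := (Nat.not_prime_iff_exists_mul_eq (by omega)).mp hprime
    push_cast at hd ⊢
    have ha0 : 0 < a := Nat.pos_of_mul_pos_right hk0
    have hb0 : 0 < b := Nat.pos_of_mul_pos_left hk0
    exact hmul a b s (by exact_mod_cast ha0) (by exact_mod_cast hb0) hd
      (ih a ha s (by exact_mod_cast ha0) ((Dvd.intro _ rfl).trans hd))
      (ih b hb s (by exact_mod_cast hb0) ((Dvd.intro_left _ rfl).trans hd))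

/-- The exponent `M` kills every ideal class. -/
theorem exponent_of_small {M : ℕ}
    (hsmall : ∀ (p : ℕ) (s : ℤ), p.Prime → 3 * (p : ℤ) ^ 2 ≤ 4 * n - t ^ 2 →
      (p : ℤ) ∣ s ^ 2 + t * s + n → RegPrincipal (quadIdeal t n p s ^ M))
    (N s : ℤ) (hN : 0 < N) (hd : N ∣ s ^ 2 + t * s + n) :
    RegPrincipal (quadIdeal t n N s ^ M) := by
  refine induction_on_norm h (P := fun N s => RegPrincipal (quadIdeal t n N s ^ M))
    ?_ ?_ ?_ ?_ hsmall N s hN hd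
  · intro s
    rw [quadIdeal_one, Ideal.top_pow]; exact RegPrincipal.top
  · intro N s s' hs hP
    rwa [quadIdeal_congr hs]
  · rintro N₁ N₂ s - - ⟨N', hN'⟩ h1 h2
    rw [quadIdeal_split h hN'.symm, mul_pow]
    exact h1.mul h2
  · intro N N' s _ _ hN' hP
    refine RegPrincipal.of_mul_right ?_ hP
    rw [← mul_pow]
    exact (regPrincipal_complement h hN').pow M

/-- An element of norm `Y ^ r` prime to its conjugate generates the power of an ideal. -/
theorem span_eq_pow {e f Y : ℤ} {r : ℕ}
    (hnorm : e ^ 2 + t * e * f + n * f ^ 2 = Y ^ r) (hcop : IsCoprime f (Y ^ r)) :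
    ∃ s, Y ^ r ∣ s ^ 2 + t * s + n ∧
      quadIdeal t n Y s ^ r = Ideal.span {(⟨e, f⟩ : QuadOrder t n)} := by
  obtain ⟨g, k, hgk⟩ := hcop
  have hdvd : (e * g) ^ 2 + t * (e * g) + n
      = Y ^ r * (g ^ 2 + k * (t * (e * g) + n * (1 + f * g))) := by
    linear_combination g ^ 2 * hnorm - (t * e * g + n * (1 + f * g)) * hgk
  refine ⟨e * g, ⟨_, hdvd⟩, ?_⟩
  rw [← quadIdeal_pow h hdvd.symm, quadIdeal]
  have hconj : (⟨e, f⟩ : QuadOrder t n) * ⟨e + t * f, -f⟩ = ⟨Y ^ r, 0⟩ := by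
    rw [mul_conj, nrm_mk, hnorm]
  apply le_antisymm
  · rw [span_pair_le]
    refine ⟨Ideal.mem_span_singleton.mpr ⟨_, hconj.symm⟩, Ideal.mem_span_singleton.mpr ?_⟩
    refine ⟨⟨g, 0⟩ + ⟨e + t * f, -f⟩ * (⟨-(g * e * k), 0⟩ + ⟨k, 0⟩ * ⟨e * g, 1⟩), ?_⟩
    rw [mul_add, ← mul_assoc, hconj]
    simp only [mk_mul_mk]
    ext
    · simp only [QuadraticAlgebra.re_add, QuadraticAlgebra.re_mul]; ring
    · simp; linear_combination -hgk
  · rw [Ideal.span_singleton_le_iff_mem]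
    refine Ideal.mem_span_pair.mpr ⟨⟨e * k, 0⟩, ⟨f, 0⟩, ?_⟩
    simp only [mk_mul_mk]
    ext
    · simp; linear_combination e * hgk
    · simp

theorem exists_root_of_span_eq {ξ γ : QuadOrder t n} {r : ℕ} (hr : Odd r)
    (hξ : nrm ξ ≠ 0) (hs : Ideal.span {ξ} = Ideal.span {γ ^ r}) :
    ∃ u : QuadOrder t n, u ^ 4 = 1 ∧ ξ = (u * γ) ^ r := by
  obtain ⟨a, ha⟩ := Ideal.mem_span_singleton.mp
    (hs ▸ Ideal.mem_span_singleton_self ξ : ξ ∈ Ideal.span {γ ^ r})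
  obtain ⟨b, hb⟩ := Ideal.mem_span_singleton.mp
    (hs ▸ Ideal.mem_span_singleton_self (γ ^ r) : γ ^ r ∈ Ideal.span {ξ})
  have hab : b * a = 1 := by
    have h0 : (b * a - 1) * ξ = 0 := by
      have : ξ = ξ * b * a := by rw [← hb]; exact ha
      linear_combination -this
    have := (mem_nonZeroDivisors_iff_right.mp (mem_nonZeroDivisors_of_nrm h ξ hξ)) _ h0
    linear_combination this
  have ha4 : a ^ 4 = 1 := unit_pow_four h a b (by rw [mul_comm]; exact hab)
  refine ⟨a ^ r, by rw [← pow_mul, mul_comm, pow_mul, ha4, one_pow], ?_⟩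
  have : (a ^ r) ^ r = a := by
    rw [← pow_mul]
    obtain ⟨k, rfl⟩ := hr
    rw [show (2 * k + 1) * (2 * k + 1) = 4 * (k * k + k) + 1 by ring, pow_succ, pow_mul, ha4]
    simp
  rw [mul_pow, this, ha]; ring

omit h in
theorem im_pow (γ : QuadOrder t n) (r : ℕ) :
    (γ ^ r).im = γ.im * lucasU (2 * γ.re + t * γ.im) (nrm γ) r ∧
      2 * (γ ^ r).re + t * (γ ^ r).im = lucasV (2 * γ.re + t * γ.im) (nrm γ) r := by
  have hrec : ∀ r, γ ^ (r + 2) = ⟨2 * γ.re + t * γ.im, 0⟩ * γ ^ (r + 1) - ⟨nrm γ, 0⟩ * γ ^ r := by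
    intro r
    rw [← mul_conj]
    have : (⟨2 * γ.re + t * γ.im, 0⟩ : QuadOrder t n) = γ + ⟨γ.re + t * γ.im, -γ.im⟩ := by
      ext
      · simp; ring
      · simp
    rw [this]; ring
  induction r using Nat.twoStepInduction with
  | zero => simp [re_one, im_one]
  | one => simp
  | more r h1 h2 =>
    rw [hrec, Lucas.V_add_two, Lucas.U_add_two, ← h1.2, ← h2.2]
    constructor
    · simp only [QuadraticAlgebra.im_sub, QuadraticAlgebra.im_mul, h1.1, h2.1]; ring
    · simp; ring

/-- If `r` is odd and prime to the class group exponent, an element of norm `Y ^ r` is, up to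
the obvious data, an `r`-th power. -/
theorem exists_root {M : ℕ} (hM0 : M ≠ 0)
    (hM : ∀ N s : ℤ, 0 < N → N ∣ s ^ 2 + t * s + n → RegPrincipal (quadIdeal t n N s ^ M))
    {e f Y : ℤ} {r : ℕ} (hr : Odd r) (hrM : r.Coprime M) (hY : 0 < Y)
    (hnorm : e ^ 2 + t * e * f + n * f ^ 2 = Y ^ r) (hcop : IsCoprime f (Y ^ r)) :
    ∃ γ : QuadOrder t n, nrm γ = Y ∧ γ.im * lucasU (2 * γ.re + t * γ.im) Y r = f ∧
      lucasV (2 * γ.re + t * γ.im) Y r = 2 * e + t * f := by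
  obtain ⟨s, hs, hpow⟩ := span_eq_pow h hnorm hcop
  have hξ : nrm (⟨e, f⟩ : QuadOrder t n) = Y ^ r := by rw [nrm_mk, hnorm]
  have hξ0 : nrm (⟨e, f⟩ : QuadOrder t n) ≠ 0 := by rw [hξ]; positivity
  have hr0 : r ≠ 0 := by rintro rfl; simp at hr
  have hIr : RegPrincipal (quadIdeal t n Y s ^ r) := hpow ▸ regPrincipal_of_nrm h hξ0
  have hIM := hM Y s hY ((dvd_pow_self Y hr0).trans hs)
  have hI : RegPrincipal (quadIdeal t n Y s) := by
    by_cases hM1 : M = 1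
    · subst hM1; simpa using hIM
    have hex : ∃ j k : ℕ, r * j = M * k + 1 := by
      obtain ⟨j, hj⟩ := Nat.exists_mul_mod_eq_one_of_coprime hrM (by omega)
      exact ⟨j, r * j / M, by rw [← hj.2]; exact (Nat.div_add_mod _ _).symm⟩
    obtain ⟨j, k, hjk⟩ := hex
    refine RegPrincipal.of_mul_left (I := quadIdeal t n Y s ^ (M * k)) ?_ ?_
    · rw [← pow_succ, ← hjk, pow_mul]; exact hIr.pow j
    · rw [pow_mul]; exact hIM.pow k
  obtain ⟨γ₀, hγ₀, hI⟩ := hI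
  rw [hI, Ideal.span_singleton_pow] at hpow
  obtain ⟨u, hu, hroot⟩ := exists_root_of_span_eq h hr hξ0 hpow.symm
  have hnγ : nrm (u * γ₀) = Y := by
    have e1 : nrm (u * γ₀) ^ r = Y ^ r := by rw [← nrm_pow, ← hroot, hξ]
    exact (pow_left_inj₀ (nrm_nonneg h _) hY.le hr0).mp e1
  have key := im_pow (u * γ₀) r
  rw [← hroot, hnγ] at key
  exact ⟨u * γ₀, hnγ, key.1.symm, key.2.symm⟩

end QuadOrder

namespace QuadOrder

theorem isMaximalOrder_zero {d : ℕ} (hd : Squarefree d) (h4 : d % 4 = 1 ∨ d % 4 = 2) :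
    IsMaximalOrder 0 d where
  disc := by omega
  regular := by
    intro p N N' s hp hN ⟨a, ha⟩ ⟨b, hb⟩ ⟨c, hc⟩
    by_cases h2 : p = 2
    · subst h2 ha hb
      have h5 : s ^ 2 + d = 4 * (a * b) := by push_cast at hN; linear_combination -hN
      rcases Int.even_or_odd' s with ⟨k, rfl | rfl⟩
      · have : (2 * k) ^ 2 = 4 * (k ^ 2) := by ring
        omega
      · have : (2 * k + 1) ^ 2 = 4 * (k ^ 2 + k) + 1 := by ring
        omega
    · have h6 : p ^ 2 ∣ 4 * d := by
        have : ((p ^ 2 : ℕ) : ℤ) ∣ ((4 * d : ℕ) : ℤ) := by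
          refine ⟨4 * (a * b) - c ^ 2, ?_⟩
          push_cast
          rw [ha, hb] at hN
          linear_combination (-4) * hN - (2 * s + p * c) * hc
        exact_mod_cast this
      have hcop : Nat.Coprime (p ^ 2) 4 :=
        Nat.Coprime.pow 2 2 ((Nat.coprime_primes hp Nat.prime_two).mpr h2)
      have h7 := hcop.dvd_of_dvd_mul_left h6
      rw [pow_two] at h7
      have := hd p h7
      exact hp.one_lt.ne' (Nat.isUnit_iff.mp this)

theorem isMaximalOrder_one {d n : ℕ} (hd : Squarefree d) (h4 : d + 1 = 4 * n) (h1 : 1 < n) :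
    IsMaximalOrder 1 n where
  disc := by omega
  regular := by
    intro p N N' s hp hN ⟨a, ha⟩ ⟨b, hb⟩ ⟨c, hc⟩
    have h6 : p ^ 2 ∣ d := by
      have : ((p ^ 2 : ℕ) : ℤ) ∣ ((d : ℕ) : ℤ) := by
        refine ⟨4 * (a * b) - c ^ 2, ?_⟩
        have h4' : (d : ℤ) + 1 = 4 * n := by exact_mod_cast h4
        push_cast
        rw [ha, hb] at hN
        linear_combination (-4) * hN - (2 * s + 1 + p * c) * hc + h4'
      exact_mod_cast this
    rw [pow_two] at h6
    exact hp.one_lt.ne' (Nat.isUnit_iff.mp (hd p h6))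

variable {t n : ℤ}

theorem regPrincipal_sq_of_ramified (h : IsMaximalOrder t n) {N s : ℤ} (h0 : N ≠ 0)
    (hN : N ∣ s ^ 2 + t * s + n) (hr : N ∣ 2 * s + t) :
    RegPrincipal (quadIdeal t n N s ^ 2) := by
  have := regPrincipal_conj h h0 hN
  have hc : N ∣ -s - t - s := by rw [show -s - t - s = -(2 * s + t) by ring]; exact hr.neg_right
  rwa [quadIdeal_congr (t := t) (n := n) hc, ← pow_two] at this

theorem dvd_sub_of_zmod_eq {p : ℕ} {s a : ℤ} (h : (s : ZMod p) = (a : ZMod p)) :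
    (p : ℤ) ∣ s - a := by
  rw [← ZMod.intCast_eq_intCast_iff_dvd_sub]; exact h.symm

theorem zmod_root {p : ℕ} {s : ℤ} (h : (p : ℤ) ∣ s ^ 2 + t * s + n) :
    (s : ZMod p) ^ 2 + (t : ZMod p) * s + (n : ZMod p) = 0 := by
  have := (ZMod.intCast_zmod_eq_zero_iff_dvd _ p).mpr h
  push_cast at this
  exact this

theorem quadIdeal_of_zmod {p : ℕ} {s a : ℤ} (h : (s : ZMod p) = (a : ZMod p)) :
    quadIdeal t n p s = quadIdeal t n p a :=
  quadIdeal_congr (dvd_sub_of_zmod_eq h)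

theorem maximal_gauss : IsMaximalOrder 0 1 :=
  isMaximalOrder_zero (d := 1) (by decide +kernel) (by norm_num)
theorem maximal_two : IsMaximalOrder 0 2 :=
  isMaximalOrder_zero (d := 2) (by decide +kernel) (by norm_num)
theorem maximal_eleven : IsMaximalOrder 1 3 :=
  isMaximalOrder_one (d := 11) (n := 3) (by decide +kernel) (by norm_num) (by norm_num)
theorem maximal_nineteen : IsMaximalOrder 1 5 :=
  isMaximalOrder_one (d := 19) (n := 5) (by decide +kernel) (by norm_num) (by norm_num)
theorem maximal_22 : IsMaximalOrder 0 22 :=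
  isMaximalOrder_zero (d := 22) (by decide +kernel) (by norm_num)
theorem maximal_38 : IsMaximalOrder 0 38 :=
  isMaximalOrder_zero (d := 38) (by decide +kernel) (by norm_num)
theorem maximal_209 : IsMaximalOrder 0 209 :=
  isMaximalOrder_zero (d := 209) (by decide +kernel) (by norm_num)
theorem maximal_418 : IsMaximalOrder 0 418 :=
  isMaximalOrder_zero (d := 418) (by decide +kernel) (by norm_num)

/-- The exponent `M` kills the class group of `ℤ[ω]`. -/
def ClassExponent (t n : ℤ) (M : ℕ) : Prop :=
  ∀ N s : ℤ, 0 < N → N ∣ s ^ 2 + t * s + n → RegPrincipal (quadIdeal t n N s ^ M)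

theorem exponent_of_no_small (h : IsMaximalOrder t n)
    (hs : ∀ (p : ℕ) (s : ℤ), p.Prime → 3 * (p : ℤ) ^ 2 ≤ 4 * n - t ^ 2 →
      (p : ℤ) ∣ s ^ 2 + t * s + n → False) : ClassExponent t n 1 :=
  fun N s => exponent_of_small h (fun p s hp h1 h2 => (hs p s hp h1 h2).elim) N s

theorem prime_le_of_bound {p b : ℕ} {B : ℤ} (h : 3 * (p : ℤ) ^ 2 ≤ B) (hb : B < 3 * (b + 1) ^ 2) :
    p ≤ b := by
  by_contra hlt
  push Not at hlt
  have : (b : ℤ) + 1 ≤ p := by exact_mod_cast hlt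
  nlinarith

theorem exponent_gauss : ClassExponent 0 1 1 := by
  refine exponent_of_no_small maximal_gauss fun p s hp h1 _ => ?_
  have := prime_le_of_bound (b := 1) h1 (by norm_num)
  exact absurd hp.two_le (by omega)

theorem exponent_two : ClassExponent 0 2 1 := by
  refine exponent_of_no_small maximal_two fun p s hp h1 _ => ?_
  have := prime_le_of_bound (b := 1) h1 (by norm_num)
  exact absurd hp.two_le (by omega)

theorem exponent_eleven : ClassExponent 1 3 1 := by
  refine exponent_of_no_small maximal_eleven fun p s hp h1 _ => ?_
  have := prime_le_of_bound (b := 1) h1 (by norm_num)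
  exact absurd hp.two_le (by omega)

theorem exponent_nineteen : ClassExponent 1 5 1 := by
  refine exponent_of_no_small maximal_nineteen fun p s hp h1 h2 => ?_
  have := prime_le_of_bound (b := 2) h1 (by norm_num)
  obtain rfl : p = 2 := le_antisymm this hp.two_le
  exact absurd (zmod_root h2) (by generalize (s : ZMod 2) = x; revert x; decide)

theorem exponent_22 : ClassExponent 0 22 2 := by
  refine fun N s => exponent_of_small maximal_22 (fun p s hp h1 h2 => ?_) N s
  have hle := prime_le_of_bound (b := 5) h1 (by norm_num)
  have hz := zmod_root h2
  interval_cases p <;> try (exfalso; revert hp; decide)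
  · exact regPrincipal_sq_of_ramified maximal_22 (by norm_num) h2 ⟨s, by push_cast; ring⟩
  · exact absurd hz (by generalize (s : ZMod 3) = x; revert x; decide)
  · exact absurd hz (by generalize (s : ZMod 5) = x; revert x; decide)

theorem regPrincipal_two_38 (s : ℤ) (hs : 2 ∣ s) : RegPrincipal (quadIdeal 0 38 2 s ^ 2) :=
  regPrincipal_sq_of_ramified maximal_38 (by norm_num)
    (by obtain ⟨k, rfl⟩ := hs; exact ⟨2 * k ^ 2 + 19, by ring⟩) ⟨s, by ring⟩

theorem two_mul_three_cubed_38 :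
    quadIdeal 0 38 2 4 * quadIdeal 0 38 3 4 ^ 3 = Ideal.span {⟨4, 1⟩} := by
  rw [← quadIdeal_pow maximal_38 (N' := 2) (by norm_num)]
  exact quadIdeal_mul_complement maximal_38 (by norm_num)

theorem regPrincipal_three_38 : RegPrincipal (quadIdeal 0 38 3 4 ^ 6) := by
  refine RegPrincipal.of_mul_left (I := quadIdeal 0 38 2 4 ^ 2) ?_ (regPrincipal_two_38 4 ⟨2, rfl⟩)
  rw [show quadIdeal 0 38 2 4 ^ 2 * quadIdeal 0 38 3 4 ^ 6 =
    (quadIdeal 0 38 2 4 * quadIdeal 0 38 3 4 ^ 3) ^ 2 by ring, two_mul_three_cubed_38]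
  exact (regPrincipal_of_nrm maximal_38 (by simp [nrm])).pow 2

theorem regPrincipal_three_38_conj : RegPrincipal (quadIdeal 0 38 3 2 ^ 6) := by
  refine regPrincipal_pow_conj maximal_38 (by norm_num) (by norm_num) ?_
  rw [quadIdeal_congr (s' := 4) (by norm_num)]
  exact regPrincipal_three_38

theorem regPrincipal_seven_38 : RegPrincipal (quadIdeal 0 38 7 2 ^ 6) := by
  refine RegPrincipal.of_mul_right (J := (quadIdeal 0 38 2 2 * quadIdeal 0 38 3 2) ^ 6) ?_ ?_
  · rw [← quadIdeal_split maximal_38 (N' := 7) (by norm_num), ← mul_pow]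
    exact (regPrincipal_complement maximal_38 (by norm_num)).pow 6
  · rw [mul_pow]
    refine RegPrincipal.mul ?_ regPrincipal_three_38_conj
    rw [show 6 = 2 * 3 by norm_num, pow_mul]
    exact (regPrincipal_two_38 2 ⟨1, rfl⟩).pow 3

theorem exponent_38 : ClassExponent 0 38 6 := by
  refine fun N s => exponent_of_small maximal_38 (fun p s hp h1 h2 => ?_) N s
  have hle := prime_le_of_bound (b := 7) h1 (by norm_num)
  have hz := zmod_root h2
  interval_cases p <;> try (exfalso; revert hp; decide)
  · rw [show 6 = 2 * 3 by norm_num, pow_mul]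
    exact (regPrincipal_sq_of_ramified maximal_38 (by norm_num) h2 ⟨s, by push_cast; ring⟩).pow 3
  · have hs : (s : ZMod 3) = (4 : ℤ) ∨ (s : ZMod 3) = (2 : ℤ) := by
      revert hz; generalize (s : ZMod 3) = x; revert x; decide
    rcases hs with hs | hs <;> rw [quadIdeal_of_zmod hs]
    · exact regPrincipal_three_38
    · exact regPrincipal_three_38_conj
  · exact absurd hz (by generalize (s : ZMod 5) = x; revert x; decide)
  · have hs : (s : ZMod 7) = (2 : ℤ) ∨ (s : ZMod 7) = (-2 : ℤ) := by
      revert hz; generalize (s : ZMod 7) = x; revert x; decide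
    rcases hs with hs | hs <;> rw [quadIdeal_of_zmod hs]
    · exact regPrincipal_seven_38
    · exact regPrincipal_pow_conj maximal_38 (by norm_num) (by norm_num) regPrincipal_seven_38

theorem regPrincipal_seven_418 : RegPrincipal (quadIdeal 0 418 7 4 ^ 4) := by
  rw [quadIdeal_congr (s' := 11) (by norm_num)]
  refine RegPrincipal.of_mul_right (J := quadIdeal 0 418 11 11 ^ 2) ?_
    (regPrincipal_sq_of_ramified maximal_418 (by norm_num) (by norm_num) (by norm_num))
  rw [show 4 = 2 * 2 by norm_num, pow_mul, ← mul_pow,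
    ← quadIdeal_pow maximal_418 (N' := 11) (by norm_num)]
  exact (regPrincipal_complement maximal_418 (by norm_num)).pow 2

theorem exponent_418 : ClassExponent 0 418 4 := by
  refine fun N s => exponent_of_small maximal_418 (fun p s hp h1 h2 => ?_) N s
  have hle := prime_le_of_bound (b := 23) h1 (by norm_num)
  have hz := zmod_root h2
  have hram : (p : ℤ) ∣ 2 * s + 0 → RegPrincipal (quadIdeal 0 418 p s ^ 4) := fun hr => by
    rw [show 4 = 2 * 2 by norm_num, pow_mul]
    exact (regPrincipal_sq_of_ramified maximal_418 (by exact_mod_cast hp.ne_zero) h2 hr).pow 2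
  interval_cases p <;> try (exfalso; revert hp; decide)
  · exact hram ⟨s, by push_cast; ring⟩
  · exact absurd hz (by generalize (s : ZMod 3) = x; revert x; decide)
  · exact absurd hz (by generalize (s : ZMod 5) = x; revert x; decide)
  · have hs : (s : ZMod 7) = (4 : ℤ) ∨ (s : ZMod 7) = (-4 : ℤ) := by
      revert hz; generalize (s : ZMod 7) = x; revert x; decide
    rcases hs with hs | hs <;> rw [quadIdeal_of_zmod hs]
    · exact regPrincipal_seven_418
    · exact regPrincipal_pow_conj maximal_418 (by norm_num) (by norm_num) regPrincipal_seven_418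
  · have hs : (s : ZMod 11) = (0 : ℤ) := by
      revert hz; generalize (s : ZMod 11) = x; revert x; decide
    exact hram (by have := dvd_sub_of_zmod_eq hs; omega)
  · exact absurd hz (by generalize (s : ZMod 13) = x; revert x; decide)
  · exact absurd hz (by generalize (s : ZMod 17) = x; revert x; decide)
  · have hs : (s : ZMod 19) = (0 : ℤ) := by
      revert hz; generalize (s : ZMod 19) = x; revert x; decide
    exact hram (by have := dvd_sub_of_zmod_eq hs; omega)
  · exact absurd hz (by generalize (s : ZMod 23) = x; revert x; decide)

theorem quadIdeal_three_209 : quadIdeal 0 209 3 14 = quadIdeal 0 209 3 (-4 - 0) :=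
  quadIdeal_congr (by norm_num)

theorem regPrincipal_three_five_209 :
    RegPrincipal (quadIdeal 0 209 3 4 ^ 2 * quadIdeal 0 209 5 4 ^ 2) := by
  rw [← quadIdeal_pow maximal_209 (N' := 25) (by norm_num),
    ← quadIdeal_pow maximal_209 (N' := 9) (by norm_num)]
  exact regPrincipal_complement maximal_209 (by norm_num)

theorem regPrincipal_five_three_209 :
    RegPrincipal (quadIdeal 0 209 5 4 * quadIdeal 0 209 3 14 ^ 4) := by
  rw [quadIdeal_congr (N := 5) (s := 4) (s' := 14) (by norm_num),
    ← quadIdeal_pow maximal_209 (N' := 5) (by norm_num)]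
  exact regPrincipal_complement maximal_209 (by norm_num)

theorem regPrincipal_three_209 : RegPrincipal (quadIdeal 0 209 3 4 ^ 10) := by
  refine RegPrincipal.of_mul_left ?_ (regPrincipal_five_three_209.pow 2)
  rw [show (quadIdeal 0 209 5 4 * quadIdeal 0 209 3 14 ^ 4) ^ 2 * quadIdeal 0 209 3 4 ^ 10 =
    quadIdeal 0 209 3 4 ^ 2 * quadIdeal 0 209 5 4 ^ 2 *
      (quadIdeal 0 209 3 4 * quadIdeal 0 209 3 14) ^ 8 by ring]
  refine regPrincipal_three_five_209.mul (RegPrincipal.pow ?_ 8)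
  rw [quadIdeal_three_209]
  exact regPrincipal_conj maximal_209 (by norm_num) (by norm_num)

theorem regPrincipal_three_209_conj : RegPrincipal (quadIdeal 0 209 3 5 ^ 10) := by
  refine regPrincipal_pow_conj maximal_209 (by norm_num) (by norm_num) ?_
  rw [quadIdeal_congr (s' := 4) (by norm_num)]
  exact regPrincipal_three_209

theorem regPrincipal_five_209 : RegPrincipal (quadIdeal 0 209 5 4 ^ 10) := by
  refine RegPrincipal.of_mul_left ?_ regPrincipal_three_209
  rw [show quadIdeal 0 209 3 4 ^ 10 * quadIdeal 0 209 5 4 ^ 10 =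
    (quadIdeal 0 209 3 4 ^ 2 * quadIdeal 0 209 5 4 ^ 2) ^ 5 by ring]
  exact regPrincipal_three_five_209.pow 5

theorem regPrincipal_ramified_209 {N s : ℤ} (h0 : N ≠ 0) (hN : N ∣ s ^ 2 + 0 * s + 209)
    (hr : N ∣ 2 * s + 0) : RegPrincipal (quadIdeal 0 209 N s ^ 10) := by
  rw [show 10 = 2 * 5 by norm_num, pow_mul]
  exact (regPrincipal_sq_of_ramified maximal_209 h0 hN hr).pow 5

theorem regPrincipal_seven_209 : RegPrincipal (quadIdeal 0 209 7 22 ^ 10) := by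
  refine RegPrincipal.of_mul_right
    (J := (quadIdeal 0 209 3 22 ^ 2 * quadIdeal 0 209 11 22) ^ 10) ?_ ?_
  · rw [← quadIdeal_pow maximal_209 (N := 3) (N' := 77) (by norm_num),
      ← quadIdeal_split maximal_209 (N' := 7) (by norm_num), ← mul_pow]
    exact (regPrincipal_complement maximal_209 (by norm_num)).pow 10
  · rw [mul_pow, quadIdeal_congr (N := 3) (s' := 4) (by norm_num), ← pow_mul,
      mul_comm 2 10, pow_mul]
    exact (regPrincipal_three_209.pow 2).mul
      (regPrincipal_ramified_209 (by norm_num) (by norm_num) (by norm_num))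

theorem regPrincipal_thirteen_209 : RegPrincipal (quadIdeal 0 209 13 5 ^ 10) := by
  refine RegPrincipal.of_mul_right
    (J := (quadIdeal 0 209 3 5 ^ 2 * quadIdeal 0 209 2 5) ^ 10) ?_ ?_
  · rw [← quadIdeal_pow maximal_209 (N := 3) (N' := 26) (by norm_num),
      ← quadIdeal_split maximal_209 (N' := 13) (by norm_num), ← mul_pow]
    exact (regPrincipal_complement maximal_209 (by norm_num)).pow 10
  · rw [mul_pow, ← pow_mul, mul_comm 2 10, pow_mul]
    exact (regPrincipal_three_209_conj.pow 2).mul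
      (regPrincipal_ramified_209 (by norm_num) (by norm_num) (by norm_num))

theorem exponent_209 : ClassExponent 0 209 10 := by
  refine fun N s => exponent_of_small maximal_209 (fun p s hp h1 h2 => ?_) N s
  have hle := prime_le_of_bound (b := 16) h1 (by norm_num)
  have hz := zmod_root h2
  have hram : (p : ℤ) ∣ 2 * s + 0 → RegPrincipal (quadIdeal 0 209 p s ^ 10) :=
    regPrincipal_ramified_209 (by exact_mod_cast hp.ne_zero) h2
  interval_cases p <;> try (exfalso; revert hp; decide)
  · exact hram ⟨s, by push_cast; ring⟩
  · have hs : (s : ZMod 3) = (4 : ℤ) ∨ (s : ZMod 3) = (-4 : ℤ) := by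
      revert hz; generalize (s : ZMod 3) = x; revert x; decide
    rcases hs with hs | hs <;> rw [quadIdeal_of_zmod hs]
    · exact regPrincipal_three_209
    · exact regPrincipal_pow_conj maximal_209 (by norm_num) (by norm_num) regPrincipal_three_209
  · have hs : (s : ZMod 5) = (4 : ℤ) ∨ (s : ZMod 5) = (-4 : ℤ) := by
      revert hz; generalize (s : ZMod 5) = x; revert x; decide
    rcases hs with hs | hs <;> rw [quadIdeal_of_zmod hs]
    · exact regPrincipal_five_209
    · exact regPrincipal_pow_conj maximal_209 (by norm_num) (by norm_num) regPrincipal_five_209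
  · have hs : (s : ZMod 7) = (22 : ℤ) ∨ (s : ZMod 7) = (-22 : ℤ) := by
      revert hz; generalize (s : ZMod 7) = x; revert x; decide
    rcases hs with hs | hs <;> rw [quadIdeal_of_zmod hs]
    · exact regPrincipal_seven_209
    · exact regPrincipal_pow_conj maximal_209 (by norm_num) (by norm_num) regPrincipal_seven_209
  · have hs : (s : ZMod 11) = (0 : ℤ) := by
      revert hz; generalize (s : ZMod 11) = x; revert x; decide
    exact hram (by have := dvd_sub_of_zmod_eq hs; omega)
  · have hs : (s : ZMod 13) = (5 : ℤ) ∨ (s : ZMod 13) = (-5 : ℤ) := by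
      revert hz; generalize (s : ZMod 13) = x; revert x; decide
    rcases hs with hs | hs <;> rw [quadIdeal_of_zmod hs]
    · exact regPrincipal_thirteen_209
    · exact regPrincipal_pow_conj maximal_209 (by norm_num) (by norm_num) regPrincipal_thirteen_209

end QuadOrder

namespace Lucas

section Eval

/-- A pair of consecutive Lucas terms, in a form suited to kernel evaluation. -/
def pair {R : Type*} [CommRing R] (T Q : R) : ℕ → R × R
  | 0 => (0, 1)
  | n + 1 => ((pair T Q n).2, T * (pair T Q n).2 - Q * (pair T Q n).1)

theorem pair_eq {R : Type*} [CommRing R] (T Q : R) (n : ℕ) :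
    pair T Q n = (lucasU T Q n, lucasU T Q (n + 1)) := by
  induction n with
  | zero => rfl
  | succ n ih => rw [pair, ih, U_add_two]

end Eval

theorem rank_two : ∀ T Q : ZMod 2, Q ≠ 0 → lucasU T Q 2 = 0 ∨ lucasU T Q 3 = 0 := by
  simp only [U_two, U_three]; decide

theorem rank_eleven : ∀ T Q : ZMod 11, Q ≠ 0 →
    lucasU T Q 10 = 0 ∨ lucasU T Q 11 = 0 ∨ lucasU T Q 12 = 0 := by
  have : ∀ T Q : ZMod 11, Q ≠ 0 →
      (pair T Q 10).1 = 0 ∨ (pair T Q 10).2 = 0 ∨ (pair T Q 11).2 = 0 := by decide +kernel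
  simpa [pair_eq] using this

theorem rank_nineteen : ∀ T Q : ZMod 19, Q ≠ 0 →
    lucasU T Q 18 = 0 ∨ lucasU T Q 19 = 0 ∨ lucasU T Q 20 = 0 := by
  have : ∀ T Q : ZMod 19, Q ≠ 0 →
      (pair T Q 18).1 = 0 ∨ (pair T Q 18).2 = 0 ∨ (pair T Q 19).2 = 0 := by decide +kernel
  simpa [pair_eq] using this

theorem U_eleven {R : Type*} [CommRing R] (T Q : R) : lucasU T Q 11 =
    (T ^ 2 - 4 * Q) ^ 5 + 11 * ((T ^ 2 - 4 * Q) * ((T ^ 2 - 4 * Q) ^ 3 * Q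
      + 4 * (T ^ 2 - 4 * Q) ^ 2 * Q ^ 2 + 7 * (T ^ 2 - 4 * Q) * Q ^ 3 + 5 * Q ^ 4) + Q ^ 5) := by
  have h := U_add T Q 5 5
  norm_num [U_five, show lucasU T Q 6 = T ^ 5 - 4 * T ^ 3 * Q + 3 * T * Q ^ 2 by
    rw [U_mul T Q 3 2, U_two, U_three, lucasV, U_three, U_add_two T Q 2, U_three, U_two]; ring] at h
  rw [h]; ring

theorem U_nineteen {R : Type*} [CommRing R] (T Q : R) : lucasU T Q 19 =
    (T ^ 2 - 4 * Q) ^ 9 + 19 * ((T ^ 2 - 4 * Q) * ((T ^ 2 - 4 * Q) ^ 7 * Q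
      + 8 * (T ^ 2 - 4 * Q) ^ 6 * Q ^ 2 + 35 * (T ^ 2 - 4 * Q) ^ 5 * Q ^ 3
      + 91 * (T ^ 2 - 4 * Q) ^ 4 * Q ^ 4 + 143 * (T ^ 2 - 4 * Q) ^ 3 * Q ^ 5
      + 132 * (T ^ 2 - 4 * Q) ^ 2 * Q ^ 6 + 66 * (T ^ 2 - 4 * Q) * Q ^ 7 + 15 * Q ^ 8)
      + Q ^ 9) := by
  have h := U_add T Q 9 9
  have h4 := U_add T Q 4 4
  have h5 := U_add T Q 4 5
  have e4 : lucasU T Q 4 = T ^ 3 - 2 * T * Q := by rw [U_add_two, U_three, U_two]; ring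
  have e6 : lucasU T Q 6 = T ^ 5 - 4 * T ^ 3 * Q + 3 * T * Q ^ 2 := by
    rw [U_add_two, U_five, e4]; ring
  norm_num [U_five, e4, e6] at h h4 h5
  rw [h, h4, h5]; ring

/-- The primes for which the law of repetition is needed below. -/
theorem U_self_structure {q : ℕ} (hq : q = 11 ∨ q = 19) (T Q : ℤ) :
    ∃ e : ℤ, lucasU T Q q =
      (T ^ 2 - 4 * Q) ^ (q / 2) + q * ((T ^ 2 - 4 * Q) * e + Q ^ (q / 2)) := by
  rcases hq with rfl | rfl
  · exact ⟨_, by simpa using U_eleven T Q⟩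
  · exact ⟨_, by simpa using U_nineteen T Q⟩

theorem dvd_disc_of_dvd_U {q : ℕ} (hq : q = 11 ∨ q = 19) {T Q : ℤ}
    (h : (q : ℤ) ∣ lucasU T Q q) : (q : ℤ) ∣ T ^ 2 - 4 * Q := by
  have hp : Prime (q : ℤ) := by rcases hq with rfl | rfl <;> norm_num
  obtain ⟨e, he⟩ := U_self_structure hq T Q
  rw [he] at h
  exact hp.dvd_of_dvd_pow ((dvd_add_left (Dvd.intro _ rfl)).mp h)

theorem sq_dvd_U_sub {q : ℕ} (hq : q = 11 ∨ q = 19) {T Q : ℤ}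
    (h : (q : ℤ) ∣ T ^ 2 - 4 * Q) : (q : ℤ) ^ 2 ∣ lucasU T Q q - q * Q ^ (q / 2) := by
  obtain ⟨e, he⟩ := U_self_structure hq T Q
  obtain ⟨c, hc⟩ := h
  have h1 : (q : ℤ) ^ 2 ∣ (q * c) ^ (q / 2) :=
    (pow_dvd_pow_of_dvd (Dvd.intro _ rfl) 2).trans
      (pow_dvd_pow _ (by rcases hq with rfl | rfl <;> norm_num))
  rw [he, hc, show ((q : ℤ) * c) ^ (q / 2) + q * (q * c * e + Q ^ (q / 2)) - q * Q ^ (q / 2)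
    = (q * c) ^ (q / 2) + q ^ 2 * (c * e) by ring]
  exact dvd_add h1 (Dvd.intro _ rfl)

theorem not_sq_dvd_U {q : ℕ} (hq : q = 11 ∨ q = 19) {T Q : ℤ}
    (h : (q : ℤ) ∣ T ^ 2 - 4 * Q) (hQ : ¬ (q : ℤ) ∣ Q) : ¬ (q : ℤ) ^ 2 ∣ lucasU T Q q := by
  have hp : Prime (q : ℤ) := by rcases hq with rfl | rfl <;> norm_num
  intro h2
  have h3 := (dvd_sub_right h2).mp (sq_dvd_U_sub hq h)
  rw [sq] at h3
  exact hQ (hp.dvd_of_dvd_pow (Int.dvd_of_mul_dvd_mul_left hp.ne_zero h3))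

theorem exists_half_mod {q : ℕ} (hq : q = 11 ∨ q = 19) {T Q : ℤ}
    (h : (q : ℤ) ∣ T ^ 2 - 4 * Q) : ∃ a : ZMod q, (T : ZMod q) = 2 * a ∧ (Q : ZMod q) = a ^ 2 := by
  have h1 := (ZMod.intCast_zmod_eq_zero_iff_dvd _ _).mpr h
  push_cast at h1
  generalize (T : ZMod q) = T', (Q : ZMod q) = Q' at *
  rcases hq with rfl | rfl <;> revert T' Q' <;> decide +kernel

/-- The law of repetition at a prime dividing the discriminant. -/
theorem pow_dvd_of_pow_dvd_U {q : ℕ} (hq : q = 11 ∨ q = 19) {T Q : ℤ}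
    (h : (q : ℤ) ∣ T ^ 2 - 4 * Q) (hQ : ¬ (q : ℤ) ∣ Q) (k m : ℕ)
    (hm : (q : ℤ) ^ k ∣ lucasU T Q m) : q ^ k ∣ m := by
  have hpn : q.Prime := by rcases hq with rfl | rfl <;> norm_num
  have hp : Prime (q : ℤ) := Nat.prime_iff_prime_int.mp hpn
  have := Fact.mk hpn
  induction k generalizing m with
  | zero => simp
  | succ k ih =>
    rcases m with _ | m
    · simp
    obtain ⟨a, hT, hQ'⟩ := exists_half_mod hq h
    have h1 : q ∣ m + 1 := by
      have h2 := (ZMod.intCast_zmod_eq_zero_iff_dvd _ _).mpr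
        ((dvd_pow_self _ k.succ_ne_zero).trans hm)
      rw [U_intCast_zmod, hT, hQ', U_of_disc_zero, mul_eq_zero] at h2
      rcases h2 with h2 | h2
      · rw [← Nat.cast_one, ← Nat.cast_add] at h2
        exact (ZMod.natCast_eq_zero_iff _ _).mp h2
      · refine absurd ((ZMod.intCast_zmod_eq_zero_iff_dvd _ _).mp ?_) hQ
        rw [hQ', eq_zero_of_pow_eq_zero h2]; simp
    obtain ⟨w, hw⟩ := h1
    rw [hw, mul_comm q w] at hm ⊢
    rw [pow_succ]
    refine mul_dvd_mul_right (ih w ?_) q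
    rw [U_mul] at hm
    have hd : (q : ℤ) ∣ lucasV T Q w ^ 2 - 4 * Q ^ w := by
      rw [V_sq, add_sub_cancel_right]; exact h.mul_right _
    have h3 := not_sq_dvd_U hq hd (fun h' => hQ (hp.dvd_of_dvd_pow h'))
    by_contra hcon
    obtain ⟨j, hj, hj2, hj3⟩ : ∃ j ≤ k, (q : ℤ) ^ j ∣ lucasU T Q w ∧
        ¬ (q : ℤ) ^ (j + 1) ∣ lucasU T Q w := by
      by_contra! hno
      have : ∀ j ≤ k, (q : ℤ) ^ j ∣ lucasU T Q w := by
        intro j hj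
        induction j with
        | zero => simp
        | succ j ihj => exact hno j (by omega) (ihj (by omega))
      exact hcon (this k le_rfl)
    have hjk : j < k := lt_of_le_of_ne hj (by rintro rfl; exact hcon hj2)
    obtain ⟨c, hc⟩ := hj2
    rw [hc, show k + 1 = j + (k + 1 - j) by omega, pow_add, mul_assoc] at hm
    have h4 := Int.dvd_of_mul_dvd_mul_left (pow_ne_zero _ hp.ne_zero) hm
    have hc' : ¬ (q : ℤ) ∣ c := by
      rintro ⟨c', rfl⟩
      exact hj3 ⟨c', by rw [hc]; ring⟩
    have h5 := hp.pow_dvd_of_dvd_mul_left _ hc' h4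
    exact h3 ((pow_dvd_pow _ (by omega)).trans h5)

theorem U_odd_ne_one {q : ℕ} (hq : q = 11 ∨ q = 19) {T Q : ℤ}
    (hd : (q : ℤ) ∣ T ^ 2 - 4 * Q) {g h : ℕ} (hg : (q : ℤ) ∣ Q ^ g - 1) (hgh : g ∣ h)
    (hqg : ¬ q ∣ g) (hh : h ≠ 0) : lucasU T Q (2 * h + 1) ≠ 1 := by
  have hpn : q.Prime := by rcases hq with rfl | rfl <;> norm_num
  have hp : Prime (q : ℤ) := Nat.prime_iff_prime_int.mp hpn
  have hQ : ¬ (q : ℤ) ∣ Q := by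
    intro h1
    have hg0 : g ≠ 0 := by rintro rfl; exact hqg (dvd_zero _)
    exact hp.not_dvd_one ((dvd_sub_right (dvd_pow h1 hg0)).mp hg)
  intro hU
  have hV : ¬ (q : ℤ) ∣ lucasV T Q (h + 1) := by
    intro h1
    have h2 := V_sq T Q (h + 1)
    have h3 : (q : ℤ) ∣ 4 * Q ^ (h + 1) := by
      rw [show 4 * Q ^ (h + 1) = lucasV T Q (h + 1) ^ 2
        - (T ^ 2 - 4 * Q) * lucasU T Q (h + 1) ^ 2 by rw [h2]; ring]
      exact dvd_sub (dvd_pow h1 two_ne_zero) (hd.mul_right _)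
    rcases hp.dvd_or_dvd h3 with h4 | h4
    · rcases hq with rfl | rfl <;> norm_num at h4
    · exact hQ (hp.dvd_of_dvd_pow h4)
  have key : ∀ k, q ^ k ∣ h := by
    intro k
    induction k with
    | zero => simp
    | succ k ih =>
      obtain ⟨m, rfl⟩ := Nat.Coprime.mul_dvd_of_dvd_of_dvd
        (Nat.Coprime.pow_right k ((Nat.Prime.coprime_iff_not_dvd hpn).mpr hqg).symm) hgh ih
      have h1 : (q : ℤ) ^ (k + 1) ∣ Q ^ (g * q ^ k * m) - 1 := by
        have h2 := (dvd_sub_pow_of_dvd_sub hg k)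
        rw [one_pow, ← pow_mul] at h2
        rw [pow_mul Q (g * q ^ k) m]
        exact h2.trans (sub_one_dvd_pow_sub_one _ m)
      refine pow_dvd_of_pow_dvd_U hq hd hQ _ _ ?_
      have h3 := U_odd_sub T Q (g * q ^ k * m)
      rw [hU] at h3
      refine hp.pow_dvd_of_dvd_mul_right _ hV ?_
      rw [← h3]
      exact (dvd_sub_comm).mp h1
  have h1 := Nat.le_of_dvd (Nat.pos_of_ne_zero hh) (key h)
  exact absurd h1 (not_le.mpr (Nat.lt_pow_self hpn.one_lt))

end Lucas

/-- Integers all of whose prime factors are among `2`, `11`, `19`, and prime to `Q`. -/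
def SmoothPrimeTo (Q u : ℤ) : Prop :=
  ∀ ℓ : ℕ, ℓ.Prime → (ℓ : ℤ) ∣ u → (ℓ = 2 ∨ ℓ = 11 ∨ ℓ = 19) ∧ ¬ (ℓ : ℤ) ∣ Q

namespace SmoothPrimeTo

theorem of_dvd {Q u v : ℤ} (h : SmoothPrimeTo Q u) (hv : v ∣ u) : SmoothPrimeTo Q v :=
  fun ℓ hℓ hd => h ℓ hℓ (hd.trans hv)

theorem rank {T Q u : ℤ} (h : SmoothPrimeTo Q u) {ℓ : ℕ} (hℓ : ℓ.Prime) (hd : (ℓ : ℤ) ∣ u) :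
    (ℓ = 2 ∧ ((ℓ : ℤ) ∣ lucasU T Q 2 ∨ (ℓ : ℤ) ∣ lucasU T Q 3)) ∨
    (ℓ = 11 ∧ ((ℓ : ℤ) ∣ lucasU T Q 10 ∨ (ℓ : ℤ) ∣ lucasU T Q 11 ∨ (ℓ : ℤ) ∣ lucasU T Q 12)) ∨
    (ℓ = 19 ∧ ((ℓ : ℤ) ∣ lucasU T Q 18 ∨ (ℓ : ℤ) ∣ lucasU T Q 19 ∨ (ℓ : ℤ) ∣ lucasU T Q 20)) := by
  obtain ⟨h1, h2⟩ := h ℓ hℓ hd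
  rw [← ZMod.intCast_zmod_eq_zero_iff_dvd] at h2
  simp only [← ZMod.intCast_zmod_eq_zero_iff_dvd, Lucas.U_intCast_zmod]
  rcases h1 with rfl | rfl | rfl
  · exact Or.inl ⟨rfl, Lucas.rank_two _ _ h2⟩
  · exact Or.inr (Or.inl ⟨rfl, Lucas.rank_eleven _ _ h2⟩)
  · exact Or.inr (Or.inr ⟨rfl, Lucas.rank_nineteen _ _ h2⟩)

end SmoothPrimeTo

namespace Lucas

/-- A prime-index Lucas number with all prime factors in `{2, 11, 19}` is a unit, or is `±p` with
`p` dividing the discriminant. -/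
theorem natAbs_U_prime {T Q : ℤ} {p : ℕ} (hp : p.Prime) (h7 : 7 ≤ p) (h0 : lucasU T Q p ≠ 0)
    (hs : SmoothPrimeTo Q (lucasU T Q p)) :
    (lucasU T Q p).natAbs = 1 ∨
      ((p = 11 ∨ p = 19) ∧ (p : ℤ) ∣ T ^ 2 - 4 * Q ∧ (lucasU T Q p).natAbs = p) := by
  have key : ∀ ℓ : ℕ, ℓ.Prime → (ℓ : ℤ) ∣ lucasU T Q p → (ℓ = 11 ∨ ℓ = 19) ∧ ℓ = p := by
    intro ℓ hℓ hd
    have hQ := (hs ℓ hℓ hd).2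
    have aux : ∀ m, (ℓ : ℤ) ∣ lucasU T Q m → p ∣ m := by
      intro m hm
      by_contra hpm
      have h1 := dvd_U_gcd hℓ hQ p m hd hm
      rw [(Nat.Prime.coprime_iff_not_dvd hp).mpr hpm, U_one] at h1
      exact hℓ.one_lt.ne' (by exact_mod_cast Int.eq_one_of_dvd_one (by positivity) h1)
    have hlow : ∀ m, m ∈ [2, 3, 10, 12, 18, 20] → ¬ (ℓ : ℤ) ∣ lucasU T Q m := by
      intro m hm hdm
      have h1 := aux m hdm
      simp only [List.mem_cons, List.not_mem_nil, or_false] at hm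
      have h2 : p ≤ m := Nat.le_of_dvd (by omega) h1
      have h3 : p ≤ 20 := by omega
      interval_cases p <;> first | omega | (exact absurd hp (by norm_num))
    rcases hs.rank hℓ hd (T := T) with ⟨rfl, h | h⟩ | ⟨rfl, h | h | h⟩ | ⟨rfl, h | h | h⟩
    · exact absurd h (hlow _ (by simp))
    · exact absurd h (hlow _ (by simp))
    · exact absurd h (hlow _ (by simp))
    · exact ⟨Or.inl rfl, ((Nat.prime_dvd_prime_iff_eq hp (by norm_num)).mp (aux _ h)).symm⟩
    · exact absurd h (hlow _ (by simp))
    · exact absurd h (hlow _ (by simp))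
    · exact ⟨Or.inr rfl, ((Nat.prime_dvd_prime_iff_eq hp (by norm_num)).mp (aux _ h)).symm⟩
    · exact absurd h (hlow _ (by simp))
  by_cases h1 : (lucasU T Q p).natAbs = 1
  · exact Or.inl h1
  right
  obtain ⟨ℓ, hℓ, hd⟩ := Nat.exists_prime_and_dvd h1
  have hd' : (ℓ : ℤ) ∣ lucasU T Q p := Int.natCast_dvd.mpr hd
  obtain ⟨hq, rfl⟩ := key ℓ hℓ hd'
  have hdisc := dvd_disc_of_dvd_U hq hd'
  refine ⟨hq, hdisc, ?_⟩
  have h2 := Nat.eq_prime_pow_of_unique_prime_dvd (p := ℓ) (Int.natAbs_ne_zero.mpr h0)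
    (fun {r} hr hrd => (key r hr (Int.natCast_dvd.mpr hrd)).2)
  have h3 := not_sq_dvd_U hq hdisc (hs ℓ hℓ hd').2
  generalize (lucasU T Q ℓ).natAbs.primeFactorsList.length = j at h2
  have : j < 2 := by
    by_contra hj
    apply h3
    have : ((ℓ ^ 2 : ℕ) : ℤ) ∣ lucasU T Q ℓ := by
      rw [Int.natCast_dvd, h2]; exact pow_dvd_pow _ (by omega)
    exact_mod_cast this
  interval_cases j
  · simp at h2; omega
  · simpa using h2

end Lucas

/-- `x² + d b² = y ^ n` with `d` squarefree and `b` composed of the primes `2`, `11`, `19`. -/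
structure IsSolution (d : ℕ) (x b y : ℤ) (n : ℕ) : Prop where
  mem : d ∈ [1, 2, 11, 19, 22, 38, 209, 418]
  pos : 0 < x
  three_le : 3 ≤ y
  odd : Odd y
  smooth : ∃ i j k : ℕ, b = 2 ^ i * 11 ^ j * 19 ^ k
  coprime : IsCoprime (d * b) y
  eq : x ^ 2 + d * b ^ 2 = y ^ n

/-- A Lucas pair `(T, Y)` realising `x + b √(-d)` as the `r`-th power of `(T + c √(-d)) / 2`. -/
structure IsRoot (d : ℕ) (x b Y : ℤ) (r : ℕ) (T c : ℤ) : Prop where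
  norm : T ^ 2 + d * c ^ 2 = 4 * Y
  im : c * lucasU T Y r = 2 * b
  re : lucasV T Y r = 2 * x

open QuadOrder

namespace IsSolution

variable {d : ℕ} {x b y : ℤ} {n : ℕ}

theorem d_pos (h : IsSolution d x b y n) : 0 < d := by
  have := h.mem
  simp only [List.mem_cons, List.not_mem_nil, or_false] at this
  omega

theorem b_pos (h : IsSolution d x b y n) : 0 < b := by
  obtain ⟨i, j, k, rfl⟩ := h.smooth
  positivity

theorem root_pow {m : ℕ} (h : IsSolution d x b y (m * n)) (hm : m ≠ 0) :
    IsSolution d x b (y ^ m) n where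
  mem := h.mem
  pos := h.pos
  three_le := h.three_le.trans (le_self_pow₀ (by linarith [h.three_le]) hm)
  odd := h.odd.pow
  smooth := h.smooth
  coprime := h.coprime.pow_right
  eq := by rw [h.eq, pow_mul]

theorem smoothPrimeTo (h : IsSolution d x b y n) : SmoothPrimeTo y (2 * b) := by
  intro ℓ hℓ hd
  have hp := Nat.prime_iff_prime_int.mp hℓ
  have h2 : ℓ = 2 → ¬ (ℓ : ℤ) ∣ y := by
    rintro rfl hy
    have := h.odd
    grind
  rcases hp.dvd_or_dvd hd with h1 | h1
  · have : ℓ = 2 := (Nat.prime_dvd_prime_iff_eq hℓ Nat.prime_two).mp (by exact_mod_cast h1)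
    exact ⟨Or.inl this, h2 this⟩
  · refine ⟨?_, fun hy => ?_⟩
    · obtain ⟨i, j, k, rfl⟩ := h.smooth
      have aux : ∀ q e : ℕ, q.Prime → (ℓ : ℤ) ∣ (q : ℤ) ^ e → ℓ = q := fun q e hq hdv =>
        (Nat.prime_dvd_prime_iff_eq hℓ hq).mp (by exact_mod_cast hp.dvd_of_dvd_pow hdv)
      rcases hp.dvd_or_dvd h1 with h1 | h1
      · rcases hp.dvd_or_dvd h1 with h1 | h1
        · exact Or.inl (aux 2 i (by norm_num) h1)
        · exact Or.inr (Or.inl (aux 11 j (by norm_num) h1))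
      · exact Or.inr (Or.inr (aux 19 k (by norm_num) h1))
    · have h3 := h.coprime.isUnit_of_dvd' (h1.mul_left _) hy
      exact hp.not_isUnit h3

theorem exists_root (h : IsSolution d x b y n) (hr : Odd n) (h38 : d = 38 → ¬ 3 ∣ n)
    (h209 : d = 209 → ¬ 5 ∣ n) : ∃ T c, IsRoot d x b y n T c := by
  have hy : 0 < y := by linarith [h.three_le]
  have hb : IsCoprime b (y ^ n) := h.coprime.of_mul_left_right.pow_right
  have h2b : IsCoprime (2 * b) (y ^ n) := by
    refine IsCoprime.mul_left ?_ hb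
    exact (Int.isCoprime_two_left.mpr h.odd).pow_right
  have r2 : n.Coprime 2 := Nat.coprime_two_right.mpr hr
  have zero_case : ∀ M : ℕ, M ≠ 0 → n.Coprime M → IsMaximalOrder 0 d → ClassExponent 0 d M →
      ∃ T c, IsRoot d x b y n T c := by
    intro M hM hco hmax hexp
    obtain ⟨γ, h1, h2, h3⟩ := QuadOrder.exists_root (t := 0) (n := d) hmax hM hexp hr hco hy
      (e := x) (f := b) (by rw [← h.eq]; ring) hb
    rw [zero_mul, add_zero] at h2 h3
    refine ⟨2 * γ.re, 2 * γ.im, ?_, ?_, ?_⟩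
    · rw [← h1, nrm]; ring
    · rw [mul_assoc, h2]
    · rw [h3]; ring
  have one_case : ∀ M : ℤ, (d : ℤ) = 4 * M - 1 → IsMaximalOrder 1 M → ClassExponent 1 M 1 →
      ∃ T c, IsRoot d x b y n T c := by
    intro M hM hmax hexp
    obtain ⟨γ, h1, h2, h3⟩ := QuadOrder.exists_root (t := 1) (n := M) hmax one_ne_zero hexp hr
      (Nat.coprime_one_right n) hy (e := x - b) (f := 2 * b) (by rw [← h.eq, hM]; ring) h2b
    refine ⟨2 * γ.re + 1 * γ.im, γ.im, ?_, h2, ?_⟩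
    · rw [← h1, nrm, hM]; ring
    · rw [h3]; ring
  have hmem := h.mem
  simp only [List.mem_cons, List.not_mem_nil, or_false] at hmem
  rcases hmem with rfl | rfl | rfl | rfl | rfl | rfl | rfl | rfl
  · exact zero_case 1 (by norm_num) (by simp) maximal_gauss exponent_gauss
  · exact zero_case 1 (by norm_num) (by simp) maximal_two exponent_two
  · exact one_case 3 (by norm_num) maximal_eleven exponent_eleven
  · exact one_case 5 (by norm_num) maximal_nineteen exponent_nineteen
  · exact zero_case 2 (by norm_num) r2 maximal_22 exponent_22
  · refine zero_case 6 (by norm_num) ?_ maximal_38 exponent_38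
    exact Nat.Coprime.mul_right (m := 2) (n := 3) r2
      ((Nat.Prime.coprime_iff_not_dvd Nat.prime_three).mpr (h38 rfl)).symm
  · refine zero_case 10 (by norm_num) ?_ maximal_209 exponent_209
    exact Nat.Coprime.mul_right (m := 2) (n := 5) r2
      ((Nat.Prime.coprime_iff_not_dvd Nat.prime_five).mpr (h209 rfl)).symm
  · exact zero_case 4 (by norm_num) (Nat.Coprime.mul_right (m := 2) (n := 2) r2 r2)
      maximal_418 exponent_418

end IsSolution

namespace Lucas

theorem V_mul_two (T Q : ℤ) (n : ℕ) : 2 * lucasV T Q (n + 1) =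
    T * lucasV T Q n + (T ^ 2 - 4 * Q) * lucasU T Q n := by
  simp only [lucasV, U_add_two]; ring

/-- The trivial bound `|U_{n+1}| ≤ (n+1) Q^{n/2}` when the roots are complex conjugate. -/
theorem abs_U_le {T s : ℝ} (hs : 0 ≤ s) (hT : |T| ≤ 2 * s) (n : ℕ) :
    |lucasU T (s ^ 2) (n + 1)| ≤ (n + 1) * s ^ n := by
  induction n with
  | zero => simp
  | succ n ih =>
    have hV : |lucasV T (s ^ 2) (n + 1)| ≤ 2 * s ^ (n + 1) := by
      refine abs_le_of_sq_le_sq ?_ (by positivity)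
      rw [V_sq, ← pow_mul, mul_pow, ← pow_mul]
      have h1 : T ^ 2 ≤ 4 * s ^ 2 := by
        have := sq_le_sq' (by linarith [neg_abs_le T, abs_nonneg T]) hT
        rw [sq_abs] at this; linarith
      have : (T ^ 2 - 4 * s ^ 2) * lucasU T (s ^ 2) (n + 1) ^ 2 ≤ 0 :=
        mul_nonpos_of_nonpos_of_nonneg (by linarith) (sq_nonneg _)
      rw [mul_comm 2 (n + 1), mul_comm (n + 1) 2]
      linarith
    have h2 : 2 * lucasU T (s ^ 2) (n + 2) = T * lucasU T (s ^ 2) (n + 1)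
        + lucasV T (s ^ 2) (n + 1) := by
      rw [lucasV]; ring
    have h3 : |2 * lucasU T (s ^ 2) (n + 2)| ≤ 2 * s * ((n + 1) * s ^ n) + 2 * s ^ (n + 1) := by
      rw [h2]
      refine (abs_add_le _ _).trans (add_le_add ?_ hV)
      rw [abs_mul]
      exact mul_le_mul hT ih (abs_nonneg _) (by positivity)
    rw [abs_mul, abs_two] at h3
    push_cast
    rw [pow_succ s n] at h3 ⊢
    change (_ : ℝ) * |lucasU T (s ^ 2) (n + 2)| ≤ _ at h3
    change |lucasU T (s ^ 2) (n + 2)| ≤ _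
    linarith

theorem sq_U_le {T Q : ℤ} (hQ : 0 ≤ Q) (hT : T ^ 2 ≤ 4 * Q) (n : ℕ) :
    lucasU T Q (n + 1) ^ 2 ≤ (n + 1) ^ 2 * Q ^ n := by
  have hQ' : (0 : ℝ) ≤ Q := by exact_mod_cast hQ
  have hs := Real.sq_sqrt hQ'
  have h1 : |(T : ℝ)| ≤ 2 * √(Q : ℝ) := by
    refine abs_le_of_sq_le_sq ?_ (by positivity)
    rw [mul_pow, hs]; exact_mod_cast (by linarith : T ^ 2 ≤ 2 ^ 2 * Q)
  have h2 := abs_U_le (Real.sqrt_nonneg _) h1 n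
  have h3 := pow_le_pow_left₀ (abs_nonneg _) h2 2
  rw [sq_abs, hs, mul_pow, ← pow_mul, mul_comm n 2, pow_mul, hs] at h3
  have h4 := map_U T Q (Int.castRingHom ℝ) (n + 1)
  simp only [eq_intCast] at h4
  rw [← h4] at h3
  exact_mod_cast h3

/-- If the discriminant is small compared with `Q`, then `2 U_{i+1} ≥ T U_i` for small `i`. -/
theorem UV_pos {T Q D : ℤ} (hT : 0 < T) (hQ : 0 < Q) (hD : T ^ 2 - 4 * Q = -D) (hD0 : 0 ≤ D)
    {q : ℕ} (hq : D * q ^ 2 < 4 * Q) (i : ℕ) (hi : i + 1 < q) :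
    0 < lucasU T Q (i + 1) ∧ 0 < lucasV T Q (i + 1) := by
  induction i with
  | zero => simpa using hT
  | succ i ih =>
    obtain ⟨hU, hV⟩ := ih (by omega)
    have eU : 2 * lucasU T Q (i + 2) = T * lucasU T Q (i + 1) + lucasV T Q (i + 1) := by
      rw [lucasV]; ring
    have eV := V_mul_two T Q (i + 1)
    rw [hD] at eV
    constructor
    · nlinarith [mul_pos hT hU]
    · have hle := sq_U_le hQ.le (by linarith) i (T := T) (Q := Q)
      have hV2 := V_sq T Q (i + 1)
      rw [hD] at hV2
      set U := lucasU T Q (i + 1)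
      set V := lucasV T Q (i + 1)
      have hP : 0 < Q ^ i := by positivity
      have hi2 : ((i : ℤ) + 1) ^ 2 + 1 ≤ q ^ 2 := by
        have : (i : ℤ) + 2 ≤ q := by exact_mod_cast (by omega : i + 2 ≤ q)
        nlinarith
      have h1 : D * (U ^ 2 + Q ^ i) < 4 * Q ^ (i + 1) := by
        have a1 : D * (U ^ 2 + Q ^ i) ≤ D * (q ^ 2 * Q ^ i) := by
          refine mul_le_mul_of_nonneg_left ?_ hD0
          nlinarith
        rw [pow_succ Q]
        nlinarith
      have h2 : (D * U) ^ 2 < (T * V) ^ 2 := by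
        rw [mul_pow T V, hV2, show T ^ 2 = 4 * Q - D by linarith]
        have : 0 < 4 * Q * (4 * Q ^ (i + 1) - D * (U ^ 2 + Q ^ i)) := by
          have : 0 < 4 * Q ^ (i + 1) - D * (U ^ 2 + Q ^ i) := by linarith
          positivity
        rw [pow_succ Q] at this ⊢
        linarith
      have h3 := abs_lt_of_sq_lt_sq h2 (by positivity)
      have h4 := (abs_lt.mp h3).2
      change 0 < lucasV T Q (i + 1 + 1)
      linarith

theorem pow_le_U {T Q D : ℤ} (hT : T ≠ 0) (hQ : 0 < Q) (hD : T ^ 2 - 4 * Q = -D) (hD0 : 0 ≤ D)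
    {h : ℕ} (hq : D * ((2 * h + 1 : ℕ) : ℤ) ^ 2 < 4 * Q) :
    (T ^ 2) ^ h ≤ 4 ^ h * lucasU T Q (2 * h + 1) := by
  wlog hpos : 0 < T generalizing T
  · have := this (T := -T) (by simpa) (by simpa using hD) (by omega)
    rwa [U_neg_odd _ _ (by simp), neg_sq] at this
  have key : ∀ i, i < 2 * h + 1 → 0 < lucasU T Q (i + 1) ∧ T ^ i ≤ 2 ^ i * lucasU T Q (i + 1) := by
    intro i hi
    induction i with
    | zero => simp
    | succ i ih =>
      obtain ⟨h1, h2⟩ := ih (by omega)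
      have h3 := (UV_pos hpos hQ hD hD0 hq i (by omega)).2
      have eU : 2 * lucasU T Q (i + 2) = T * lucasU T Q (i + 1) + lucasV T Q (i + 1) := by
        rw [lucasV]; ring
      constructor
      · change 0 < lucasU T Q (i + 2)
        nlinarith [mul_pos hpos h1]
      · change T ^ (i + 1) ≤ 2 ^ (i + 1) * lucasU T Q (i + 2)
        have : 2 ^ (i + 1) * lucasU T Q (i + 2) =
          T * (2 ^ i * lucasU T Q (i + 1)) + 2 ^ i * lucasV T Q (i + 1) := by
          rw [pow_succ, mul_assoc, eU]; ring
        rw [this, pow_succ, mul_comm]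
        have : 0 < 2 ^ i * lucasV T Q (i + 1) := by positivity
        nlinarith [mul_le_mul_of_nonneg_left h2 hpos.le]
  have h1 := (key (2 * h) (by omega)).2
  rwa [pow_mul, pow_mul] at h1

end Lucas

theorem Lucas.U_dvd_U {R : Type*} [CommRing R] (T Q : R) {m n : ℕ} (h : m ∣ n) :
    lucasU T Q m ∣ lucasU T Q n := by
  obtain ⟨k, rfl⟩ := h
  exact ⟨_, U_mul T Q m k⟩

namespace SmoothPrimeTo

theorem of_pow {Q u : ℤ} (h : SmoothPrimeTo Q u) (m : ℕ) : SmoothPrimeTo (Q ^ m) u :=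
  fun ℓ hℓ hd => ⟨(h ℓ hℓ hd).1, fun h' =>
    (h ℓ hℓ hd).2 ((Nat.prime_iff_prime_int.mp hℓ).dvd_of_dvd_pow h')⟩

end SmoothPrimeTo

namespace IsRoot

variable {d : ℕ} {x b Y T c : ℤ} {r : ℕ}

theorem disc (h : IsRoot d x b Y r T c) : T ^ 2 - 4 * Y = -(d * c ^ 2) := by linarith [h.norm]

theorem U_ne_zero (h : IsRoot d x b Y r T c) (hb : b ≠ 0) {m : ℕ} (hm : m ∣ r) :
    lucasU T Y m ≠ 0 := by
  intro h0
  obtain ⟨e, he⟩ := Lucas.U_dvd_U T Y hm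
  have := h.im
  rw [he, h0, zero_mul, mul_zero] at this
  omega

theorem smooth_U (h : IsRoot d x b Y r T c) (hs : SmoothPrimeTo Y (2 * b)) {m : ℕ} (hm : m ∣ r) :
    SmoothPrimeTo Y (lucasU T Y m) :=
  hs.of_dvd ((Lucas.U_dvd_U T Y hm).trans (h.im ▸ Dvd.intro_left _ rfl))

theorem mul_im {p q : ℕ} (h : IsRoot d x b Y (p * q) T c) :
    IsRoot d x b (Y ^ p) q (lucasV T Y p) (c * lucasU T Y p) where
  norm := by rw [Lucas.V_sq, h.disc]; ring
  im := by rw [← h.im, Lucas.U_mul]; ring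
  re := by rw [← h.re, Lucas.V_mul]

end IsRoot

theorem sq_lt_three_pow {p : ℕ} (hp : 7 ≤ p) : (p : ℤ) ^ 2 < 3 ^ (p - 1) := by
  obtain ⟨m, rfl⟩ := Nat.exists_eq_add_of_le hp
  induction m with
  | zero => norm_num
  | succ m ih =>
    have := ih (by omega)
    rw [show 7 + (m + 1) - 1 = (7 + m - 1) + 1 by omega, pow_succ (3 : ℤ)]
    push_cast at this ⊢
    nlinarith

/-- No root has an exponent with a prime factor `p ≥ 7` and a further odd factor at most `p`. -/
theorem not_isRoot_mul {d : ℕ} {x b z T c : ℤ} {p h : ℕ} (hb : b ≠ 0)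
    (hs : SmoothPrimeTo z (2 * b)) (hz : 3 ≤ z) (hp : p.Prime) (h7 : 7 ≤ p) (hh : h ≠ 0)
    (hle : 2 * h + 1 ≤ p) : ¬ IsRoot d x b z (p * (2 * h + 1)) T c := by
  intro H
  have H' : IsRoot d x b z ((2 * h + 1) * p) T c := by rwa [mul_comm] at H
  set q := 2 * h + 1 with hq
  have hT4 : T ^ 2 ≤ 4 * z := by
    have : 0 ≤ d * c ^ 2 := by positivity
    linarith [H.norm]
  have sq_of : ∀ {T Q : ℤ}, lucasU T Q p ≠ 0 → SmoothPrimeTo Q (lucasU T Q p) →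
      lucasU T Q p ^ 2 = 1 ∨ ((p = 11 ∨ p = 19) ∧ lucasU T Q p ^ 2 = p ^ 2) := by
    intro T Q h0 hsm
    rcases Lucas.natAbs_U_prime hp h7 h0 hsm with h1 | ⟨h1, -, h2⟩
    · left; rw [← Int.natAbs_sq, h1]; norm_num
    · right; exact ⟨h1, by rw [← Int.natAbs_sq, h2]⟩
  have he := sq_of (H.U_ne_zero hb (Dvd.intro _ rfl)) (H.smooth_U hs (Dvd.intro _ rfl))
  have hf := sq_of (H'.mul_im.U_ne_zero hb dvd_rfl)
    (H'.mul_im.smooth_U (hs.of_pow q) dvd_rfl)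
  have hUU : lucasU T z p * lucasU (lucasV T z p) (z ^ p) q =
      lucasU T z q * lucasU (lucasV T z q) (z ^ q) p := by
    rw [← Lucas.U_mul, ← Lucas.U_mul, mul_comm]
  have hD := H.mul_im.disc
  set e := lucasU T z p
  set f := lucasU (lucasV T z q) (z ^ q) p
  set S := lucasV T z p
  have hpz : (7 : ℤ) ≤ p := by exact_mod_cast h7
  have hqp : (q : ℤ) ≤ p := by exact_mod_cast hle
  have hE1 : 1 ≤ e ^ 2 := by rcases he with he | ⟨-, he⟩ <;> rw [he]; nlinarith
  have hf2 : f ^ 2 ≤ p ^ 2 := by rcases hf with hf | ⟨-, hf⟩ <;> rw [hf]; nlinarith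
  have hEp : e ^ 2 * p ^ 2 < z ^ (p - 1) := by
    refine lt_of_lt_of_le ?_ (pow_le_pow_left₀ (by norm_num) hz _)
    rcases he with he | ⟨rfl | rfl, he⟩
    · rw [he, one_mul]; exact sq_lt_three_pow h7
    · rw [he]; norm_num
    · rw [he]; norm_num
  have hzp : z ^ p = z * z ^ (p - 1) := by rw [← pow_succ']; congr 1; omega
  have hc4 : d * c ^ 2 ≤ 4 * z := by linarith [H.norm, sq_nonneg T]
  have hc0 : (0 : ℤ) ≤ d * c ^ 2 := by positivity
  set X := z ^ (p - 1) - e ^ 2 with hX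
  have hX3 : 3 * (p : ℤ) < X := by
    have h1 : e ^ 2 * (p ^ 2 - 1) < X := by rw [hX]; linarith
    have h2 : 1 * ((p : ℤ) ^ 2 - 1) ≤ e ^ 2 * (p ^ 2 - 1) :=
      mul_le_mul_of_nonneg_right hE1 (by nlinarith)
    nlinarith
  have hS : 4 * (z * X) ≤ S ^ 2 := by
    have h1 : S ^ 2 = 4 * z ^ p - d * c ^ 2 * e ^ 2 := by linear_combination hD
    rw [h1, hzp, hX]
    nlinarith
  have hzX : 0 < z * X := by nlinarith
  have hS0 : S ≠ 0 := by rintro h0; rw [h0] at hS; linarith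
  have hpow := Lucas.pow_le_U hS0 (by positivity) hD (by positivity) (h := h) (by
    have h1 : (d : ℤ) * (c * e) ^ 2 * q ^ 2 ≤ 4 * z * (e ^ 2 * p ^ 2) := by
      rw [show (d : ℤ) * (c * e) ^ 2 * q ^ 2 = d * c ^ 2 * (e ^ 2 * q ^ 2) by ring]
      have : (q : ℤ) ^ 2 ≤ p ^ 2 := pow_le_pow_left₀ (by positivity) hqp 2
      gcongr
    rw [← hq, hzp]
    nlinarith)
  rw [← hq] at hpow
  set W := lucasU S (z ^ p) q
  have hW : (z * X) ^ h ≤ W := by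
    have h1 := pow_le_pow_left₀ (by positivity) hS h
    rw [mul_pow] at h1
    exact le_of_mul_le_mul_left (h1.trans hpow) (by positivity)
  have hU := Lucas.sq_U_le (by linarith) hT4 (2 * h) (Q := z)
  rw [← hq] at hU
  have h1 : ((z * X) ^ h) ^ 2 ≤ (q * p * z ^ h) ^ 2 := by
    calc ((z * X) ^ h) ^ 2 ≤ W ^ 2 := pow_le_pow_left₀ (by positivity) hW 2
      _ ≤ e ^ 2 * W ^ 2 := le_mul_of_one_le_left (sq_nonneg _) hE1
      _ = lucasU T z q ^ 2 * f ^ 2 := by rw [← mul_pow, hUU, mul_pow]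
      _ ≤ (((2 * h : ℕ) : ℤ) + 1) ^ 2 * z ^ (2 * h) * p ^ 2 := by gcongr
      _ = (q * p * z ^ h) ^ 2 := by rw [hq]; push_cast; ring
  have h2 := abs_le_of_sq_le_sq h1 (by positivity)
  rw [abs_of_pos (by positivity), mul_pow, mul_comm (z ^ h)] at h2
  have h3 : X ^ h ≤ q * p := le_of_mul_le_mul_right h2 (by positivity)
  have h4 : (3 * (p : ℤ)) ^ h < X ^ h := pow_lt_pow_left₀ hX3 (by positivity) hh
  have h5 : (q : ℤ) * p ≤ (3 * p) ^ h := by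
    rw [mul_pow]
    have h6 := one_add_mul_le_pow (a := (2 : ℤ)) (by norm_num) h
    have h7 : (p : ℤ) ≤ p ^ h := le_self_pow₀ (by linarith) hh
    have h8 : (q : ℤ) ≤ 3 ^ h := by rw [hq]; push_cast; norm_num at h6; linarith
    gcongr
  linarith

/-- A Lucas pair `(2a, Y)` realising `x + b √(-d)` as the `r`-th power of `a + c √(-d)`. -/
structure IsEvenRoot (d : ℕ) (x b Y : ℤ) (r : ℕ) (a c : ℤ) : Prop where
  norm : a ^ 2 + d * c ^ 2 = Y
  im : c * lucasU (2 * a) Y r = b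
  re : lucasU (2 * a) Y (r + 1) - a * lucasU (2 * a) Y r = x

namespace IsEvenRoot

variable {d : ℕ} {x b Y a c : ℤ} {r : ℕ}

theorem isRoot (h : IsEvenRoot d x b Y r a c) : IsRoot d x b Y r (2 * a) (2 * c) where
  norm := by rw [← h.norm]; ring
  im := by rw [← h.im]; ring
  re := by rw [← h.re, lucasV]; ring

theorem disc (h : IsEvenRoot d x b Y r a c) : (2 * a) ^ 2 - 4 * Y = -(4 * (d * c ^ 2)) := by
  rw [← h.norm]; ring

theorem c_dvd (h : IsEvenRoot d x b Y r a c) : c ∣ b := ⟨_, h.im.symm⟩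

end IsEvenRoot

theorem IsRoot.exists_even {d : ℕ} {x b Y T c : ℤ} {r : ℕ} (h : IsRoot d x b Y r T c)
    (hd : d ∈ [1, 2, 11, 19, 22, 38, 209, 418]) (hY : Odd Y)
    (h3 : d = 11 ∨ d = 19 → Even T ∨ ¬ 3 ∣ r) : ∃ a c', IsEvenRoot d x b Y r a c' := by
  have hpar : ∀ T c : ℤ, T ^ 2 + d * c ^ 2 = 4 * Y → (d = 11 ∨ d = 19 → Even T) →
      Even T ∧ Even c := by
    intro T c hn hev
    have key : ∀ T c Y : ZMod 8, ∀ e ∈ [1, 2, 11, 19, 22, 38, 209, 418], Y ∈ [1, 3, 5, 7] →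
        T ^ 2 + (e : ℕ) * c ^ 2 = 4 * Y → (e = 11 ∨ e = 19 → 4 * T = 0) →
        4 * T = 0 ∧ 4 * c = 0 := by decide +kernel
    have h8 : ∀ {w : ℤ}, 4 * (w : ZMod 8) = 0 ↔ Even w := by
      intro w
      rw [show (4 * (w : ZMod 8)) = ((4 * w : ℤ) : ZMod 8) by push_cast; ring,
        ZMod.intCast_zmod_eq_zero_iff_dvd, even_iff_two_dvd]
      constructor
      · rintro ⟨k, hk⟩; exact ⟨k, by push_cast at hk; linarith⟩
      · rintro ⟨k, rfl⟩; exact ⟨k, by push_cast; ring⟩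
    have hY8 : (Y : ZMod 8) ∈ ([1, 3, 5, 7] : List (ZMod 8)) := by
      have h1 : ∀ w : ZMod 8, 4 * w ≠ 0 → w ∈ ([1, 3, 5, 7] : List (ZMod 8)) := by decide +kernel
      exact h1 _ (fun h0 => (Int.not_even_iff_odd.mpr hY) (h8.mp h0))
    have := key T c Y d hd hY8 (by exact_mod_cast congrArg (Int.cast : ℤ → ZMod 8) hn)
      (fun he => h8.mpr (hev he))
    exact ⟨h8.mp this.1, h8.mp this.2⟩
  obtain ⟨⟨a, hT⟩, ⟨c', hc⟩⟩ := hpar T c h.norm (by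
    intro hd'
    rcases h3 hd' with h3 | h3
    · exact h3
    by_contra hodd
    rw [Int.not_even_iff_odd] at hodd
    have hc : Odd c := by
      have h1 := h.norm
      have h2 : Odd (T ^ 2) := hodd.pow
      by_contra hce
      rw [Int.not_odd_iff_even] at hce
      have h4 : Even ((d : ℤ) * c ^ 2) := (hce.pow_of_ne_zero two_ne_zero).mul_left _
      have h5 : Odd (4 * Y) := h1 ▸ h2.add_even h4
      exact (Int.not_even_iff_odd.mpr h5) ⟨2 * Y, by ring⟩
    have h2 : (2 : ℤ) ∣ lucasU T Y r := by
      have h1 : (2 : ℤ) ∣ c * lucasU T Y r := h.im ▸ Dvd.intro _ rfl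
      rcases Int.prime_two.dvd_or_dvd h1 with h1 | h1
      · exact absurd (even_iff_two_dvd.mpr h1) (Int.not_even_iff_odd.mpr hc)
      · exact h1
    have hY2 : ¬ ((2 : ℕ) : ℤ) ∣ Y := fun h' =>
      (Int.not_even_iff_odd.mpr hY) (even_iff_two_dvd.mpr h')
    have hU3 : (2 : ℤ) ∣ lucasU T Y 3 := by
      rw [Lucas.U_three]
      exact even_iff_two_dvd.mp (hodd.pow.sub_odd hY)
    have h4 := Lucas.dvd_U_gcd Nat.prime_two hY2 3 r hU3 h2
    rw [(Nat.Prime.coprime_iff_not_dvd Nat.prime_three).mpr h3, Lucas.U_one] at h4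
    norm_num at h4)
  refine ⟨a, c', ?_, ?_, ?_⟩
  · have := h.norm; rw [hT, hc] at this; linarith
  · have := h.im; rw [hT, hc, ← two_mul, ← two_mul] at this; linarith
  · have := h.re; rw [hT, ← two_mul, lucasV] at this; linarith

namespace Lucas

/-- Modulo `Q - a ^ 2` the Lucas sequence with `T = 2a` degenerates. -/
theorem sub_dvd_U (a Q : ℤ) (n : ℕ) :
    Q - a ^ 2 ∣ lucasU (2 * a) Q (n + 1) - (n + 1) * a ^ n := by
  rw [← Int.natAbs_dvd, ← ZMod.intCast_zmod_eq_zero_iff_dvd]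
  have h1 : (Q : ZMod (Q - a ^ 2).natAbs) = (a : ZMod (Q - a ^ 2).natAbs) ^ 2 := by
    have : ((Q - a ^ 2 : ℤ) : ZMod (Q - a ^ 2).natAbs) = 0 := by
      rw [ZMod.intCast_zmod_eq_zero_iff_dvd, Int.natAbs_dvd]
    push_cast at this
    exact sub_eq_zero.mp this
  push_cast
  rw [U_intCast_zmod, h1]
  push_cast
  rw [U_of_disc_zero, sub_self]

end Lucas

theorem IsEvenRoot.dvd_re_sub {d : ℕ} {x b Y a c : ℤ} {r : ℕ} (h : IsEvenRoot d x b Y (r + 1) a c) :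
    d * c ^ 2 ∣ x - a ^ (r + 1) := by
  have hB : (d : ℤ) * c ^ 2 = Y - a ^ 2 := by rw [← h.norm]; ring
  have h1 := Lucas.sub_dvd_U a Y (r + 1)
  have h2 := (Lucas.sub_dvd_U a Y r).mul_left a
  rw [hB, ← h.re]
  have := dvd_sub h1 h2
  rw [show lucasU (2 * a) Y (r + 1 + 1) - a * lucasU (2 * a) Y (r + 1) - a ^ (r + 1) =
    lucasU (2 * a) Y (r + 1 + 1) - (((r + 1 : ℕ) : ℤ) + 1) * a ^ (r + 1) -
      a * (lucasU (2 * a) Y (r + 1) - (r + 1) * a ^ r) by push_cast; ring]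
  exact this

/-- Exponents `2p` are impossible for primes `p ≥ 7`. -/
theorem not_isEvenRoot_sq {d : ℕ} {x b z a c : ℤ} {p : ℕ} (hb : b ≠ 0) (hd : 0 < d)
    (hs : SmoothPrimeTo z (2 * b)) (hz : 3 ≤ z) (hp : p.Prime) (h7 : 7 ≤ p)
    (heq : x ^ 2 + d * b ^ 2 = (z ^ 2) ^ p) : ¬ IsEvenRoot d x b (z ^ 2) p a c := by
  intro H
  have hU := Lucas.natAbs_U_prime hp h7 (H.isRoot.U_ne_zero hb dvd_rfl)
    (H.isRoot.smooth_U (hs.of_pow 2) dvd_rfl)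
  have him := H.im
  have hc : c ≠ 0 := by rintro rfl; exact hb (by rw [← him, zero_mul])
  obtain ⟨h, hh⟩ := hp.odd_of_ne_two (by omega)
  subst hh
  have hdvd := H.dvd_re_sub
  set e := lucasU (2 * a) (z ^ 2) (2 * h + 1)
  have hB : (d : ℤ) * c ^ 2 = (z + a) * (z - a) := by linear_combination H.norm
  have hdc : 0 < (d : ℤ) * c ^ 2 := by positivity
  have he : e ^ 2 < z ^ (2 * h) := by
    refine lt_of_lt_of_le ?_ (pow_le_pow_left₀ (by norm_num) hz _)
    have := sq_lt_three_pow h7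
    rw [Nat.add_sub_cancel] at this
    refine lt_of_le_of_lt ?_ this
    rw [← Int.natAbs_sq e]
    rcases hU with hU | ⟨-, -, hU⟩ <;> rw [hU]
    have : (7 : ℤ) ≤ ((2 * h + 1 : ℕ) : ℤ) := by exact_mod_cast h7
    push_cast at this ⊢
    nlinarith
  have haz : a ^ 2 < z ^ 2 := by linarith [H.norm]
  obtain ⟨ha1, ha2⟩ := abs_lt.mp (abs_lt_of_sq_lt_sq haz (by linarith))
  rw [hB] at hdvd
  have hodd : Odd (2 * h + 1) := ⟨h, rfl⟩
  obtain ⟨m, hm⟩ : z + a ∣ z ^ (2 * h + 1) + x := by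
    have h1 := hodd.add_dvd_pow_add_pow z a
    have h2 := (Dvd.intro _ rfl : z + a ∣ (z + a) * (z - a)).trans hdvd
    have := dvd_add h1 h2
    rwa [show z ^ (2 * h + 1) + a ^ (2 * h + 1) + (x - a ^ (2 * h + 1)) =
      z ^ (2 * h + 1) + x by ring] at this
  obtain ⟨m', hm'⟩ : z - a ∣ z ^ (2 * h + 1) - x := by
    have h1 := sub_dvd_pow_sub_pow z a (2 * h + 1)
    have h2 := (Dvd.intro_left _ rfl : z - a ∣ (z + a) * (z - a)).trans hdvd
    have := dvd_sub h1 h2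
    rwa [show z ^ (2 * h + 1) - a ^ (2 * h + 1) - (x - a ^ (2 * h + 1)) =
      z ^ (2 * h + 1) - x by ring] at this
  have hDe : (z ^ (2 * h + 1) + x) * (z ^ (2 * h + 1) - x) = d * b ^ 2 := by
    rw [← pow_mul, mul_comm 2, pow_mul] at heq
    linear_combination -heq
  have hmm : m * m' = e ^ 2 := by
    have h1 : (z + a) * (z - a) * (m * m') = (z + a) * (z - a) * e ^ 2 := by
      rw [← hB, show (d : ℤ) * c ^ 2 * e ^ 2 = d * b ^ 2 by rw [← him]; ring, ← hDe, hm, hm', hB]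
      ring
    exact mul_left_cancel₀ (by rw [← hB]; exact hdc.ne') h1
  have hx2 : x ^ 2 < (z ^ (2 * h + 1)) ^ 2 := by
    have : 0 < (d : ℤ) * b ^ 2 := by positivity
    linarith
  obtain ⟨hx1, hx2⟩ := abs_lt.mp (abs_lt_of_sq_lt_sq hx2 (by positivity))
  have hm0 : 0 < m := pos_of_mul_pos_right (hm ▸ (by linarith) : 0 < (z + a) * m) (by linarith)
  have hm0' : 0 < m' := pos_of_mul_pos_right (hm' ▸ (by linarith) : 0 < (z - a) * m') (by linarith)
  have h1 : m ≤ e ^ 2 := by rw [← hmm]; exact le_mul_of_one_le_right hm0.le hm0'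
  have h2 : m' ≤ e ^ 2 := by rw [← hmm]; exact le_mul_of_one_le_left hm0'.le hm0
  have h3 : z * z ^ (2 * h) ≤ z * e ^ 2 := by
    rw [← pow_succ']
    nlinarith
  exact absurd (le_of_mul_le_mul_left h3 (by linarith)) (not_le.mpr he)

namespace Lucas

theorem U_periodic {R : Type*} [CommRing R] {T Q : R} {s P : ℕ}
    (h : pair T Q (s + P) = pair T Q s) (i j : ℕ) :
    lucasU T Q (s + i + P * j) = lucasU T Q (s + i) := by
  have step : ∀ i, pair T Q (s + i + P) = pair T Q (s + i) := by
    intro i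
    induction i with
    | zero => exact h
    | succ i ih =>
      rw [show s + (i + 1) + P = (s + i + P) + 1 by ring, pair, ih, ← add_assoc, pair]
  have all : ∀ j, pair T Q (s + i + P * j) = pair T Q (s + i) := by
    intro j
    induction j with
    | zero => rfl
    | succ j ih =>
      rw [show s + i + P * (j + 1) = s + (i + P * j) + P by ring, step, ← add_assoc, ih]
  simpa [pair_eq] using congrArg Prod.fst (all j)

theorem U_eq_pair {R : Type*} [CommRing R] (T Q : R) (n : ℕ) :
    lucasU T Q n = (pair T Q n).1 := by rw [pair_eq]

theorem U_odd_three (a : ZMod 3) {n : ℕ} (hn : Odd n) : lucasU (2 * a) (a ^ 2 + 2) n = 1 := by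
  obtain ⟨h, rfl⟩ := hn
  have h1 : ∀ a : ZMod 3, pair (2 * a) (a ^ 2 + 2) (1 + 2) = pair (2 * a) (a ^ 2 + 2) 1 := by
    decide +kernel
  have := U_periodic (h1 a) 0 h
  rwa [add_zero, add_comm 1, U_one] at this

end Lucas

theorem zmod_ne_zero {q : ℕ} {b : ℤ} (h : ¬ (q : ℤ) ∣ b) : (b : ZMod q) ≠ 0 := by
  rwa [Ne, ZMod.intCast_zmod_eq_zero_iff_dvd]

theorem IsSolution.not_dvd_b {d : ℕ} {x b y : ℤ} {n : ℕ} (h : IsSolution d x b y n) {ℓ : ℕ}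
    (hℓ : ℓ.Prime) (h2 : ℓ ≠ 2) (h11 : ℓ ≠ 11) (h19 : ℓ ≠ 19) : ¬ (ℓ : ℤ) ∣ b := by
  intro hd
  have := (h.smoothPrimeTo ℓ hℓ (hd.mul_left 2)).1
  omega

theorem IsSolution.not_dvd_y {d : ℕ} {x b y : ℤ} {n : ℕ} (h : IsSolution d x b y n) {ℓ : ℕ}
    (hℓ : ℓ.Prime) (hd : (ℓ : ℤ) ∣ d * b) : ¬ (ℓ : ℤ) ∣ y := fun hy =>
  (Nat.prime_iff_prime_int.mp hℓ).not_isUnit (h.coprime.isUnit_of_dvd' hd hy)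

namespace IsEvenRoot

variable {d : ℕ} {x b Y a c : ℤ} {r : ℕ}

theorem cast_norm (h : IsEvenRoot d x b Y r a c) (m : ℕ) :
    (Y : ZMod m) = (a : ZMod m) ^ 2 + (d : ZMod m) * (c : ZMod m) ^ 2 := by
  rw [← h.norm]; push_cast; ring

theorem cast_U (h : IsEvenRoot d x b Y r a c) (m n : ℕ) :
    ((lucasU (2 * a) Y n : ℤ) : ZMod m) = lucasU (2 * (a : ZMod m))
      ((a : ZMod m) ^ 2 + (d : ZMod m) * (c : ZMod m) ^ 2) n := by
  rw [Lucas.U_intCast_zmod, h.cast_norm]; push_cast; rfl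

theorem dvd_disc (h : IsEvenRoot d x b Y r a c) {q : ℤ} (hq : q ∣ d * c ^ 2) :
    q ∣ (2 * a) ^ 2 - 4 * Y := by
  rw [h.disc]; exact (hq.mul_left 4).neg_right

theorem cast_eq_sq (h : IsEvenRoot d x b Y r a c) {q : ℕ} (hq : (q : ℤ) ∣ d * c ^ 2) :
    (Y : ZMod q) = (a : ZMod q) ^ 2 := by
  rw [← sub_eq_zero]
  have : ((Y - a ^ 2 : ℤ) : ZMod q) = 0 := by
    rw [ZMod.intCast_zmod_eq_zero_iff_dvd, ← h.norm, add_sub_cancel_left]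
    exact hq
  push_cast at this
  exact this

theorem U_eleven_ne (h : IsEvenRoot d x b Y r a c) (hq : (11 : ℤ) ∣ d * c ^ 2) :
    lucasU (2 * a) Y 11 ≠ -11 := by
  intro hU
  have h1 := Lucas.sq_dvd_U_sub (Or.inl rfl) (h.dvd_disc hq)
  rw [hU, show (-11 : ℤ) - (11 : ℕ) * Y ^ (11 / 2) = 11 * (-1 - Y ^ 5) by norm_num; ring,
    show ((11 : ℕ) : ℤ) ^ 2 = 11 * 11 by norm_num] at h1
  have h2 := (ZMod.intCast_zmod_eq_zero_iff_dvd _ 11).mpr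
    (Int.dvd_of_mul_dvd_mul_left (by norm_num) h1)
  push_cast at h2
  rw [h.cast_eq_sq hq] at h2
  have : ∀ w : ZMod 11, -1 - (w ^ 2) ^ 5 ≠ 0 := by decide +kernel
  exact this _ h2

end IsEvenRoot

/-- For `d ∈ {38, 209}` the prime-index Lucas number is `1`, up to two congruence exceptions. -/
theorem IsEvenRoot.U_eq_one {d : ℕ} {x b z a c : ℤ} {p m : ℕ} (hd : d = 38 ∨ d = 209)
    (hsol : IsSolution d x b (z ^ m) p) (hp : p.Prime) (h7 : 7 ≤ p)
    (H : IsEvenRoot d x b (z ^ m) p a c) (hm : d = 38 → m = 3) :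
    lucasU (2 * a) (z ^ m) p = 1 := by
  have hb := hsol.b_pos.ne'
  have hU := Lucas.natAbs_U_prime hp h7 (H.isRoot.U_ne_zero hb dvd_rfl)
    (H.isRoot.smooth_U hsol.smoothPrimeTo dvd_rfl)
  have hc : ∀ ℓ : ℕ, ℓ = 3 ∨ ℓ = 7 → (c : ZMod ℓ) ≠ 0 := by
    intro ℓ hℓ
    refine zmod_ne_zero fun hdv => ?_
    rcases hℓ with rfl | rfl <;>
      exact hsol.not_dvd_b (by norm_num) (by norm_num) (by norm_num) (by norm_num)
        (hdv.trans H.c_dvd)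
  have h3 : ((lucasU (2 * a) (z ^ m) p : ℤ) : ZMod 3) = 1 := by
    rw [H.cast_U]
    have hc1 : (d : ZMod 3) * (c : ZMod 3) ^ 2 = 2 := by
      have h1 : ∀ w : ZMod 3, w ≠ 0 → w ^ 2 = 1 := by decide
      rw [h1 _ (hc 3 (Or.inl rfl))]
      rcases hd with rfl | rfl <;> decide
    rw [hc1]
    exact Lucas.U_odd_three _ (hp.odd_of_ne_two (by omega))
  rcases hU with hU | ⟨hp', hdisc, hU⟩
  · rcases Int.natAbs_eq_iff.mp hU with h1 | h1
    · simpa using h1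
    · rw [h1] at h3
      exact absurd h3 (by decide)
  · have hdc : (p : ℤ) ∣ d * c ^ 2 := by
      rw [H.disc, dvd_neg] at hdisc
      have hpp := Nat.prime_iff_prime_int.mp hp
      rcases hpp.dvd_or_dvd hdisc with h1 | h1
      · rcases hp' with rfl | rfl <;> norm_num at h1
      · exact h1
    rcases hp' with rfl | rfl
    · rcases Int.natAbs_eq_iff.mp hU with h1 | h1
      · rw [h1] at h3
        exact absurd h3 (by decide)
      · exact absurd h1 (H.U_eleven_ne (by simpa using hdc))
    · rcases Int.natAbs_eq_iff.mp hU with h1 | h1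
      · have hc7 := hc 7 (Or.inr rfl)
        have h7 := H.cast_U 7 19
        have hn := H.cast_norm 7
        rw [h1, Lucas.U_eq_pair] at h7
        exfalso
        rcases hd with rfl | rfl
        · rw [hm rfl] at hn
          push_cast at hn h7
          have key : ∀ a c z : ZMod 7, c ≠ 0 → z ^ 3 = a ^ 2 + 38 * c ^ 2 →
              19 ≠ (Lucas.pair (2 * a) (a ^ 2 + 38 * c ^ 2) 19).1 := by decide +kernel
          exact key _ _ _ hc7 hn h7
        · push_cast at h7
          have key : ∀ a c : ZMod 7, c ≠ 0 →
              19 ≠ (Lucas.pair (2 * a) (a ^ 2 + 209 * c ^ 2) 19).1 := by decide +kernel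
          exact key _ _ hc7 h7
      · rw [h1] at h3
        exact absurd h3 (by decide)

/-- There is no solution with `d = 209` and exponent `5p`, `p ≥ 7`. -/
theorem not_isSolution_209 {x b z : ℤ} {p : ℕ} (hp : p.Prime) (h7 : 7 ≤ p) :
    ¬ IsSolution 209 x b (z ^ 5) p := by
  intro hsol
  have hodd := hp.odd_of_ne_two (by omega)
  have h5 : ¬ 5 ∣ p := fun h => by
    have := (Nat.prime_dvd_prime_iff_eq Nat.prime_five hp).mp h
    omega
  obtain ⟨T, c, hT⟩ := hsol.exists_root hodd (by norm_num) (fun _ => h5)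
  obtain ⟨a, c, H⟩ := hT.exists_even hsol.mem hsol.odd (by norm_num)
  have hU := H.U_eq_one (Or.inr rfl) hsol hp h7 (by norm_num)
  have hdvd : (11 : ℤ) ∣ ((209 : ℕ) : ℤ) * c ^ 2 := Dvd.dvd.mul_right (by norm_num) _
  obtain ⟨h, rfl⟩ := hodd
  refine Lucas.U_odd_ne_one (q := 11) (Or.inl rfl) (H.dvd_disc hdvd) (g := 1) (h := h) ?_
    (one_dvd _) (by norm_num) (by omega) hU
  rw [← ZMod.intCast_zmod_eq_zero_iff_dvd]
  have h1 := H.cast_eq_sq (q := 11) hdvd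
  have hz : ((z ^ 5 : ℤ) : ZMod 11) ≠ 0 :=
    zmod_ne_zero (hsol.not_dvd_y (by norm_num) (Dvd.dvd.mul_right (by norm_num) _))
  push_cast at h1 hz ⊢
  have key : ∀ z a : ZMod 11, z ^ 5 ≠ 0 → z ^ 5 = a ^ 2 → (z ^ 5) ^ 1 - 1 = 0 := by decide +kernel
  exact key _ _ hz h1

/-- For `d = 38` and exponent `3p`, the prime `p ≥ 7` is `2` modulo `3`. -/
theorem IsEvenRoot.mod_three_38 {x b z a c : ℤ} {p : ℕ}
    (hsol : IsSolution 38 x b (z ^ 3) p) (hp : p.Prime) (h7 : 7 ≤ p)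
    (H : IsEvenRoot 38 x b (z ^ 3) p a c) : p % 6 = 5 := by
  have hodd := hp.odd_of_ne_two (by omega)
  have h3 : ¬ 3 ∣ p := fun h => by
    have := (Nat.prime_dvd_prime_iff_eq Nat.prime_three hp).mp h
    omega
  have hU := H.U_eq_one (Or.inl rfl) hsol hp h7 (fun _ => rfl)
  have hdvd : (19 : ℤ) ∣ ((38 : ℕ) : ℤ) * c ^ 2 := Dvd.dvd.mul_right (by norm_num) _
  obtain ⟨h, rfl⟩ := hodd
  by_contra hcon
  have h6 : (2 * h + 1) % 6 = 1 := by
    have := Nat.mod_lt (2 * h + 1) (by norm_num : 6 > 0)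
    interval_cases hr : (2 * h + 1) % 6 <;> omega
  refine Lucas.U_odd_ne_one (q := 19) (Or.inr rfl) (H.dvd_disc hdvd) (g := 3) (h := h) ?_
    (by omega) (by norm_num) (by omega) hU
  rw [← ZMod.intCast_zmod_eq_zero_iff_dvd]
  have h1 := H.cast_eq_sq (q := 19) hdvd
  have hz : ((z ^ 3 : ℤ) : ZMod 19) ≠ 0 :=
    zmod_ne_zero (hsol.not_dvd_y (by norm_num) (Dvd.dvd.mul_right (by norm_num) _))
  push_cast at h1 hz ⊢
  have key : ∀ z a : ZMod 19, z ^ 3 ≠ 0 → z ^ 3 = a ^ 2 → (z ^ 3) ^ 3 - 1 = 0 := by decide +kernel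
  exact key _ _ hz h1

namespace QuadOrder

theorem two_38_not_regPrincipal : ¬ RegPrincipal (quadIdeal 0 38 2 4) := by
  rintro ⟨δ, -, hδ⟩
  have h := quadIdeal_mul_conj maximal_38 (N := 2) (N' := 27) (s := 4) (by norm_num)
  rw [quadIdeal_congr (N := 2) (s := -4 - 0) (s' := 4) (by norm_num), hδ,
    Ideal.span_singleton_mul_span_singleton] at h
  obtain ⟨α, hα⟩ := Ideal.mem_span_singleton.mp
    (h ▸ Ideal.mem_span_singleton_self _ : (⟨2, 0⟩ : QuadOrder 0 38) ∈ Ideal.span {δ * δ})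
  obtain ⟨β, hβ⟩ := Ideal.mem_span_singleton.mp
    (h ▸ Ideal.mem_span_singleton_self _ : δ * δ ∈ Ideal.span {(⟨2, 0⟩ : QuadOrder 0 38)})
  have h1 := congrArg nrm hα
  have h2 := congrArg nrm hβ
  simp only [nrm_mul, nrm_mk] at h1 h2
  have hδ0 := nrm_nonneg maximal_38 δ
  have h4 : nrm δ = 2 := by
    have h5 : nrm δ ≤ 2 := by
      by_contra hgt
      push Not at hgt
      have hα0 : 0 < nrm α := by
        rcases (nrm_nonneg maximal_38 α).lt_or_eq with h | h
        · exact h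
        · rw [← h] at h1; norm_num at h1
      nlinarith
    interval_cases h : nrm δ <;> omega
  have h6 : δ.re ^ 2 + 0 * δ.re * δ.im + 38 * δ.im ^ 2 = 2 := h4
  have h7 : δ.im = 0 := by
    by_contra h0
    have : 0 < δ.im ^ 2 := by positivity
    nlinarith [sq_nonneg δ.re]
  rw [h7] at h6
  have h8 : δ.re ≤ 1 := by nlinarith
  have h9 : -1 ≤ δ.re := by nlinarith
  interval_cases h : δ.re <;> omega

theorem three_cubed_38_not_regPrincipal : ¬ RegPrincipal (quadIdeal 0 38 3 4 ^ 3) := fun h =>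
  two_38_not_regPrincipal <| RegPrincipal.of_mul_right (two_mul_three_cubed_38 ▸
    regPrincipal_of_nrm maximal_38 (by simp [nrm])) h

/-- The class of the prime `(3, 4 + ω)` generates the class group of `ℤ[√-38]`. -/
theorem three_generates_38 (N s : ℤ) (hN : 0 < N) (hd : N ∣ s ^ 2 + 0 * s + 38) :
    ∃ j, RegPrincipal (quadIdeal 0 38 N s * quadIdeal 0 38 3 4 ^ j) := by
  have h6 := regPrincipal_three_38
  have h33 : RegPrincipal (quadIdeal 0 38 3 2 * quadIdeal 0 38 3 4) := by
    rw [quadIdeal_congr (s := 4) (s' := -2 - 0) (by norm_num)]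
    exact regPrincipal_conj maximal_38 (by norm_num) (by norm_num)
  have h72 : RegPrincipal (quadIdeal 0 38 7 2 * quadIdeal 0 38 3 4 ^ 2) := by
    refine RegPrincipal.of_mul_right
      (J := quadIdeal 0 38 2 4 ^ 2 * (quadIdeal 0 38 3 2 * quadIdeal 0 38 3 4)) ?_
      ((regPrincipal_two_38 4 ⟨2, rfl⟩).mul h33)
    rw [show quadIdeal 0 38 7 2 * quadIdeal 0 38 3 4 ^ 2 * (quadIdeal 0 38 2 4 ^ 2 *
      (quadIdeal 0 38 3 2 * quadIdeal 0 38 3 4)) = quadIdeal 0 38 7 2 * (quadIdeal 0 38 2 4 *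
      quadIdeal 0 38 3 2) * (quadIdeal 0 38 2 4 * quadIdeal 0 38 3 4 ^ 3) by ring,
      two_mul_three_cubed_38, quadIdeal_congr (N := 2) (s := 4) (s' := 2) (by norm_num),
      ← quadIdeal_split maximal_38 (N' := 7) (by norm_num)]
    exact (regPrincipal_complement maximal_38 (by norm_num)).mul
      (regPrincipal_of_nrm maximal_38 (by simp [nrm]))
  refine induction_on_norm maximal_38
    (P := fun N s => ∃ j, RegPrincipal (quadIdeal 0 38 N s * quadIdeal 0 38 3 4 ^ j))
    ?_ ?_ ?_ ?_ (fun p s hp h1 h2 => ?_) N s hN hd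
  · intro s
    exact ⟨0, by rw [quadIdeal_one, pow_zero, Ideal.one_eq_top, Ideal.top_mul]; exact .top⟩
  · rintro N s s' hs hP
    rwa [quadIdeal_congr hs]
  · rintro N₁ N₂ s - - ⟨N', hN'⟩ ⟨j, hj⟩ ⟨k, hk⟩
    refine ⟨j + k, ?_⟩
    rw [quadIdeal_split maximal_38 hN'.symm, pow_add, mul_mul_mul_comm]
    exact hj.mul hk
  · rintro N N' s - - hN' ⟨j, hj⟩
    refine ⟨5 * j, RegPrincipal.of_mul_right ?_ hj⟩
    rw [mul_mul_mul_comm, ← pow_add, show 5 * j + j = 6 * j by ring, pow_mul]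
    exact (regPrincipal_complement maximal_38 hN').mul (h6.pow j)
  have hle := prime_le_of_bound (b := 7) h1 (by norm_num)
  have hz := zmod_root h2
  interval_cases p <;> try (exfalso; revert hp; decide)
  · have hs : (s : ZMod 2) = (4 : ℤ) := by
      revert hz; generalize (s : ZMod 2) = x; revert x; decide
    refine ⟨3, ?_⟩
    rw [quadIdeal_of_zmod hs]
    exact two_mul_three_cubed_38 ▸ regPrincipal_of_nrm maximal_38 (by simp [nrm])
  · have hs : (s : ZMod 3) = (4 : ℤ) ∨ (s : ZMod 3) = (2 : ℤ) := by
      revert hz; generalize (s : ZMod 3) = x; revert x; decide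
    rcases hs with hs | hs <;> rw [quadIdeal_of_zmod hs]
    · exact ⟨5, by rw [pow_succ'] at h6; exact h6⟩
    · exact ⟨1, by rw [pow_one]; exact h33⟩
  · exact absurd hz (by generalize (s : ZMod 5) = x; revert x; decide)
  · have hs : (s : ZMod 7) = (2 : ℤ) ∨ (s : ZMod 7) = (-2 : ℤ) := by
      revert hz; generalize (s : ZMod 7) = x; revert x; decide
    rcases hs with hs | hs <;> rw [quadIdeal_of_zmod hs]
    · exact ⟨2, h72⟩
    · refine ⟨4, RegPrincipal.of_mul_right ?_ h72⟩
      rw [mul_mul_mul_comm, ← pow_add]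
      refine RegPrincipal.mul ?_ h6
      rw [quadIdeal_congr (s := 2) (s' := - -2 - 0) (by norm_num)]
      exact regPrincipal_conj maximal_38 (by norm_num) (by norm_num)

theorem nine_eq_three_sq_38 : quadIdeal 0 38 3 4 ^ 2 = quadIdeal 0 38 9 4 :=
  (quadIdeal_pow maximal_38 (N' := 6) (by norm_num)).symm

theorem three_pow_six_38 (ε : ℤ) (hε : ε = 1 ∨ ε = -1) :
    quadIdeal 0 38 9 (4 * ε) ^ 3 = Ideal.span {⟨-11, 4 * ε⟩} := by
  have hε2 : ε ^ 2 = 1 := by rcases hε with rfl | rfl <;> norm_num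
  rw [quadIdeal_congr (s' := 544 * ε) ⟨-60 * ε, by ring⟩,
    ← quadIdeal_pow maximal_38 (N' := 406) (by linear_combination (-295936) * hε2), quadIdeal]
  apply le_antisymm
  · rw [span_pair_le]
    refine ⟨Ideal.mem_span_singleton.mpr ⟨⟨-11, -4 * ε⟩, ?_⟩,
      Ideal.mem_span_singleton.mpr ⟨⟨-8 * ε, -3⟩, ?_⟩⟩ <;>
      rw [mk_mul_mk] <;> ext <;> simp <;> linarith
  · rw [Ideal.span_singleton_le_iff_mem]
    refine Ideal.mem_span_pair.mpr ⟨⟨-3, 0⟩, ⟨4 * ε, 0⟩, ?_⟩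
    simp only [mk_mul_mk]
    ext <;> simp
    linarith

theorem exists_of_mem_quadIdeal_38 {N s N' : ℤ} (h : N * N' = s ^ 2 + 38) {x : QuadOrder 0 38}
    (hx : x ∈ quadIdeal 0 38 N s) : ∃ u v, x = ⟨N * u + s * v, v⟩ := by
  obtain ⟨α, β, rfl⟩ := Ideal.mem_span_pair.mp hx
  refine ⟨α.re - s * α.im - N' * β.im, N * α.im + β.re + s * β.im, ?_⟩
  ext
  · simp; linear_combination β.im * h
  · simp; ring

/-- Cubes of ideals in `ℤ[√-38]` that are principal. -/
theorem cubic_38 {a b z : ℤ} (hz : 0 < z) (h : a ^ 2 + 38 * b ^ 2 = z ^ 3) (hc : IsCoprime b z) :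
    (∃ u v, (⟨a, b⟩ : QuadOrder 0 38) = ⟨u, v⟩ ^ 3) ∨
      ∃ ε u v : ℤ, (ε = 1 ∨ ε = -1) ∧
        (⟨a, b⟩ : QuadOrder 0 38) * ⟨-11, 4 * ε⟩ = ⟨9 * u + 4 * ε * v, v⟩ ^ 3 := by
  obtain ⟨s, hs, hI⟩ := span_eq_pow maximal_38 (e := a) (f := b) (Y := z) (r := 3)
    (by linear_combination h) hc.pow_right
  have hz3 : (0 : ℤ) < z ^ 3 := by positivity
  have h0 : nrm (⟨a, b⟩ : QuadOrder 0 38) ≠ 0 := by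
    rw [nrm_mk]; intro h0; linarith
  have hγ := hI ▸ regPrincipal_of_nrm maximal_38 h0
  obtain ⟨j, hj⟩ := three_generates_38 z s hz ((Dvd.intro_left (z ^ 2) (by ring)).trans hs)
  have hred : RegPrincipal (quadIdeal 0 38 z s * quadIdeal 0 38 3 4 ^ (j % 6)) := by
    refine RegPrincipal.of_mul_right ?_ (regPrincipal_three_38.pow (j / 6))
    rwa [mul_assoc, ← pow_mul, ← pow_add, Nat.mod_add_div]
  have hε : ∀ ε : ℤ, ε = 1 ∨ ε = -1 →
      RegPrincipal (quadIdeal 0 38 z s * quadIdeal 0 38 9 (4 * ε)) → ∃ u v : ℤ,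
        (⟨a, b⟩ : QuadOrder 0 38) * ⟨-11, 4 * ε⟩ = ⟨9 * u + 4 * ε * v, v⟩ ^ 3 := by
    rintro ε hε ⟨ρ, -, hρ⟩
    have hn : nrm (⟨-11, 4 * ε⟩ : QuadOrder 0 38) ≠ 0 := by
      rcases hε with rfl | rfl <;> norm_num [nrm_mk]
    obtain ⟨w, -, hw⟩ := exists_root_of_span_eq maximal_38 (r := 3) (γ := ρ)
      (ξ := ⟨a, b⟩ * ⟨-11, 4 * ε⟩) (by decide) (by rw [nrm_mul]; exact mul_ne_zero h0 hn) (by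
        rw [← Ideal.span_singleton_mul_span_singleton, ← hI, ← three_pow_six_38 ε hε, ← mul_pow,
          hρ, Ideal.span_singleton_pow])
    have hmem : w * ρ ∈ quadIdeal 0 38 9 (4 * ε) := by
      refine Ideal.mul_mem_left _ _ (Ideal.mul_le_right (I := quadIdeal 0 38 z s) ?_)
      rw [hρ]; exact Ideal.mem_span_singleton_self ρ
    obtain ⟨u, v, huv⟩ := exists_of_mem_quadIdeal_38 (N' := 6)
      (by rcases hε with rfl | rfl <;> norm_num) hmem
    exact ⟨u, v, by rw [hw, huv]⟩
  have hodd : ∀ i, i % 6 = 3 → ¬ RegPrincipal (quadIdeal 0 38 3 4 ^ i) := by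
    intro i hi hP
    refine three_cubed_38_not_regPrincipal
      (RegPrincipal.of_mul_left ?_ (regPrincipal_three_38.pow (i / 6)))
    rw [← pow_mul, ← pow_add]
    rwa [show 6 * (i / 6) + 3 = i by omega]
  have hcube : RegPrincipal (quadIdeal 0 38 3 4 ^ (j % 6 * 3)) := by
    refine RegPrincipal.of_mul_left ?_ hγ
    rw [pow_mul, ← mul_pow]
    exact hred.pow 3
  have hlt := Nat.mod_lt j (show 6 > 0 by norm_num)
  interval_cases h6 : j % 6
  · left
    rw [pow_zero, mul_one] at hred
    obtain ⟨ρ, -, hρ⟩ := hred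
    obtain ⟨w, -, hw⟩ := exists_root_of_span_eq maximal_38 (r := 3) (γ := ρ)
      (ξ := ⟨a, b⟩) (by decide) h0 (by rw [← hI, hρ, Ideal.span_singleton_pow])
    exact ⟨(w * ρ).re, (w * ρ).im, hw⟩
  · exact absurd hcube (hodd _ (by norm_num))
  · right
    rw [nine_eq_three_sq_38] at hred
    obtain ⟨u, v, huv⟩ := hε 1 (Or.inl rfl) (by simpa using hred)
    exact ⟨1, u, v, Or.inl rfl, huv⟩
  · exact absurd hcube (hodd _ (by norm_num))
  · right
    obtain ⟨u, v, huv⟩ := hε (-1) (Or.inr rfl) (by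
      refine RegPrincipal.of_mul_right ?_ regPrincipal_three_38
      have h9 := regPrincipal_conj maximal_38 (N := 9) (s := 4) (by norm_num) (by norm_num)
      rw [← nine_eq_three_sq_38] at h9
      rw [show (4 : ℤ) * -1 = -4 - 0 by norm_num, show quadIdeal 0 38 z s *
        quadIdeal 0 38 9 (-4 - 0) * quadIdeal 0 38 3 4 ^ 6 = quadIdeal 0 38 z s *
        quadIdeal 0 38 3 4 ^ 4 * (quadIdeal 0 38 3 4 ^ 2 * quadIdeal 0 38 9 (-4 - 0)) by ring]
      exact hred.mul h9)
    exact ⟨-1, u, v, Or.inr rfl, huv⟩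
  · exact absurd hcube (hodd _ (by norm_num))

end QuadOrder

/-! ### A sieve for the class of `(3, 4 + √-38)` -/

namespace Sieve

open Lucas

/-- The integers `a`, `b` with `a + b √-38` a cube times a fixed element of cubic class, and
with `p`-th Lucas number equal to one. -/
structure Twisted (a b u v : ℤ) (p : ℕ) : Prop where
  U_eq_one : lucasU (2 * a) (a ^ 2 + 38 * b ^ 2) p = 1
  re : -11 * a - 152 * b = (9 * u + 4 * v) ^ 3 - 114 * (9 * u + 4 * v) * v ^ 2
  im : 4 * a - 11 * b = 3 * (9 * u + 4 * v) ^ 2 * v - 38 * v ^ 3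

theorem sub_mul_lucasU {R : Type*} [CommRing R] (α β : R) (n : ℕ) :
    (α - β) * lucasU (α + β) (α * β) n = α ^ n - β ^ n := by
  induction n using Nat.twoStepInduction with
  | zero => simp [U_zero]
  | one => simp [U_one]
  | more n h1 h2 => rw [U_add_two]; linear_combination (α + β) * h2 - α * β * h1

/-- The local condition at a prime `ℓ` at which `-38` is the square of `s`, for the exponent `r`
and the conjugate roots `x` and `y` with difference `c`. -/
def rootTest (ℓ s e r c x y : ℕ) : Bool :=
  Nat.beq (x ^ r % ℓ) ((y ^ r + c) % ℓ) &&
  (Nat.ble (((4 * s + 11 * (ℓ - 1)) * x) ^ e % ℓ) 1 &&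
  Nat.ble (((4 * s + 11) * (ℓ - 1) * y) ^ e % ℓ) 1)

/-- The local condition at `ℓ` for the exponent `r` and the value `β` of `b`. -/
def splitTest (ℓ s e r β : ℕ) : Bool :=
  (List.range ℓ).any fun y => rootTest ℓ s e r (2 * β * s % ℓ) ((y + 2 * β * s) % ℓ) y

theorem pow_eq_pow_mod {ℓ : ℕ} [Fact ℓ.Prime] {p : ℕ} (hp : p % (ℓ - 1) ≠ 0) (x : ZMod ℓ) :
    x ^ p = x ^ (p % (ℓ - 1)) := by
  rcases eq_or_ne x 0 with rfl | hx
  · rw [zero_pow hp, zero_pow]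
    rintro rfl; simp at hp
  · conv_lhs => rw [← Nat.mod_add_div p (ℓ - 1), pow_add, pow_mul, ZMod.pow_card_sub_one_eq_one hx,
      one_pow, mul_one]

theorem cube_pow_le {ℓ : ℕ} [Fact ℓ.Prime] {e w : ℕ} (he : 3 * e = ℓ - 1 ∨ e = 0) (t : ZMod ℓ)
    (hw : (w : ZMod ℓ) = t ^ 3) : w ^ e % ℓ ≤ 1 := by
  have hℓ : 1 < ℓ := (Fact.out : ℓ.Prime).one_lt
  have h : (w : ZMod ℓ) ^ e = 0 ∨ (w : ZMod ℓ) ^ e = 1 := by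
    rcases he with he | rfl
    · rw [hw, ← pow_mul, he]
      rcases eq_or_ne t 0 with rfl | ht
      · exact Or.inl (zero_pow (by omega))
      · exact Or.inr (ZMod.pow_card_sub_one_eq_one ht)
    · exact Or.inr (pow_zero _)
  rcases h with h | h
  · have : ((w ^ e : ℕ) : ZMod ℓ) = (0 : ℕ) := by push_cast; exact h
    rw [ZMod.natCast_eq_natCast_iff'] at this
    simp [this]
  · have : ((w ^ e : ℕ) : ZMod ℓ) = (1 : ℕ) := by push_cast; exact h
    rw [ZMod.natCast_eq_natCast_iff'] at this
    rw [this]; exact Nat.mod_le _ _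

theorem Twisted.splitTest {a b u v : ℤ} {p : ℕ} (h : Twisted a b u v p) {ℓ s e β : ℕ}
    (hℓ : ℓ.Prime) (hs : (s ^ 2 + 38) % ℓ = 0) (he : 3 * e = ℓ - 1 ∨ e = 0)
    (hr : p % (ℓ - 1) ≠ 0) (hβ : (β : ZMod ℓ) = b) :
    splitTest ℓ s e (p % (ℓ - 1)) β = true := by
  have := Fact.mk hℓ
  have : NeZero ℓ := ⟨hℓ.ne_zero⟩
  have hs' : (s : ZMod ℓ) ^ 2 = -38 := by
    have := (ZMod.natCast_eq_zero_iff _ ℓ).mpr (Nat.dvd_of_mod_eq_zero hs)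
    push_cast at this
    linear_combination this
  have h1 : ((ℓ - 1 : ℕ) : ZMod ℓ) = -1 := by
    rw [Nat.cast_sub hℓ.one_lt.le]; simp
  have key := fun n => sub_mul_lucasU ((a : ZMod ℓ) + b * s) (a - b * s) n
  have hU := congrArg (Int.cast : ℤ → ZMod ℓ) h.U_eq_one
  rw [U_intCast_zmod] at hU
  have hre := congrArg (Int.cast : ℤ → ZMod ℓ) h.re
  have him := congrArg (Int.cast : ℤ → ZMod ℓ) h.im
  push_cast at hU hre him
  have key := key p
  rw [show (a + b * s + (a - b * s) : ZMod ℓ) = 2 * a by ring,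
    show ((a + b * s) * (a - b * s) : ZMod ℓ) = a ^ 2 + 38 * b ^ 2 by
      linear_combination (-(b : ZMod ℓ) ^ 2) * hs', hU, pow_eq_pow_mod hr, pow_eq_pow_mod hr] at key
  have hx : (((((a : ZMod ℓ) - b * s).val + 2 * β * s) % ℓ : ℕ) : ZMod ℓ) = a + b * s := by
    rw [ZMod.natCast_mod]
    push_cast
    rw [ZMod.natCast_zmod_val, hβ]; ring
  rw [Sieve.splitTest, List.any_eq_true]
  refine ⟨((a : ZMod ℓ) - b * s).val, List.mem_range.mpr (ZMod.val_lt _), ?_⟩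
  simp only [rootTest, Bool.and_eq_true, Nat.beq_eq, Nat.ble_eq]
  refine ⟨?_, ?_, ?_⟩
  · rw [← ZMod.natCast_eq_natCast_iff', Nat.cast_pow, hx, Nat.cast_add, Nat.cast_pow,
      ZMod.natCast_mod]
    push_cast
    rw [ZMod.natCast_zmod_val, hβ]
    linear_combination -key
  · refine cube_pow_le he ((9 * u + 4 * v) + v * s) ?_
    rw [Nat.cast_mul, hx]
    push_cast
    rw [h1]
    linear_combination hre + s * him + (4 * b - v ^ 3 * s - 3 * (9 * u + 4 * v) * v ^ 2) * hs'
  · refine cube_pow_le he ((9 * u + 4 * v) - v * s) ?_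
    push_cast
    rw [ZMod.natCast_zmod_val, h1]
    linear_combination hre - s * him + (4 * b + v ^ 3 * s - 3 * (9 * u + 4 * v) * v ^ 2) * hs'

/-- One step of the sieve: the prime, a square root of `-38`, the cubic exponent, and the factors
by which the four moduli grow. -/
structure Step where
  prime : ℕ
  root : ℕ
  exponent : ℕ
  fp : ℕ
  fi : ℕ
  fj : ℕ
  fk : ℕ

/-- Residue classes for `p` and for the exponents in `b = B ^ i * 11 ^ j * 19 ^ k`. -/
structure Residues where
  (modP modI modJ modK : ℕ)
  (p i j k : ℕ)

/-- The exponents lie in the residue classes. -/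
structure Residues.Mem (c : Residues) (p i j k : ℕ) : Prop where
  p : ∃ t, p = c.p + c.modP * t
  i : ∃ t, i = c.i + c.modI * t
  j : ∃ t, j = c.j + c.modJ * t
  k : ∃ t, k = c.k + c.modK * t

/-- The subclass of the residue classes with the given digits. -/
def Step.refine (S : Step) (c : Residues) (x y z w : ℕ) : Residues :=
  ⟨c.modP * S.fp, c.modI * S.fi, c.modJ * S.fj, c.modK * S.fk,
    c.p + c.modP * x, c.i + c.modI * y, c.j + c.modJ * z, c.k + c.modK * w⟩

/-- The test of a subclass at the prime of a step. -/
def Step.test (B : ℕ) (S : Step) (c : Residues) : Bool :=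
  splitTest S.prime S.root S.exponent (c.p % (S.prime - 1))
    (B ^ c.i * 11 ^ c.j * 19 ^ c.k % S.prime)

/-- Whether some subclass survives all the tests. -/
def survives (B : ℕ) (leaf : Residues → Bool) : List Step → Residues → Bool
  | [], c => leaf c
  | S :: L, c =>
    (List.range S.fp).any fun x =>
      Nat.beq (Nat.gcd (Nat.gcd (c.p + c.modP * x) (c.modP * S.fp)) 30) 1 &&
      (List.range S.fi).any fun y => (List.range S.fj).any fun z => (List.range S.fk).any fun w =>
        S.test B (S.refine c x y z w) && survives B leaf L (S.refine c x y z w)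

/-- The side conditions on a list of steps, given the starting moduli. -/
def Valid (B : ℕ) : List Step → ℕ → ℕ → ℕ → ℕ → Prop
  | [], _, _, _, _ => True
  | S :: L, P, I, J, K =>
    (S.prime.Prime ∧ (S.prime - 1) % 2 = 0 ∧ (S.root ^ 2 + 38) % S.prime = 0 ∧
      (3 * S.exponent = S.prime - 1 ∨ S.exponent = 0) ∧
      (0 < S.fp ∧ 0 < S.fi ∧ 0 < S.fj ∧ 0 < S.fk) ∧
      P * S.fp % (S.prime - 1) = 0 ∧ B ^ (I * S.fi) % S.prime = 1 ∧
      11 ^ (J * S.fj) % S.prime = 1 ∧ 19 ^ (K * S.fk) % S.prime = 1) ∧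
    Valid B L (P * S.fp) (I * S.fi) (J * S.fj) (K * S.fk)

theorem exists_digit {n r M f : ℕ} (hf : 0 < f) (h : ∃ t, n = r + M * t) :
    ∃ x < f, ∃ t, n = r + M * x + M * f * t := by
  obtain ⟨t, rfl⟩ := h
  refine ⟨t % f, Nat.mod_lt _ hf, t / f, ?_⟩
  conv_lhs => rw [← Nat.mod_add_div t f]
  ring

theorem pow_cast_eq {ℓ B M n r : ℕ} (h1 : B ^ M % ℓ = 1) (h : ∃ t, n = r + M * t) :
    (B : ZMod ℓ) ^ n = B ^ r := by
  obtain ⟨t, rfl⟩ := h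
  have : (B : ZMod ℓ) ^ M = 1 := by
    have h2 := ZMod.natCast_mod (B ^ M) ℓ
    rw [h1] at h2
    push_cast at h2
    exact h2.symm
  rw [pow_add, pow_mul, this, one_pow, mul_one]

theorem Twisted.survives {a u v : ℤ} {B p i j k : ℕ}
    (h : Twisted a ((B ^ i * 11 ^ j * 19 ^ k : ℕ) : ℤ) u v p) (h30 : Nat.gcd p 30 = 1)
    {leaf : Residues → Bool} (hleaf : ∀ c : Residues, c.Mem p i j k → leaf c = true)
    (L : List Step) (c : Residues) (hL : Valid B L c.modP c.modI c.modJ c.modK)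
    (hc : c.Mem p i j k) : survives B leaf L c = true := by
  induction L generalizing c with
  | nil => exact hleaf c hc
  | cons S L ih =>
    obtain ⟨⟨hℓ, h2, hs, he, ⟨f1, f2, f3, f4⟩, hP, hI, hJ, hK⟩, hL⟩ := hL
    obtain ⟨x, hx, hp⟩ := exists_digit f1 hc.p
    obtain ⟨y, hy, hi⟩ := exists_digit f2 hc.i
    obtain ⟨z, hz, hj⟩ := exists_digit f3 hc.j
    obtain ⟨w, hw, hk⟩ := exists_digit f4 hc.k
    have hmod : (c.p + c.modP * x) % (S.prime - 1) = p % (S.prime - 1) := by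
      obtain ⟨t, rfl⟩ := hp
      rw [Nat.add_mod _ (c.modP * S.fp * t), Nat.mul_mod, hP]
      simp
    have hr : p % (S.prime - 1) ≠ 0 := fun h0 => by
      have hd := (Nat.dvd_of_mod_eq_zero h2).trans (Nat.dvd_of_mod_eq_zero h0)
      have := Nat.dvd_gcd hd (show 2 ∣ 30 by norm_num)
      rw [h30] at this
      norm_num at this
    rw [Sieve.survives]
    simp only [List.any_eq_true, List.mem_range, Bool.and_eq_true, Nat.beq_eq]
    refine ⟨x, hx, ?_, y, hy, z, hz, w, hw, ?_, ih _ hL ⟨hp, hi, hj, hk⟩⟩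
    · refine Nat.dvd_one.mp ?_
      rw [← h30]
      refine Nat.dvd_gcd ?_ (Nat.gcd_dvd_right _ _)
      refine (Nat.gcd_dvd_left _ _).trans ?_
      obtain ⟨t, ht⟩ := hp
      rw [ht]
      exact Nat.dvd_add (Nat.gcd_dvd_left _ _) ((Nat.gcd_dvd_right _ _).mul_right t)
    · simp only [Step.test, Step.refine]
      rw [hmod]
      refine h.splitTest hℓ hs he hr ?_
      rw [ZMod.natCast_mod]
      push_cast
      rw [pow_cast_eq hI hi]
      have h11 := pow_cast_eq hJ hj
      have h19 := pow_cast_eq hK hk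
      push_cast at h11 h19
      rw [h11, h19]

def splitStepsSeventeen : List Step :=
  [⟨7, 2, 2, 1, 1, 1, 6⟩, ⟨13, 1, 4, 1, 4, 4, 2⟩, ⟨37, 6, 12, 3, 3, 1, 3⟩, ⟨73, 20, 24, 1, 1, 6, 1⟩]

def splitStepsTwentyThree : List Step :=
  [⟨7, 2, 2, 1, 1, 1, 6⟩, ⟨13, 1, 4, 1, 1, 4, 2⟩, ⟨37, 6, 12, 3, 1, 1, 3⟩,
    ⟨109, 17, 36, 3, 1, 9, 1⟩,
    ⟨73, 20, 24, 1, 1, 2, 1⟩, ⟨181, 18, 60, 5, 1, 5, 1⟩, ⟨271, 49, 90, 1, 1, 1, 5⟩]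

/-- The classes left over to be treated at the inert prime `31`. -/
def inertLeaf (c : Residues) : Bool :=
  !(Nat.beq (c.modP % 120) 0 && Nat.beq (c.modJ % 30) 0 && Nat.beq (c.modK % 15) 0 &&
    Nat.beq (c.p % 120) 119 && [3, 14, 17].contains (11 ^ c.j * 19 ^ c.k % 31))

theorem U_ne_one_thirty_one (a b : ZMod 31) (hb : b = 3 ∨ b = 14 ∨ b = 17)
    (h : (a ^ 2 + 38 * b ^ 2) ^ 10 = 0 ∨ (a ^ 2 + 38 * b ^ 2) ^ 10 = 1) {p : ℕ}
    (hp : p % 120 = 119) : lucasU (2 * a) (a ^ 2 + 38 * b ^ 2) p ≠ 1 := by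
  have key : ∀ b : ZMod 31, (b = 3 ∨ b = 14 ∨ b = 17) → ∀ a : ZMod 31,
      ((a ^ 2 + 38 * b ^ 2) ^ 10 = 0 ∨ (a ^ 2 + 38 * b ^ 2) ^ 10 = 1) →
      pair (2 * a) (a ^ 2 + 38 * b ^ 2) (0 + 960) = pair (2 * a) (a ^ 2 + 38 * b ^ 2) 0 ∧
      ∀ i < 8, (pair (2 * a) (a ^ 2 + 38 * b ^ 2) (119 + 120 * i)).1 ≠ 1 := by decide +kernel
  obtain ⟨h1, h2⟩ := key b hb a h
  have := U_periodic h1 (p % 960) (p / 960)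
  rw [zero_add, Nat.mod_add_div] at this
  rw [this, show p % 960 = 119 + 120 * (p % 960 / 120) by omega, U_eq_pair]
  exact h2 _ (by omega)

theorem Twisted.inertLeaf {a u v z : ℤ} {p i j k : ℕ}
    (h : Twisted a ((1 ^ i * 11 ^ j * 19 ^ k : ℕ) : ℤ) u v p)
    (hz : a ^ 2 + 38 * ((1 ^ i * 11 ^ j * 19 ^ k : ℕ) : ℤ) ^ 2 = z ^ 3) (c : Residues)
    (hc : c.Mem p i j k) : inertLeaf c = true := by
  by_contra hcon
  rw [Bool.not_eq_true, Sieve.inertLeaf] at hcon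
  simp only [Bool.not_eq_false', Bool.and_eq_true, List.contains_eq_mem, List.mem_cons,
    List.not_mem_nil, or_false, decide_eq_true_eq, Nat.beq_eq] at hcon
  obtain ⟨⟨⟨⟨hP, hJ⟩, hK⟩, hp⟩, hb⟩ := hcon
  have hp' : p % 120 = 119 := by
    obtain ⟨t, rfl⟩ := hc.p
    rw [Nat.add_mod _ (c.modP * t), Nat.mul_mod, hP, hp]
    simp
  have hpow : ∀ g M n : ℕ, g ^ n % 31 = 1 → M % n = 0 → g ^ M % 31 = 1 := by
    intro g M n hg hM
    obtain ⟨t, rfl⟩ := Nat.dvd_of_mod_eq_zero hM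
    rw [pow_mul, Nat.pow_mod, hg]
    simp
  have h11 := pow_cast_eq (hpow 11 _ 30 (by norm_num) hJ) hc.j
  have h19 := pow_cast_eq (hpow 19 _ 15 (by norm_num) hK) hc.k
  push_cast at h11 h19
  have hb' : (((1 ^ i * 11 ^ j * 19 ^ k : ℕ) : ℤ) : ZMod 31) = 3 ∨
      (((1 ^ i * 11 ^ j * 19 ^ k : ℕ) : ℤ) : ZMod 31) = 14 ∨
      (((1 ^ i * 11 ^ j * 19 ^ k : ℕ) : ℤ) : ZMod 31) = 17 := by
    push_cast
    rw [h11, h19, one_pow, one_mul]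
    have h0 := ZMod.natCast_mod (11 ^ c.j * 19 ^ c.k) 31
    push_cast at h0
    rcases hb with hb | hb | hb <;> rw [hb] at h0
    · exact Or.inl h0.symm
    · exact Or.inr (Or.inl h0.symm)
    · exact Or.inr (Or.inr h0.symm)
  have hU := congrArg (Int.cast : ℤ → ZMod 31) h.U_eq_one
  have hN := congrArg (Int.cast : ℤ → ZMod 31) hz
  rw [U_intCast_zmod] at hU
  generalize ((1 ^ i * 11 ^ j * 19 ^ k : ℕ) : ℤ) = b at *
  push_cast at hU hN
  refine U_ne_one_thirty_one a b hb' ?_ hp' hU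
  rw [hN]
  have : ∀ z : ZMod 31, (z ^ 3) ^ 10 = 0 ∨ (z ^ 3) ^ 10 = 1 := by decide +kernel
  exact this _

theorem survives_seventeen : ∀ i < 3, ∀ j < 3, (i + j) % 3 ≠ 2 →
    survives 2 (fun _ => true) splitStepsSeventeen ⟨24, 3, 3, 1, 17, i, j, 0⟩ = false := by
  decide +kernel

theorem survives_twentyThree : ∀ j < 2,
    survives 1 Sieve.inertLeaf splitStepsTwentyThree ⟨24, 1, 3, 1, 23, 0, j, 0⟩ = false := by
  decide +kernel

theorem exists_eq_mod_add (n m : ℕ) : ∃ t, n = n % m + m * t := ⟨n / m, (Nat.mod_add_div n m).symm⟩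

theorem Twisted.false_of_mod_seventeen {a u v : ℤ} {p i j k : ℕ}
    (h : Twisted a ((2 ^ i * 11 ^ j * 19 ^ k : ℕ) : ℤ) u v p) (h30 : Nat.gcd p 30 = 1)
    (hp : p % 24 = 17) (hij : (i + j) % 3 ≠ 2) : False := by
  have hv : Valid 2 splitStepsSeventeen 24 3 3 1 := by
    simp only [splitStepsSeventeen, Valid]; norm_num
  have := h.survives (leaf := fun _ => true) h30 (fun _ _ => rfl) _
    ⟨24, 3, 3, 1, 17, i % 3, j % 3, 0⟩ hv
    ⟨hp ▸ exists_eq_mod_add p 24, exists_eq_mod_add i 3, exists_eq_mod_add j 3, k, by simp⟩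
  rw [survives_seventeen _ (Nat.mod_lt _ (by norm_num)) _ (Nat.mod_lt _ (by norm_num))
    (by omega)] at this
  exact absurd this (by decide)

theorem Twisted.false_of_mod_twentyThree {a u v z : ℤ} {p j k : ℕ}
    (h : Twisted a ((11 ^ j * 19 ^ k : ℕ) : ℤ) u v p) (h30 : Nat.gcd p 30 = 1)
    (hz : a ^ 2 + 38 * ((11 ^ j * 19 ^ k : ℕ) : ℤ) ^ 2 = z ^ 3)
    (hp : p % 24 = 23) (hj : j % 3 ≠ 2) : False := by
  have hv : Valid 1 splitStepsTwentyThree 24 1 3 1 := by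
    simp only [splitStepsTwentyThree, Valid]; norm_num; decide +kernel
  rw [show 11 ^ j * 19 ^ k = 1 ^ 0 * 11 ^ j * 19 ^ k by simp] at h hz
  have := h.survives h30 (h.inertLeaf hz) _ ⟨24, 1, 3, 1, 23, 0, j % 3, 0⟩ hv
    ⟨hp ▸ exists_eq_mod_add p 24, ⟨0, rfl⟩, exists_eq_mod_add j 3, ⟨k, by simp⟩⟩
  rw [survives_twentyThree _ (by omega)] at this
  exact absurd this (by decide)

theorem exponents_mod_three {a z : ℤ} {p i j k : ℕ} (hp : p % 6 = 5)
    (hz : a ^ 2 + 38 * ((2 ^ i * 11 ^ j * 19 ^ k : ℕ) : ℤ) ^ 2 = z ^ 3)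
    (hU : lucasU (2 * a) (z ^ 3) p = 1) : (i + j) % 3 ≠ 2 := by
  have hU := congrArg (Int.cast : ℤ → ZMod 9) hU
  have hN := congrArg (Int.cast : ℤ → ZMod 9) hz
  rw [U_intCast_zmod] at hU
  push_cast at hU hN
  rw [show (11 : ZMod 9) = 2 by decide, show (19 : ZMod 9) = 1 by decide, one_pow, mul_one,
    ← pow_add] at hN
  have h6 : (2 : ZMod 9) ^ (i + j) = 2 ^ ((i + j) % 6) := by
    conv_lhs => rw [← Nat.mod_add_div (i + j) 6, pow_add, pow_mul,
      show (2 : ZMod 9) ^ 6 = 1 by decide, one_pow, mul_one]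
  rw [h6] at hN
  have key : ∀ r < 6, ∀ a z : ZMod 9, a ^ 2 + 38 * (2 ^ r) ^ 2 = z ^ 3 →
      pair (2 * a) (z ^ 3) (5 + 6) = pair (2 * a) (z ^ 3) 5 ∧
      ((pair (2 * a) (z ^ 3) 5).1 = 1 → r % 3 ≠ 2) := by decide +kernel
  obtain ⟨h1, h2⟩ := key _ (Nat.mod_lt (i + j) (by norm_num)) _ _ hN
  have h3 := U_periodic h1 0 (p / 6)
  rw [add_zero, show 5 + 6 * (p / 6) = p by omega, hU, U_eq_pair] at h3
  have := h2 h3.symm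
  omega

theorem prime_mod_eight {a b z : ℤ} {p : ℕ} (hp : Odd p) (hzo : Odd z)
    (hz : a ^ 2 + 38 * b ^ 2 = z ^ 3) (hU : lucasU (2 * a) (z ^ 3) p = 1) :
    p % 8 = 1 ∨ p % 8 = 7 ∧ Odd b := by
  obtain ⟨w, rfl⟩ := hzo
  have hU := congrArg (Int.cast : ℤ → ZMod 8) hU
  have hN := congrArg (Int.cast : ℤ → ZMod 8) hz
  rw [U_intCast_zmod] at hU
  push_cast at hU hN
  have key : ∀ a w b : ZMod 8, a ^ 2 + 38 * b ^ 2 = (2 * w + 1) ^ 3 →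
      pair (2 * a) ((2 * w + 1) ^ 3) (1 + 8) = pair (2 * a) ((2 * w + 1) ^ 3) 1 ∧
      ∀ i < 8, Even i → (pair (2 * a) ((2 * w + 1) ^ 3) (1 + i)).1 = 1 →
        i = 0 ∨ i = 6 ∧ 4 * b ≠ 0 := by decide +kernel
  obtain ⟨h1, h2⟩ := key _ _ _ hN
  obtain ⟨h, rfl⟩ := hp
  have h3 := U_periodic h1 (2 * h % 8) (2 * h / 8)
  rw [add_assoc, Nat.mod_add_div, add_comm 1, hU, U_eq_pair] at h3
  rcases h2 _ (Nat.mod_lt _ (by norm_num)) (by grind) h3.symm with h4 | ⟨h4, h5⟩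
  · left; omega
  · refine Or.inr ⟨by omega, ?_⟩
    by_contra hb
    obtain ⟨c, rfl⟩ := even_iff_two_dvd.mp (Int.not_odd_iff_even.mp hb)
    refine h5 ?_
    push_cast
    have h8 : (8 : ZMod 8) = 0 := by decide
    linear_combination (c : ZMod 8) * h8

theorem Twisted.false {a u v z : ℤ} {p i j k : ℕ}
    (h : Twisted a ((2 ^ i * 11 ^ j * 19 ^ k : ℕ) : ℤ) u v p) (hp : p.Prime) (h7 : 7 ≤ p)
    (hz : a ^ 2 + 38 * ((2 ^ i * 11 ^ j * 19 ^ k : ℕ) : ℤ) ^ 2 = z ^ 3) (hzo : Odd z)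
    (hp6 : p % 6 = 5) : False := by
  have h30 : Nat.gcd p 30 = 1 := by
    refine (hp.coprime_iff_not_dvd).mpr fun hd => ?_
    have := Nat.le_of_dvd (by norm_num) hd
    interval_cases p <;> revert hp <;> simp_all
  have hU := h.U_eq_one
  rw [hz] at hU
  have hij := exponents_mod_three hp6 hz hU
  rcases prime_mod_eight (hp.odd_of_ne_two (by omega)) hzo hz hU with h8 | ⟨h8, hodd⟩
  · exact h.false_of_mod_seventeen h30 (by omega) hij
  · obtain rfl : i = 0 := by
      by_contra hi
      rw [Int.odd_coe_nat, Nat.odd_mul, Nat.odd_mul, Nat.odd_pow_iff hi] at hodd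
      exact absurd hodd.1.1 (by decide)
    rw [pow_zero, one_mul] at h hz
    exact h.false_of_mod_twentyThree h30 hz (by omega) (by omega)

end Sieve

open Lucas QuadOrder

/-- There is no solution with `d = 38` and exponent `3p`, `p ≥ 7`. -/
theorem not_isSolution_38 {x b z : ℤ} {p : ℕ} (hp : p.Prime) (h7 : 7 ≤ p) :
    ¬ IsSolution 38 x b (z ^ 3) p := by
  intro hsol
  have hodd := hp.odd_of_ne_two (by omega)
  have h3 : ¬ 3 ∣ p := fun h => by
    have := (Nat.prime_dvd_prime_iff_eq Nat.prime_three hp).mp h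
    omega
  have hzo : Odd z := (Int.odd_pow' (by norm_num)).mp hsol.odd
  have hz : 3 ≤ z := by
    have h1 := hsol.three_le
    have h2 : 1 < z := by by_contra hcon; nlinarith [sq_nonneg (z - 1), sq_nonneg (z + 1)]
    obtain ⟨w, rfl⟩ := hzo
    omega
  obtain ⟨T, c, hT⟩ := hsol.exists_root hodd (fun _ => h3) (by norm_num)
  obtain ⟨a, c, H⟩ := hT.exists_even hsol.mem hsol.odd (by norm_num)
  have hp6 := IsEvenRoot.mod_three_38 hsol hp h7 H
  have hU := H.U_eq_one (Or.inl rfl) hsol hp h7 (fun _ => rfl)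
  obtain rfl : c = b := by have := H.im; rwa [hU, mul_one] at this
  have hN : a ^ 2 + 38 * c ^ 2 = z ^ 3 := H.norm
  have hc : IsCoprime c z := (IsCoprime.of_mul_left_right hsol.coprime).of_isCoprime_of_dvd_right
    (dvd_pow_self z (by norm_num))
  rcases cubic_38 (by omega) hN hc with ⟨u, v, huv⟩ | ⟨ε, u, v, hε, huv⟩
  · have hnz : u ^ 2 + 38 * v ^ 2 = z := by
      have := congrArg nrm huv
      rw [nrm_pow, nrm_mk, nrm_mk] at this
      have h1 : (u ^ 2 + 38 * v ^ 2) ^ 3 = z ^ 3 := by linarith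
      exact (Odd.strictMono_pow (by decide : Odd 3)).injective h1
    obtain ⟨him, hre⟩ := im_pow (⟨u, v⟩ : QuadOrder 0 38) 3
    rw [← huv] at him hre
    have hnrm : nrm (⟨u, v⟩ : QuadOrder 0 38) = z := by rw [nrm_mk]; linarith
    rw [hnrm] at him hre
    simp only [zero_mul, add_zero] at him hre
    refine not_isRoot_mul (d := 38) (x := x) (T := 2 * u) (c := 2 * v) (h := 1) hsol.b_pos.ne'
      (fun ℓ hℓ hd => (hsol.smoothPrimeTo ℓ hℓ hd).imp_right
        (mt (Dvd.dvd.pow · three_ne_zero))) hz hp h7 one_ne_zero (by omega)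
      ⟨by push_cast; linarith, ?_, ?_⟩
    · rw [show p * (2 * 1 + 1) = 3 * p by ring, U_mul, ← hre, hU]
      linarith
    · rw [show p * (2 * 1 + 1) = 3 * p by ring, V_mul, ← hre]
      exact H.isRoot.re
  · obtain ⟨i, j, k, hb⟩ := hsol.smooth
    have h1 := congrArg (fun w => w.re) huv
    have h2 := congrArg (fun w => w.im) huv
    have hb' : ((2 ^ i * 11 ^ j * 19 ^ k : ℕ) : ℤ) = c := by rw [hb]; push_cast; rfl
    have hneg : lucasU (2 * -a) (z ^ 3) p = 1 := by
      rw [mul_neg, U_neg_odd _ _ hodd, hU]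
    simp [pow_succ] at h1 h2
    rcases hε with rfl | rfl
    · refine Sieve.Twisted.false (a := a) (u := u) (v := v) (z := z) (i := i) (j := j) (k := k)
        ⟨?_, ?_, ?_⟩ hp h7 ?_ hzo hp6 <;> rw [hb']
      · rwa [hN]
      · linear_combination h1
      · linear_combination h2
      · exact hN
    · refine Sieve.Twisted.false (a := -a) (u := -u) (v := v) (z := z) (i := i) (j := j) (k := k)
        ⟨?_, ?_, ?_⟩ hp h7 ?_ hzo hp6 <;> rw [hb']
      · rwa [neg_sq, hN]
      · linear_combination -h1
      · linear_combination h2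
      · rwa [neg_sq]

namespace Pell

/-- The positive solutions of `5w² - 4v² = 1` form a single orbit. -/
theorem induction {P : ℤ → ℤ → Prop} (h1 : P 1 1)
    (hs : ∀ v w, P v w → P (9 * v + 10 * w) (8 * v + 9 * w)) {v w : ℤ} (hv : 0 < v) (hw : 0 < w)
    (h : 5 * w ^ 2 - 4 * v ^ 2 = 1) : P v w := by
  obtain ⟨n, hn⟩ : ∃ n : ℕ, v < n := ⟨v.toNat + 1, by push_cast; omega⟩
  induction n generalizing v w with
  | zero => push_cast at hn; omega
  | succ n ih =>
    rcases lt_or_ge v 5 with hlt | hge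
    · have hw5 : w < 5 := by nlinarith
      interval_cases v <;> interval_cases w <;> simp_all
    · have h2 : 0 < 9 * v - 10 * w := by nlinarith
      have h3 : 0 < 9 * w - 8 * v := by nlinarith
      have h4 : 9 * v - 10 * w < v := by nlinarith
      have := hs _ _ (ih h2 h3 (by linear_combination h) (by push_cast at hn; omega))
      convert this using 1 <;> ring

/-- The generator of the solution orbit of `5w² - 4v² = 1`, modulo `N`. -/
def step {N : ℕ} (p : ZMod N × ZMod N) : ZMod N × ZMod N :=
  (9 * p.1 + 10 * p.2, 8 * p.1 + 9 * p.2)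

theorem exists_iterate {N m : ℕ} (hm : 0 < m)
    (hper : step^[m] ((1, 1) : ZMod N × ZMod N) = (1, 1)) {v w : ℤ} (hv : 0 < v) (hw : 0 < w)
    (h : 5 * w ^ 2 - 4 * v ^ 2 = 1) :
    ∃ j < m, ((v : ZMod N), (w : ZMod N)) = step^[j] (1, 1) := by
  refine induction (P := fun v w => ∃ j < m, ((v : ZMod N), (w : ZMod N)) = step^[j] (1, 1))
    ⟨0, hm, by simp⟩ ?_ hv hw h
  rintro v w ⟨j, hj, hjv⟩
  have hstep : (((9 * v + 10 * w : ℤ) : ZMod N), ((8 * v + 9 * w : ℤ) : ZMod N)) =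
      step^[j + 1] (1, 1) := by
    rw [Function.iterate_succ_apply', ← hjv, step]
    push_cast
    rfl
  rcases Nat.lt_or_ge (j + 1) m with h | h
  · exact ⟨j + 1, h, hstep⟩
  · exact ⟨0, hm, by rw [hstep, show j + 1 = m by omega, hper]; rfl⟩

theorem dvd_of_dvd {a b m : ℕ} (hm : 0 < m) (ha : a ≠ 0)
    (hper : step^[m] ((1, 1) : ZMod (a * b) × ZMod (a * b)) = (1, 1))
    (hall : ∀ j < m, (b : ZMod (a * b)) * (step^[j] ((1, 1) : ZMod (a * b) × ZMod (a * b))).1 = 0 →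
      (a : ZMod (a * b)) * (step^[j] ((1, 1) : ZMod (a * b) × ZMod (a * b))).1 = 0)
    {v w : ℤ} (hv : 0 < v) (hw : 0 < w) (h : 5 * w ^ 2 - 4 * v ^ 2 = 1) (hd : (a : ℤ) ∣ v) :
    (b : ℤ) ∣ v := by
  obtain ⟨j, hj, hjv⟩ := exists_iterate hm hper hv hw h
  have h1 := hall j hj
  rw [← hjv] at h1
  obtain ⟨k, rfl⟩ := hd
  have h2 : (a : ZMod (a * b)) * ((a * k : ℤ) : ZMod (a * b)) = 0 := by
    apply h1
    have : ((a : ZMod (a * b)) * b) = 0 := by exact_mod_cast ZMod.natCast_self (a * b)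
    push_cast
    linear_combination (k : ZMod (a * b)) * this
  have h3 : ((a * (a * k) : ℤ) : ZMod (a * b)) = 0 := by push_cast; push_cast at h2; exact h2
  rw [ZMod.intCast_zmod_eq_zero_iff_dvd] at h3
  push_cast at h3
  exact Int.dvd_of_mul_dvd_mul_left (by exact_mod_cast ha) h3

/-- Solutions of `5w² - 4v² = 1` with `v` composed of the primes `2`, `11`, `19`. -/
theorem smooth {v w : ℤ} (h : 5 * w ^ 2 - 4 * v ^ 2 = 1)
    (hs : ∀ ℓ : ℕ, ℓ.Prime → (ℓ : ℤ) ∣ v → ℓ = 2 ∨ ℓ = 11 ∨ ℓ = 19) :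
    v ^ 2 = 1 ∨ v ^ 2 = 361 := by
  have hv0 : v ≠ 0 := by rintro rfl; omega
  have hw0 : w ≠ 0 := by rintro rfl; nlinarith
  have habs : 5 * |w| ^ 2 - 4 * |v| ^ 2 = 1 := by rwa [sq_abs, sq_abs]
  have h2 : ¬ ((2 : ℕ) : ℤ) ∣ v := by
    rintro ⟨k, rfl⟩
    have key : ∀ k w : ZMod 16, 5 * w ^ 2 - 4 * (2 * k) ^ 2 ≠ 1 := by decide +kernel
    exact key k w (by exact_mod_cast congrArg (Int.cast : ℤ → ZMod 16) h)
  have h11 : ¬ ((11 : ℕ) : ℤ) ∣ v := by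
    intro hd
    have h31 := dvd_of_dvd (a := 11) (b := 31) (m := 5) (by norm_num) (by norm_num)
      (by decide +kernel) (by decide +kernel) (abs_pos.mpr hv0) (abs_pos.mpr hw0) habs
      ((dvd_abs _ _).mpr hd)
    have := hs 31 (by norm_num) ((dvd_abs _ _).mp h31)
    omega
  have h361 : ¬ ((361 : ℕ) : ℤ) ∣ v := by
    intro hd
    have h229 := dvd_of_dvd (a := 361) (b := 229) (m := 57) (by norm_num) (by norm_num)
      (by decide +kernel) (by decide +kernel) (abs_pos.mpr hv0) (abs_pos.mpr hw0)
      habs ((dvd_abs _ _).mpr hd)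
    have := hs 229 (by norm_num) ((dvd_abs _ _).mp h229)
    omega
  have h19 := Nat.eq_prime_pow_of_unique_prime_dvd (p := 19) (Int.natAbs_ne_zero.mpr hv0)
    (fun {r} hr hrd => by
      have hrd' := Int.natCast_dvd.mpr hrd
      rcases hs r hr hrd' with rfl | rfl | rfl
      · exact absurd hrd' h2
      · exact absurd hrd' h11
      · rfl)
  generalize v.natAbs.primeFactorsList.length = j at h19
  rcases Nat.lt_or_ge j 2 with hj | hj
  · rw [← Int.natAbs_sq, h19]
    interval_cases j <;> simp
  · refine absurd (Int.natCast_dvd.mpr ?_) h361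
    rw [h19]
    exact pow_dvd_pow 19 hj

end Pell

/-- An odd integer composed of `2`, `11`, `19` is a unit unless `11` or `19` divides it. -/
theorem SmoothPrimeTo.eq_one_or {Q u : ℤ} (h : SmoothPrimeTo Q u) (hu : Odd u)
    (h11 : ¬ (11 : ℤ) ∣ u) (h19 : ¬ (19 : ℤ) ∣ u) : u = 1 ∨ u = -1 := by
  by_contra h0
  have h1 : u.natAbs ≠ 1 := by omega
  obtain ⟨ℓ, hℓ, hd⟩ := Nat.exists_prime_and_dvd h1
  have hd' := Int.natCast_dvd.mpr hd
  rcases (h ℓ hℓ hd').1 with rfl | rfl | rfl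
  · exact (Int.not_even_iff_odd.mpr hu) (even_iff_two_dvd.mpr hd')
  · exact h11 hd'
  · exact h19 hd'

theorem IsSolution.prime_mem {d : ℕ} {x b y c : ℤ} {n : ℕ} (h : IsSolution d x b y n)
    (hc : c ∣ b) {ℓ : ℕ} (hℓ : ℓ.Prime) (hd : (ℓ : ℤ) ∣ d * c ^ 2) :
    ℓ = 2 ∨ ℓ = 11 ∨ ℓ = 19 := by
  have hp := Nat.prime_iff_prime_int.mp hℓ
  rcases hp.dvd_or_dvd hd with h1 | h1
  · have h2 : ℓ ∣ 418 * 2 := by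
      have := Int.natCast_dvd_natCast.mp h1
      have hmem := h.mem
      simp only [List.mem_cons, List.not_mem_nil, or_false] at hmem
      rcases hmem with rfl | rfl | rfl | rfl | rfl | rfl | rfl | rfl <;>
        exact this.trans (by norm_num)
    rw [show 418 * 2 = 2 * 2 * 11 * 19 by norm_num, hℓ.dvd_mul, hℓ.dvd_mul, hℓ.dvd_mul,
      Nat.prime_dvd_prime_iff_eq hℓ (by norm_num), Nat.prime_dvd_prime_iff_eq hℓ (by norm_num),
      Nat.prime_dvd_prime_iff_eq hℓ (by norm_num)] at h2
    tauto
  · exact (h.smoothPrimeTo ℓ hℓ (((hp.dvd_of_dvd_pow h1).trans hc).mul_left 2)).1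

theorem IsEvenRoot.U_five {d : ℕ} {x b Y a c : ℤ} {r : ℕ} (h : IsEvenRoot d x b Y r a c) :
    lucasU (2 * a) Y 5 = 5 * (a ^ 2 - d * c ^ 2) ^ 2 - 4 * (d * c ^ 2) ^ 2 := by
  rw [Lucas.U_five, ← h.norm]; ring

/-- The imaginary part of a root after passing to a power. -/
theorem IsEvenRoot.mul_im {d : ℕ} {x b Y a c : ℤ} {p q : ℕ} (h : IsEvenRoot d x b Y (p * q) a c) :
    IsEvenRoot d x b (Y ^ p) q (lucasU (2 * a) Y (p + 1) - a * lucasU (2 * a) Y p)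
      (c * lucasU (2 * a) Y p) := by
  have hV : lucasV (2 * a) Y p = 2 * (lucasU (2 * a) Y (p + 1) - a * lucasU (2 * a) Y p) := by
    rw [lucasV]; ring
  have H := h.isRoot.mul_im
  rw [hV] at H
  exact ⟨by linarith [H.norm], by linarith [H.im], by have := H.re; rw [lucasV] at this; linarith⟩

theorem exists_five_form {A B : ℤ} (h : Odd (A + B)) :
    ∃ k, 5 * (A - B) ^ 2 - 4 * B ^ 2 = 4 * k + 1 := by
  obtain ⟨k, hk⟩ := h
  exact ⟨5 * (k - B) ^ 2 + 5 * (k - B) + 1 - B ^ 2, by rw [eq_sub_of_add_eq hk]; ring⟩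

theorem not_isSolution_twentyFive {d : ℕ} {x b z : ℤ} (hd : d ≠ 209) :
    ¬ IsSolution d x b z 25 := by
  intro h
  obtain ⟨T, c₀, hr⟩ := h.exists_root (by decide) (by norm_num) (fun h' => absurd h' hd)
  obtain ⟨a, c, hr⟩ := hr.exists_even h.mem h.odd (fun _ => Or.inr (by norm_num))
  have hb : b ≠ 0 := h.b_pos.ne'
  have hr : IsEvenRoot d x b z (5 * 5) a c := hr
  have hsU := hr.isRoot.smooth_U h.smoothPrimeTo (m := 25) (by norm_num)
  have hsW := hsU
  rw [show 25 = 5 * 5 by norm_num, Lucas.U_mul] at hsW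
  have hM := hr.mul_im
  have hV : lucasV (2 * a) z 5 = 2 * (lucasU (2 * a) z (5 + 1) - a * lucasU (2 * a) z 5) := by
    rw [lucasV]; ring
  rw [hV] at hsW
  have hW := hM.U_five
  have hcb := hM.c_dvd
  have hN := hM.norm
  have hU5 : ∀ ℓ : ℕ, ℓ = 11 ∨ ℓ = 19 → ℓ.Prime → (ℓ : ℤ) ∣ lucasU (2 * a) z 25 →
      (ℓ : ℤ) ∣ lucasU (2 * a) z 5 ∧ ¬ (ℓ : ℤ) ∣ z := by
    intro ℓ hℓ hp hdv
    have hz := (hsU ℓ hp hdv).2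
    refine ⟨?_, hz⟩
    have aux : ∀ m ∈ [10, 11, 12, 18, 19, 20], (ℓ : ℤ) ∣ lucasU (2 * a) z m →
        (ℓ : ℤ) ∣ lucasU (2 * a) z 5 := by
      intro m hm hdm
      refine (Lucas.dvd_U_gcd hp hz 25 m hdv hdm).trans (Lucas.U_dvd_U _ _ ?_)
      have : ∀ m ∈ [10, 11, 12, 18, 19, 20], Nat.gcd 25 m ∣ 5 := by decide
      exact this m hm
    rcases hsU.rank hp hdv (T := 2 * a) with ⟨rfl, -⟩ | ⟨-, h' | h' | h'⟩ | ⟨-, h' | h' | h'⟩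
    · omega
    all_goals exact aux _ (by simp) h'
  set A := lucasU (2 * a) z (5 + 1) - a * lucasU (2 * a) z 5
  set W := lucasU (2 * A) (z ^ 5) 5
  set C := c * lucasU (2 * a) z 5 with hC
  have hndvd : ∀ ℓ : ℕ, ℓ = 11 ∨ ℓ = 19 → ℓ.Prime → ¬ (ℓ : ℤ) ∣ W := by
    intro ℓ hℓ hp hdv
    have hpi := Nat.prime_iff_prime_int.mp hp
    obtain ⟨h1, h2⟩ := hU5 ℓ hℓ hp (by
      rw [show 25 = 5 * 5 by norm_num, Lucas.U_mul, hV]; exact hdv.mul_left _)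
    have h3 : (ℓ : ℤ) ∣ d * C ^ 2 := (dvd_pow (h1.mul_left c) two_ne_zero).mul_left _
    obtain ⟨k, hk⟩ := h3
    rw [hk] at hW hN
    have h5 : (ℓ : ℤ) ∣ 5 * (z ^ 5) ^ 2 := by
      have : 5 * (z ^ 5) ^ 2 = W + ℓ * (k * (5 * (2 * A ^ 2 + ℓ * k) - 
          (5 * (ℓ * k - 2 * A ^ 2) - 4 * (ℓ * k)))) := by
        rw [hW, ← hN]; ring
      rw [this]
      exact dvd_add hdv (Dvd.intro _ rfl)
    rcases hpi.dvd_or_dvd h5 with h6 | h6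
    · have := Int.le_of_dvd (by norm_num) h6
      omega
    · exact h2 (hpi.dvd_of_dvd_pow (hpi.dvd_of_dvd_pow h6))
  have hWs : SmoothPrimeTo z W := hsW.of_dvd (Dvd.intro_left _ rfl)
  have hodd : Odd (A ^ 2 + d * C ^ 2) := hN ▸ h.odd.pow
  have hBs := fun (ℓ : ℕ) (hℓ : ℓ.Prime) hdv => h.prime_mem hcb hℓ hdv
  generalize (d : ℤ) * C ^ 2 = B at *
  have hz5 : 3 ^ 5 ≤ z ^ 5 := pow_le_pow_left₀ (by norm_num) h.three_le 5
  generalize A ^ 2 = A₂ at *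
  obtain ⟨k, hk⟩ := exists_five_form hodd
  rw [← hW] at hk
  have hW1 : W = 1 := by
    rcases hWs.eq_one_or ⟨2 * k, by rw [hk]; ring⟩ (hndvd 11 (by simp) (by norm_num))
      (hndvd 19 (by simp) (by norm_num)) with h1 | h1 <;> omega
  have hP := Pell.smooth (w := A₂ - B) (v := B) (by rw [← hW, hW1]) hBs
  have hle : (A₂ - B) ^ 2 ≤ 17 ^ 2 := by rcases hP with hP | hP <;> rw [hP] at hW <;> linarith
  have hle' : B ^ 2 ≤ 19 ^ 2 := by rcases hP with hP | hP <;> rw [hP] <;> norm_num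
  have h1 := abs_le_of_sq_le_sq hle (by norm_num)
  have h2 := abs_le_of_sq_le_sq hle' (by norm_num)
  rw [abs_le] at h1 h2
  linarith

/-- Positive odd integers composed of `11` and `19` are `1` or `3` modulo `8`. -/
theorem SmoothPrimeTo.mod_eight {Q u : ℤ} (h : SmoothPrimeTo Q u) (hu : Odd u) (hpos : 0 < u) :
    u % 8 = 1 ∨ u % 8 = 3 := by
  obtain ⟨n, rfl⟩ := Int.eq_ofNat_of_zero_le hpos.le
  induction n using Nat.strong_induction_on with
  | _ n ih =>
    rcases eq_or_ne n 1 with rfl | h1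
    · simp
    obtain ⟨ℓ, hℓ, k, rfl⟩ := Nat.exists_prime_and_dvd h1
    have hk : 0 < k := Nat.pos_of_ne_zero (by rintro rfl; simp at hpos)
    push_cast at hu h
    rw [Int.odd_mul] at hu
    have hk8 := ih k (lt_mul_of_one_lt_left hk hℓ.one_lt) (h.of_dvd (Dvd.intro_left _ rfl)) hu.2
      (by exact_mod_cast hk)
    rcases (h ℓ hℓ (Dvd.intro _ rfl)).1 with rfl | rfl | rfl
    · exact absurd hu.1 (by decide)
    all_goals push_cast; omega

theorem SmoothPrimeTo.not_prime_dvd {Q u : ℤ} (h : SmoothPrimeTo Q u) (ℓ : ℕ) (hℓ : ℓ.Prime)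
    (h19 : ℓ ≠ 2 ∧ ℓ ≠ 11 ∧ ℓ ≠ 19) : ¬ (ℓ : ℤ) ∣ u := by
  intro hd
  have := (h ℓ hℓ hd).1
  omega

/-- A positive smooth integer is one of `1`, `2`, a multiple of `4`, or a multiple of `11`
or `19`. -/
theorem SmoothPrimeTo.cases_of_pos {Q u : ℤ} (h : SmoothPrimeTo Q u) (hpos : 0 < u)
    (h11 : ¬ (11 : ℤ) ∣ u) (h19 : ¬ (19 : ℤ) ∣ u) : u = 1 ∨ u = 2 ∨ 4 ∣ u := by
  rcases Int.even_or_odd u with he | ho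
  · obtain ⟨k, rfl⟩ := even_iff_two_dvd.mp he
    rcases Int.even_or_odd k with he | ho
    · obtain ⟨j, rfl⟩ := even_iff_two_dvd.mp he
      exact Or.inr (Or.inr ⟨j, by ring⟩)
    · rcases (h.of_dvd (Dvd.intro_left _ rfl)).eq_one_or ho (fun hd => h11 (hd.mul_left _))
        (fun hd => h19 (hd.mul_left _)) with rfl | rfl <;> omega
  · rcases h.eq_one_or ho h11 h19 with rfl | rfl <;> omega

namespace ExponentTen

theorem eq_two_of_form_eq_one {Q u v : ℤ} (hu0 : 0 < u) (hv0 : 0 < v) (hu : SmoothPrimeTo Q u)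
    (hv : SmoothPrimeTo Q v) (hg : SmoothPrimeTo Q (5 * (u - v) ^ 2 - 4 * u ^ 2))
    (hf : 5 * (u - v) ^ 2 - 4 * v ^ 2 = 1) : u = 2 ∧ v = 1 := by
  rcases Pell.smooth hf (fun ℓ hℓ hd => (hv ℓ hℓ hd).1) with h1 | h1
  · have hv1 : v = 1 := by nlinarith
    subst hv1
    have : (u - 2) * u = 0 := by linarith
    rcases mul_eq_zero.mp this with h | h <;> omega
  · have hv1 : v = 19 := by nlinarith
    subst hv1
    have : (u - 36) * (u - 2) = 0 := by linarith
    rcases mul_eq_zero.mp this with h | h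
    · obtain rfl : u = 36 := by omega
      exact absurd (by norm_num) (hu.not_prime_dvd 3 (by norm_num) (by norm_num))
    · obtain rfl : u = 2 := by omega
      exact absurd (by norm_num) (hg.not_prime_dvd 1429 (by norm_num) (by norm_num))

theorem false_of_one {Q u : ℤ} (hu0 : 0 < u) (hu : 4 ∣ u)
    (hf : SmoothPrimeTo Q (5 * (u - 1) ^ 2 - 4))
    (hg : SmoothPrimeTo Q (5 * (u - 1) ^ 2 - 4 * u ^ 2)) : False := by
  obtain ⟨k, rfl⟩ := hu
  by_cases h : 3 ≤ k
  · have hpos : 0 < 5 * (4 * k - 1) ^ 2 - 4 * (4 * k) ^ 2 := by nlinarith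
    have heq : 5 * (4 * k - 1) ^ 2 - 4 * (4 * k) ^ 2 = 8 * (2 * k ^ 2 - 5 * k) + 5 := by ring
    have := hg.mod_eight ⟨4 * (2 * k ^ 2 - 5 * k) + 2, by rw [heq]; ring⟩ hpos
    omega
  · obtain rfl | rfl : k = 1 ∨ k = 2 := by omega
    · exact hf.not_prime_dvd 41 (by norm_num) (by norm_num) (by norm_num)
    · exact hf.not_prime_dvd 241 (by norm_num) (by norm_num) (by norm_num)

/-- Modulo `11` or `19` at most one of the four factors vanishes. -/
theorem not_dvd_two (z a : ℤ) {ℓ : ℕ} (hℓ : ℓ = 11 ∨ ℓ = 19) (hz : ¬ (ℓ : ℤ) ∣ z) :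
    ¬ ((ℓ : ℤ) ∣ z + a ∧ (ℓ : ℤ) ∣ z - a) ∧
    ¬ ((ℓ : ℤ) ∣ 5 * a ^ 2 - (z - a) ^ 2 ∧ (ℓ : ℤ) ∣ 5 * a ^ 2 - (z + a) ^ 2) ∧
    ¬ ((ℓ : ℤ) ∣ 5 * a ^ 2 - (z - a) ^ 2 ∧ (ℓ : ℤ) ∣ z + a) ∧
    ¬ ((ℓ : ℤ) ∣ 5 * a ^ 2 - (z - a) ^ 2 ∧ (ℓ : ℤ) ∣ z - a) ∧
    ¬ ((ℓ : ℤ) ∣ 5 * a ^ 2 - (z + a) ^ 2 ∧ (ℓ : ℤ) ∣ z + a) ∧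
    ¬ ((ℓ : ℤ) ∣ 5 * a ^ 2 - (z + a) ^ 2 ∧ (ℓ : ℤ) ∣ z - a) := by
  simp only [← ZMod.intCast_zmod_eq_zero_iff_dvd] at hz ⊢
  push_cast at hz ⊢
  generalize (z : ZMod ℓ) = z at *
  generalize (a : ZMod ℓ) = a at *
  rcases hℓ with rfl | rfl <;> revert z a <;> decide +kernel

theorem eq_of_odd {z a : ℤ} (ha : Odd a) (hz : Odd z) (hP0 : 0 < z + a) (hR0 : 0 < z - a)
    (hP : SmoothPrimeTo z (z + a)) (hR : SmoothPrimeTo z (z - a))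
    (hf : SmoothPrimeTo z (5 * a ^ 2 - (z - a) ^ 2))
    (hg : SmoothPrimeTo z (5 * a ^ 2 - (z + a) ^ 2)) : z = 3 ∧ (a = 1 ∨ a = -1) := by
  have h11 : (11 : ℤ) ∣ z ∨ _ := or_iff_not_imp_left.mpr (not_dvd_two z a (ℓ := 11) (by simp))
  have h19 : (19 : ℤ) ∣ z ∨ _ := or_iff_not_imp_left.mpr (not_dvd_two z a (ℓ := 19) (by simp))
  have e11 : ∀ u, SmoothPrimeTo z u → (11 : ℤ) ∣ u → ¬ (11 : ℤ) ∣ z :=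
    fun u hu hd => (hu 11 (by norm_num) hd).2
  have e19 : ∀ u, SmoothPrimeTo z u → (19 : ℤ) ∣ u → ¬ (19 : ℤ) ∣ z :=
    fun u hu hd => (hu 19 (by norm_num) hd).2
  have f11 := e11 _ hf
  have f19 := e19 _ hf
  have g11 := e11 _ hg
  have g19 := e19 _ hg
  obtain ⟨u, hu⟩ : ∃ u, z + a = 2 * u := (even_iff_two_dvd.mp (hz.add_odd ha))
  obtain ⟨v, hv⟩ : ∃ v, z - a = 2 * v := (even_iff_two_dvd.mp (hz.sub_odd ha))
  obtain rfl : z = u + v := by omega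
  obtain rfl : a = u - v := by omega
  rw [hu] at hP hg h11 h19 g11 g19
  rw [hv] at hR hf h11 h19 f11 f19
  have ef : 5 * (u - v) ^ 2 - (2 * v) ^ 2 = 5 * (u - v) ^ 2 - 4 * v ^ 2 := by ring
  have eg : 5 * (u - v) ^ 2 - (2 * u) ^ 2 = 5 * (u - v) ^ 2 - 4 * u ^ 2 := by ring
  rw [ef, eg] at h11 h19
  rw [ef] at hf f11 f19
  rw [eg] at hg g11 g19
  have hu' := hP.of_dvd (Dvd.intro_left _ rfl)
  have hv' := hR.of_dvd (Dvd.intro_left _ rfl)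
  have hswap : (v - u) ^ 2 = (u - v) ^ 2 := by ring
  by_cases hf1 : 5 * (u - v) ^ 2 - 4 * v ^ 2 = 1
  · obtain ⟨rfl, rfl⟩ := eq_two_of_form_eq_one (by omega) (by omega) hu' hv' hg hf1
    norm_num
  by_cases hg1 : 5 * (u - v) ^ 2 - 4 * u ^ 2 = 1
  · obtain ⟨rfl, rfl⟩ := eq_two_of_form_eq_one (u := v) (v := u) (by omega) (by omega) hv' hu'
      (by rwa [hswap]) (by rwa [hswap])
    norm_num
  exfalso
  obtain ⟨k, hk⟩ := ha
  have hf4 : 5 * (u - v) ^ 2 - 4 * v ^ 2 = 4 * (5 * k ^ 2 + 5 * k + 1 - v ^ 2) + 1 := by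
    rw [hk]; ring
  have hg4 : 5 * (u - v) ^ 2 - 4 * u ^ 2 = 4 * (5 * k ^ 2 + 5 * k + 1 - u ^ 2) + 1 := by
    rw [hk]; ring
  have hfd : (11 : ℤ) ∣ 5 * (u - v) ^ 2 - 4 * v ^ 2 ∨ (19 : ℤ) ∣ 5 * (u - v) ^ 2 - 4 * v ^ 2 := by
    by_contra! hcon
    rcases hf.eq_one_or ⟨2 * (5 * k ^ 2 + 5 * k + 1 - v ^ 2), by rw [hf4]; ring⟩ hcon.1 hcon.2
      with h | h <;> omega
  have hgd : (11 : ℤ) ∣ 5 * (u - v) ^ 2 - 4 * u ^ 2 ∨ (19 : ℤ) ∣ 5 * (u - v) ^ 2 - 4 * u ^ 2 := by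
    by_contra! hcon
    rcases hg.eq_one_or ⟨2 * (5 * k ^ 2 + 5 * k + 1 - u ^ 2), by rw [hg4]; ring⟩ hcon.1 hcon.2
      with h | h <;> omega
  obtain ⟨hu11, hu19, hv11, hv19⟩ : ¬ (11 : ℤ) ∣ 2 * u ∧ ¬ (19 : ℤ) ∣ 2 * u ∧
      ¬ (11 : ℤ) ∣ 2 * v ∧ ¬ (19 : ℤ) ∣ 2 * v := by
    clear hP hR hf hg hu' hv' e11 e19 hf1 hg1 hf4 hg4 ef eg hswap
    grind
  have cu := hu'.cases_of_pos (by omega) (fun h => hu11 (h.mul_left _))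
    (fun h => hu19 (h.mul_left _))
  have cv := hv'.cases_of_pos (by omega) (fun h => hv11 (h.mul_left _))
    (fun h => hv19 (h.mul_left _))
  rcases Int.even_or_odd v with hv2 | hv2
  · obtain rfl : u = 1 := by
      obtain ⟨i, hi⟩ := hv2
      obtain ⟨j, hj⟩ := hz
      rcases cu with h | h | h <;> omega
    rcases cv with rfl | rfl | cv
    · omega
    · norm_num at hg1
    · exact false_of_one (u := v) (by omega) cv (by rw [← hswap] at hg; simpa using hg)
        (by rw [← hswap] at hf; simpa using hf)
  · obtain rfl : v = 1 := by
      obtain ⟨i, hi⟩ := hv2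
      rcases cv with h | h | h <;> omega
    rcases cu with rfl | rfl | cu
    · omega
    · norm_num at hf1
    · exact false_of_one (by omega) cu (by simpa using hf) (by simpa using hg)

theorem false_of_even {z a : ℤ} (ha : Even a) (hz : Odd z) (hz3 : 3 ≤ z) (hP0 : 0 < z + a)
    (hR0 : 0 < z - a) (hP : SmoothPrimeTo z (z + a)) (hR : SmoothPrimeTo z (z - a))
    (hf : SmoothPrimeTo z (5 * a ^ 2 - (z - a) ^ 2))
    (hg : SmoothPrimeTo z (5 * a ^ 2 - (z + a) ^ 2)) : False := by
  have h11 : (11 : ℤ) ∣ z ∨ _ := or_iff_not_imp_left.mpr (not_dvd_two z a (ℓ := 11) (by simp))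
  have h19 : (19 : ℤ) ∣ z ∨ _ := or_iff_not_imp_left.mpr (not_dvd_two z a (ℓ := 19) (by simp))
  have e11 : ∀ u, SmoothPrimeTo z u → (11 : ℤ) ∣ u → ¬ (11 : ℤ) ∣ z :=
    fun u hu hd => (hu 11 (by norm_num) hd).2
  have e19 : ∀ u, SmoothPrimeTo z u → (19 : ℤ) ∣ u → ¬ (19 : ℤ) ∣ z :=
    fun u hu hd => (hu 19 (by norm_num) hd).2
  have ha0 : a ≠ 0 := by
    rintro rfl
    obtain ⟨ℓ, hℓ, hd⟩ := Int.exists_prime_and_dvd (n := z) (by omega)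
    exact (hP ℓ.natAbs (Int.prime_iff_natAbs_prime.mp hℓ) (by simpa using hd)).2 (by simpa using hd)
  have hPo : Odd (z + a) := hz.add_even ha
  have hRo : Odd (z - a) := hz.sub_even ha
  have cP : z + a = 1 ∨ (11 : ℤ) ∣ z + a ∨ (19 : ℤ) ∣ z + a := by
    by_contra! h
    rcases hP.eq_one_or hPo h.2.1 h.2.2 with h' | h' <;> omega
  have cR : z - a = 1 ∨ (11 : ℤ) ∣ z - a ∨ (19 : ℤ) ∣ z - a := by
    by_contra! h
    rcases hR.eq_one_or hRo h.2.1 h.2.2 with h' | h' <;> omega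
  have aux : ∀ w, Odd w → SmoothPrimeTo z (5 * a ^ 2 - w ^ 2) → 5 * a ^ 2 - w ^ 2 = -1 ∨
      (11 : ℤ) ∣ 5 * a ^ 2 - w ^ 2 ∨ (19 : ℤ) ∣ 5 * a ^ 2 - w ^ 2 := by
    intro w hw hs
    obtain ⟨k, hk⟩ := hw
    obtain ⟨j, hj⟩ := ha
    have h4 : 5 * a ^ 2 - w ^ 2 = 4 * (5 * j ^ 2 - k ^ 2 - k) - 1 := by rw [hk, hj]; ring
    by_contra! h
    rcases hs.eq_one_or ⟨2 * (5 * j ^ 2 - k ^ 2 - k) - 1, by rw [h4]; ring⟩ h.2.1 h.2.2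
      with h' | h' <;> omega
  have cf := aux _ hRo hf
  have cg := aux _ hPo hg
  have f11 := e11 _ hf
  have f19 := e19 _ hf
  have g11 := e11 _ hg
  have g19 := e19 _ hg
  have P11 := e11 _ hP
  have P19 := e19 _ hP
  have key : (z + a = 1 ∧ z - a = 1) ∨
      (5 * a ^ 2 - (z - a) ^ 2 = -1 ∧ 5 * a ^ 2 - (z + a) ^ 2 = -1) ∨
      (5 * a ^ 2 - (z - a) ^ 2 = -1 ∧ (z + a = 1 ∨ z - a = 1)) ∨
      (5 * a ^ 2 - (z + a) ^ 2 = -1 ∧ (z + a = 1 ∨ z - a = 1)) := by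
    clear hP hR hf hg e11 e19 aux
    grind
  rcases key with ⟨h1, h2⟩ | ⟨h1, h2⟩ | ⟨h1, h2 | h2⟩ | ⟨h1, h2 | h2⟩
  · omega
  · have : a * z = 0 := by linarith
    rcases mul_eq_zero.mp this with h | h <;> omega
  · obtain rfl : z = 1 - a := by omega
    have : a * (a + 4) = 0 := by linarith
    rcases mul_eq_zero.mp this with h | h
    · exact ha0 h
    · obtain rfl : a = -4 := by omega
      exact hR.not_prime_dvd 3 (by norm_num) (by norm_num) (by norm_num)
  · rw [h2] at h1
    exact ha0 (by nlinarith)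
  · rw [h2] at h1
    exact ha0 (by nlinarith)
  · obtain rfl : z = 1 + a := by omega
    have : a * (a - 4) = 0 := by linarith
    rcases mul_eq_zero.mp this with h | h
    · exact ha0 h
    · obtain rfl : a = 4 := by omega
      exact hP.not_prime_dvd 3 (by norm_num) (by norm_num) (by norm_num)

end ExponentTen

theorem IsSolution.eq_of_exponent_ten {d : ℕ} {x b z : ℤ} (hd : d ≠ 209)
    (h : IsSolution d x b z 10) : d = 2 ∧ x = 241 ∧ b = 22 ∧ z = 3 := by
  have h' : IsSolution d x b z (2 * 5) := h
  have h5 := h'.root_pow two_ne_zero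
  obtain ⟨T, c₀, hr⟩ := h5.exists_root (by decide) (by norm_num) (fun h' => absurd h' hd)
  obtain ⟨a, c, hr⟩ := hr.exists_even h5.mem h5.odd (fun _ => Or.inr (by norm_num))
  have hb : b ≠ 0 := h.b_pos.ne'
  have hc : c ≠ 0 := by rintro rfl; exact hb (by rw [← hr.im, zero_mul])
  have hB : (z + a) * (z - a) = d * c ^ 2 := by linear_combination -hr.norm
  have hB0 : (0 : ℤ) < d * c ^ 2 := by have := h.d_pos; positivity
  have hz0 := h.three_le
  obtain ⟨ha1, ha2⟩ := abs_lt.mp (abs_lt_of_sq_lt_sq (by linarith [hr.norm] : a ^ 2 < z ^ 2)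
    (by linarith))
  have hBs : SmoothPrimeTo z ((z + a) * (z - a)) := by
    intro ℓ hℓ hdv
    rw [hB] at hdv
    refine ⟨h.prime_mem hr.c_dvd hℓ hdv, h.not_dvd_y hℓ ?_⟩
    have hp := Nat.prime_iff_prime_int.mp hℓ
    rcases hp.dvd_or_dvd hdv with h1 | h1
    · exact h1.mul_right _
    · exact ((hp.dvd_of_dvd_pow h1).trans hr.c_dvd).mul_left _
  have hU := hr.U_five
  have hUs := hr.isRoot.smooth_U h5.smoothPrimeTo dvd_rfl
  have hfg : lucasU (2 * a) (z ^ 2) 5 =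
      (5 * a ^ 2 - (z - a) ^ 2) * (5 * a ^ 2 - (z + a) ^ 2) := by rw [hU, ← hB]; ring
  have hfs : SmoothPrimeTo z ((5 * a ^ 2 - (z - a) ^ 2) * (5 * a ^ 2 - (z + a) ^ 2)) := by
    rw [← hfg]
    exact fun ℓ hℓ hdv => ⟨(hUs ℓ hℓ hdv).1, fun hz => (hUs ℓ hℓ hdv).2 (hz.pow two_ne_zero)⟩
  have hP := hBs.of_dvd (Dvd.intro _ rfl)
  have hR := hBs.of_dvd (Dvd.intro_left _ rfl)
  have hf := hfs.of_dvd (Dvd.intro _ rfl)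
  have hg := hfs.of_dvd (Dvd.intro_left _ rfl)
  rcases Int.even_or_odd a with ha | ha
  · exact (ExponentTen.false_of_even ha h.odd hz0 (by linarith) (by linarith) hP hR hf hg).elim
  obtain ⟨rfl, ha⟩ := ExponentTen.eq_of_odd ha h.odd (by linarith) (by linarith) hP hR hf hg
  have hU11 : lucasU (2 * a) (3 ^ 2) 5 = -11 := by
    rw [hfg]; rcases ha with rfl | rfl <;> norm_num
  have hB8 : (d : ℤ) * c ^ 2 = 8 := by rw [← hB]; rcases ha with rfl | rfl <;> norm_num
  have hd2 : d = 2 := by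
    have hmem := h.mem
    have hc1 : 1 ≤ c ^ 2 := Int.add_one_le_iff.mpr (sq_pos_of_ne_zero hc)
    simp only [List.mem_cons, List.not_mem_nil, or_false] at hmem
    rcases hmem with rfl | rfl | rfl | rfl | rfl | rfl | rfl | rfl
    · exfalso
      have : |c| < 3 := abs_lt_of_sq_lt_sq (by push_cast at hB8; linarith) (by norm_num)
      obtain ⟨h1, h2⟩ := abs_lt.mp this
      interval_cases c <;> norm_num at hB8
    · rfl
    all_goals exfalso; push_cast at hB8; linarith
  subst hd2
  have hc2 : (c - 2) * (c + 2) = 0 := by push_cast at hB8; linarith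
  have him := hr.im
  rw [hU11] at him
  have hbpos := h.b_pos
  have hb22 : b = 22 := by
    rcases mul_eq_zero.mp hc2 with h1 | h1 <;> omega
  subst hb22
  refine ⟨rfl, ?_, rfl, rfl⟩
  have heq := h.eq
  have hx := h.pos
  push_cast at heq
  nlinarith

theorem SmoothPrimeTo.exists_natAbs_pow {Q u : ℤ} (h : SmoothPrimeTo Q u) (hu : u ≠ 0) {q : ℕ}
    (hq : ∀ ℓ : ℕ, ℓ = 2 ∨ ℓ = 11 ∨ ℓ = 19 → (ℓ : ℤ) ∣ u → ℓ = q) : ∃ k : ℕ, u.natAbs = q ^ k :=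
  ⟨_, Nat.eq_prime_pow_of_unique_prime_dvd (Int.natAbs_ne_zero.mpr hu) fun {ℓ} hℓ hd =>
    hq ℓ (h ℓ hℓ (Int.natCast_dvd.mpr hd)).1 (Int.natCast_dvd.mpr hd)⟩

theorem not_isSolution_fifteen_of_eq_38 {x b z : ℤ} : ¬ IsSolution 38 x b z 15 := by
  intro h
  have h' : IsSolution 38 x b z (3 * 5) := h
  have h5 := h'.root_pow three_ne_zero
  obtain ⟨T, c₀, hr⟩ := h5.exists_root (by decide) (by norm_num) (by norm_num)
  obtain ⟨a, c, hr⟩ := hr.exists_even h5.mem h5.odd (fun _ => Or.inr (by norm_num))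
  have hU := hr.U_five
  have hUs := hr.isRoot.smooth_U h5.smoothPrimeTo dvd_rfl
  have hU0 := hr.isRoot.U_ne_zero h.b_pos.ne' dvd_rfl
  obtain ⟨k, hk⟩ := exists_five_form (A := a ^ 2) (B := (38 : ℕ) * c ^ 2) (hr.norm ▸ h5.odd)
  rw [← hU] at hk
  have hz : (z : ZMod 19) ≠ 0 := zmod_ne_zero (h.not_dvd_y (ℓ := 19) (by norm_num)
    ((by norm_num : ((19 : ℕ) : ℤ) ∣ ((38 : ℕ) : ℤ)).mul_right _))
  have h38 : ((38 : ℕ) : ZMod 19) = 0 := by decide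
  have hN : (a : ZMod 19) ^ 2 = (z : ZMod 19) ^ 3 := by
    have := congrArg (Int.cast : ℤ → ZMod 19) hr.norm
    push_cast at this
    rw [← this]
    linear_combination (-(c : ZMod 19) ^ 2) * h38
  have hU19 : ((lucasU (2 * a) (z ^ 3) 5 : ℤ) : ZMod 19) = 5 * (z : ZMod 19) ^ 6 := by
    rw [hU]
    push_cast
    have h38' : (38 : ZMod 19) = 0 := by decide
    rw [hN, h38']
    ring
  have hz18 : (z : ZMod 19) ^ 18 = 1 := by
    have : ∀ w : ZMod 19, w ≠ 0 → w ^ 18 = 1 := by decide +kernel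
    exact this _ hz
  obtain ⟨j, hj⟩ := hUs.exists_natAbs_pow hU0 (q := 11) (by
    rintro ℓ (rfl | rfl | rfl) hd
    · omega
    · rfl
    · rw [← ZMod.intCast_zmod_eq_zero_iff_dvd, hU19] at hd
      have : ∀ w : ZMod 19, w ≠ 0 → 5 * w ^ 6 ≠ 0 := by decide +kernel
      exact absurd hd (this _ hz))
  have hU6 : (lucasU (2 * a) (z ^ 3) 5) ^ 6 = ((11 : ℤ) ^ 6) ^ j := by
    rw [← (by decide : Even 6).pow_abs, ← Int.natCast_natAbs, hj]
    push_cast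
    rw [← pow_mul, mul_comm, pow_mul]
    norm_num
  have h1 := congrArg (Int.cast : ℤ → ZMod 19) hU6
  rw [Int.cast_pow, hU19, Int.cast_pow, show (((11 : ℤ) ^ 6 : ℤ) : ZMod 19) = 1 by decide +kernel,
    one_pow, mul_pow, ← pow_mul] at h1
  have h2 : (5 : ZMod 19) ^ 6 = 1 := by
    rw [← h1, show (z : ZMod 19) ^ (6 * 6) = ((z : ZMod 19) ^ 18) ^ 2 by ring, hz18]; ring
  exact absurd h2 (by decide)

namespace ExponentFifteen

theorem U_fifteen {R : Type*} [CommRing R] (T Q : R) : lucasU T Q 15 =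
    (T ^ 2 - Q) * (T ^ 4 - 3 * T ^ 2 * Q + Q ^ 2) *
      ((T ^ 2 - Q) ^ 4 - 5 * Q * T ^ 2 * (T ^ 2 - 2 * Q) ^ 2) := by
  have hV : lucasV T Q 3 = T ^ 3 - 3 * T * Q := by
    rw [Lucas.V_add_two, Lucas.V_add_two, zero_add, Lucas.V_one, Lucas.V_zero]
    ring
  rw [show 15 = 3 * 5 by norm_num, Lucas.U_mul, Lucas.U_three, Lucas.U_five, hV]
  ring

theorem two_pow_bound {m B e : ℤ} (hm : 3 ≤ m) (hB : 2 ≤ B) (he : e = 1 ∨ e = -1) :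
    ((8 * m - 1) * B + e) * ((8 * m - 2) * B + e) * ((8 * m - 4) * B + e) <
      m * (4 * m * B + e) * (32 * m ^ 2 * B ^ 2 + 8 * m * B * e + 1) := by
  obtain ⟨i, rfl⟩ := Int.le.dest hm
  obtain ⟨j, rfl⟩ := Int.le.dest hB
  rw [← sub_pos]
  rcases he with rfl | rfl <;> ring_nf <;> positivity

/-- The case of `B` a power of two in the exponent `15`. -/
theorem two_pow_case {A : ℤ} {s : ℕ} (hQ : 3 ≤ A + 2 ^ s) (hQo : Odd (A + 2 ^ s))
    (h : 32 * A * 2 ^ s * (A - 2 ^ s) * (A - 3 * 2 ^ s) = (A + 2 ^ s) ^ 4 - 1) : False := by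
  rcases s with - | s
  · have h1 : A * (A ^ 3 - 28 * A ^ 2 + 134 * A - 92) = 0 := by linear_combination -h
    rcases mul_eq_zero.mp h1 with h2 | h2
    · omega
    · have key : ∀ w : ZMod 7, w ^ 3 - 28 * w ^ 2 + 134 * w - 92 ≠ 0 := by decide +kernel
      exact key A (by exact_mod_cast congrArg (Int.cast : ℤ → ZMod 7) h2)
  have hB : (2 : ℤ) ≤ 2 ^ (s + 1) := by
    rw [pow_succ]; linarith [one_le_pow₀ (by norm_num : (1 : ℤ) ≤ 2) (n := s)]
  have hBe : (2 : ℤ) ∣ 2 ^ (s + 1) := dvd_pow_self 2 (by omega)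
  obtain ⟨e, t, he, hN⟩ : ∃ e t : ℤ, (e = 1 ∨ e = -1) ∧ A + 2 ^ (s + 1) = 4 * t + e := by
    obtain ⟨k, hk⟩ := hQo
    rcases Int.even_or_odd' k with ⟨j, hj | hj⟩
    · exact ⟨1, j, Or.inl rfl, by omega⟩
    · exact ⟨-1, j + 1, Or.inr rfl, by omega⟩
  have he2 : e ^ 2 = 1 := by rcases he with rfl | rfl <;> norm_num
  have h1 : 2 ^ (s + 1 + 1) * (A * (A - 2 ^ (s + 1)) * (A - 3 * 2 ^ (s + 1))) =
      t * ((2 * t + e) * (8 * t ^ 2 + 4 * t * e + 1)) := by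
    rw [hN] at h
    rw [pow_succ _ (s + 1)]
    refine mul_left_cancel₀ (by norm_num : (16 : ℤ) ≠ 0) ?_
    linear_combination h + (e ^ 2 + 1 + 32 * t ^ 2 + 8 * t * e + 8 * t * e) * he2
  obtain ⟨m, rfl⟩ : (2 : ℤ) ^ (s + 1 + 1) ∣ t := by
    refine IsCoprime.dvd_of_dvd_mul_right ?_ (Dvd.intro _ h1)
    refine IsCoprime.pow_left (Int.isCoprime_two_left.mpr (Odd.mul ?_ ?_))
    · rcases he with rfl | rfl
      · exact ⟨t, rfl⟩
      · exact ⟨t - 1, by ring⟩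
    · exact ⟨4 * t ^ 2 + 2 * t * e, by ring⟩
  rw [mul_assoc (2 ^ (s + 1 + 1)) m] at h1
  have h2 := mul_left_cancel₀ (by positivity : (2 : ℤ) ^ (s + 1 + 1) ≠ 0) h1
  rw [pow_succ _ (s + 1)] at h2 hN
  generalize (2 : ℤ) ^ (s + 1) = B at *
  obtain rfl : A = (8 * m - 1) * B + e := by linear_combination hN
  have hm0 : 0 < m := by
    by_contra hm
    have : m * B ≤ 0 := mul_nonpos_of_nonpos_of_nonneg (by linarith) (by linarith)
    rcases he with rfl | rfl <;> nlinarith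
  have hdvd : B ∣ m - 1 := by
    have h3 : B ∣ (m - 1) * e := ⟨e ^ 2 * (24 * m - 7) +
      B * e * (3 * (8 * m - 1) ^ 2 - 8 * (8 * m - 1) + 3) +
      B ^ 2 * ((8 * m - 1) * (8 * m - 2) * (8 * m - 4)) - m * (4 * m + 8 * m * e ^ 2) -
      64 * m ^ 3 * B * e - 128 * m ^ 4 * B ^ 2, by linear_combination e * he2 - h2⟩
    rcases he with rfl | rfl
    · simpa using h3
    · exact dvd_sub_comm.mp (by simpa using h3)
  have hm2 := hBe.trans hdvd
  obtain rfl | hm3 : m = 1 ∨ 3 ≤ m := by omega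
  · have h3 : (4 * B + e) * (5 * B * (2 * B + e)) = 0 := by
      linear_combination h2 - (4 * B + e) * he2
    rcases mul_eq_zero.mp h3 with h4 | h4
    · rcases he with rfl | rfl <;> omega
    · rcases mul_eq_zero.mp h4 with h4 | h4 <;> rcases he with rfl | rfl <;> omega
  · have := two_pow_bound hm3 hB he
    nlinarith

theorem false_of_even {A B Q : ℤ} (hAB : A + B = Q) (hB : 0 < B) (hQ : 3 ≤ Q)
    (hQo : Odd Q) (hBs : SmoothPrimeTo Q B) (hu : SmoothPrimeTo Q (3 * A - B))
    (hv : SmoothPrimeTo Q (5 * (A - B) ^ 2 - 4 * B ^ 2))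
    (h : 32 * A * B * (A - B) * (A - 3 * B) = Q ^ 4 - 1) : False := by
  subst hAB
  have hQ4 : 3 * (A + B) * ((A + B) ^ 4 - 1) ≠ 0 := by
    have : (1 : ℤ) < (A + B) ^ 4 := one_lt_pow₀ (by linarith) (by norm_num)
    exact mul_ne_zero (by linarith) (by linarith)
  have hv1 : (5 * (A - B) ^ 2 - 4 * B ^ 2) ^ 2 ≠ 1 := by
    intro h1
    apply hQ4
    linear_combination 4 * B * h1 - (3 * A - B) * h
  obtain ⟨k, hk⟩ := exists_five_form hQo
  have hv' : (11 : ℤ) ∣ 5 * (A - B) ^ 2 - 4 * B ^ 2 ∨ (19 : ℤ) ∣ 5 * (A - B) ^ 2 - 4 * B ^ 2 := by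
    by_contra! hcon
    rcases hv.eq_one_or ⟨2 * k, by rw [hk]; ring⟩ hcon.1 hcon.2 with h1 | h1 <;>
      exact hv1 (by rw [h1]; norm_num)
  obtain ⟨q, hq⟩ := id hQo
  have hu' : (11 : ℤ) ∣ 3 * A - B ∨ (19 : ℤ) ∣ 3 * A - B := by
    by_contra! hcon
    rcases hu.eq_one_or ⟨2 * A - q - 1, by linarith⟩ hcon.1 hcon.2 with h1 | h1
    · obtain rfl : B = 3 * A - 1 := by linarith
      have h2 : 16 * A * (2 * A - 1) * (2 * ((3 * A - 1) * (8 * A - 3) - 4 * A ^ 2 + 2 * A) - 1) =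
        0 := by linear_combination h
      rcases mul_eq_zero.mp h2 with h3 | h3
      · rcases mul_eq_zero.mp h3 with h3 | h3 <;> omega
      · omega
    · obtain rfl : B = 3 * A + 1 := by linarith
      have h2 : 16 * A * (2 * A + 1) * (2 * ((3 * A + 1) * (8 * A + 3) - 4 * A ^ 2 - 2 * A) - 1) =
        0 := by linear_combination h
      rcases mul_eq_zero.mp h2 with h3 | h3
      · rcases mul_eq_zero.mp h3 with h3 | h3 <;> omega
      · omega
  have disj : ∀ ℓ : ℕ, ℓ = 11 ∨ ℓ = 19 → ¬ (ℓ : ℤ) ∣ A + B →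
      ¬ ((ℓ : ℤ) ∣ 5 * (A - B) ^ 2 - 4 * B ^ 2 ∧ (ℓ : ℤ) ∣ 3 * A - B) ∧
      ¬ ((ℓ : ℤ) ∣ 5 * (A - B) ^ 2 - 4 * B ^ 2 ∧ (ℓ : ℤ) ∣ B) ∧
      ¬ ((ℓ : ℤ) ∣ 3 * A - B ∧ (ℓ : ℤ) ∣ B) := by
    clear * -
    intro ℓ hℓ hz
    simp only [← ZMod.intCast_zmod_eq_zero_iff_dvd] at hz ⊢
    push_cast at hz ⊢
    generalize (A : ZMod ℓ) = A at *
    generalize (B : ZMod ℓ) = B at *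
    rcases hℓ with rfl | rfl <;> revert A B <;> decide +kernel
  have d11 := disj 11 (by simp)
  have d19 := disj 19 (by simp)
  have e11 : ∀ u, SmoothPrimeTo (A + B) u → (11 : ℤ) ∣ u → ¬ (11 : ℤ) ∣ A + B :=
    fun u hu hd => (hu 11 (by norm_num) hd).2
  have e19 : ∀ u, SmoothPrimeTo (A + B) u → (19 : ℤ) ∣ u → ¬ (19 : ℤ) ∣ A + B :=
    fun u hu hd => (hu 19 (by norm_num) hd).2
  have v11 := e11 _ hv
  have v19 := e19 _ hv
  have u11 := e11 _ hu
  have u19 := e19 _ hu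
  obtain ⟨hB11, hB19⟩ : ¬ (11 : ℤ) ∣ B ∧ ¬ (19 : ℤ) ∣ B := by
    clear hBs hu hv e11 e19 disj h hQ4 hv1 hk hq hB hQ hQo
    push_cast at d11 d19
    grind
  obtain ⟨s, hs⟩ := hBs.exists_natAbs_pow hB.ne' (q := 2) (by
    rintro ℓ (rfl | rfl | rfl) hd
    · rfl
    · exact absurd hd hB11
    · exact absurd hd hB19)
  obtain rfl : B = 2 ^ s := by
    rw [← Int.natAbs_of_nonneg hB.le, hs]; push_cast; rfl
  exact two_pow_case hQ hQo h

/-- The primitive part of `U_15`. -/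
theorem primitive_eq_one_or {T Q : ℤ} (hU : SmoothPrimeTo Q (lucasU T Q 15)) :
    (T ^ 2 - Q) ^ 4 - 5 * Q * T ^ 2 * (T ^ 2 - 2 * Q) ^ 2 = 1 ∨
      (T ^ 2 - Q) ^ 4 - 5 * Q * T ^ 2 * (T ^ 2 - 2 * Q) ^ 2 = -1 := by
  rw [U_fifteen] at hU
  have h := hU.of_dvd (Dvd.intro_left _ rfl)
  by_contra! h0
  obtain ⟨ℓ, hℓ, hd⟩ := Nat.exists_prime_and_dvd
    (n := ((T ^ 2 - Q) ^ 4 - 5 * Q * T ^ 2 * (T ^ 2 - 2 * Q) ^ 2).natAbs) (by omega)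
  have hd' := Int.natCast_dvd.mpr hd
  obtain ⟨h1, h2⟩ := h ℓ hℓ hd'
  rw [← ZMod.intCast_zmod_eq_zero_iff_dvd] at h2 hd'
  push_cast at h2 hd'
  generalize (T : ZMod ℓ) = T at *
  generalize (Q : ZMod ℓ) = Q at *
  clear * - h1 h2 hd'
  rcases h1 with rfl | rfl | rfl <;> revert T Q <;> decide +kernel

theorem false_of_odd {T Q Δ : ℤ} {d q : ℕ} (hT : Odd T) (hQo : Odd Q) (hQ : 3 ≤ Q)
    (hΔ : T ^ 2 - 4 * Q = Δ) (hdq : d = 11 ∧ q = 19 ∨ d = 19 ∧ q = 11) (hd : (d : ℤ) ∣ Δ)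
    (hdQ : ¬ (d : ℤ) ∣ Q) (hU : SmoothPrimeTo Q (lucasU T Q 15)) : False := by
  have hΦ := primitive_eq_one_or hU
  rw [U_fifteen] at hU
  have hu := hU.of_dvd (Dvd.intro _ (mul_assoc _ _ _).symm)
  have hv := (hU.of_dvd (Dvd.intro _ rfl)).of_dvd (Dvd.intro_left _ rfl)
  have hid : Δ * (T ^ 4 - 3 * T ^ 2 * Q + Q ^ 2) ^ 2 + 3 * Q ^ 5 =
      (Δ + 3 * Q) * ((T ^ 2 - Q) ^ 4 - 5 * Q * T ^ 2 * (T ^ 2 - 2 * Q) ^ 2) := by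
    rw [← hΔ]; ring
  have hvo : Odd (T ^ 4 - 3 * T ^ 2 * Q + Q ^ 2) := by
    rw [Int.odd_iff]
    obtain ⟨i, rfl⟩ := hT
    obtain ⟨j, rfl⟩ := hQo
    ring_nf
    omega
  have hΔ4 : -(4 * Q) ≤ Δ := by nlinarith [sq_nonneg T]
  have hQ4 : 81 ≤ Q ^ 4 := by
    have := pow_le_pow_left₀ (by norm_num) hQ 4
    linarith
  have hv1 : (T ^ 4 - 3 * T ^ 2 * Q + Q ^ 2) ^ 2 ≠ 1 := by
    intro h1
    rw [h1] at hid
    rcases hΦ with h2 | h2 <;> rw [h2] at hid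
    · have : Q * (Q ^ 4 - 1) = 0 := by linarith
      rcases mul_eq_zero.mp this with h3 | h3 <;> linarith
    · nlinarith
  have hdu : ¬ (d : ℤ) ∣ T ^ 2 - Q ∧ ¬ (d : ℤ) ∣ T ^ 4 - 3 * T ^ 2 * Q + Q ^ 2 := by
    rw [← hΔ] at hd
    clear * - hd hdQ hdq
    simp only [← ZMod.intCast_zmod_eq_zero_iff_dvd] at *
    push_cast at *
    generalize (T : ZMod d) = T at *
    generalize (Q : ZMod d) = Q at *
    rcases hdq with ⟨rfl, -⟩ | ⟨rfl, -⟩ <;> revert T Q <;> decide +kernel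
  have hqv : (q : ℤ) ∣ T ^ 4 - 3 * T ^ 2 * Q + Q ^ 2 := by
    by_contra hcon
    have : T ^ 4 - 3 * T ^ 2 * Q + Q ^ 2 = 1 ∨ T ^ 4 - 3 * T ^ 2 * Q + Q ^ 2 = -1 := by
      rcases hdq with ⟨rfl, rfl⟩ | ⟨rfl, rfl⟩
      · exact hv.eq_one_or hvo hdu.2 hcon
      · exact hv.eq_one_or hvo hcon hdu.2
    rcases this with h1 | h1 <;> exact hv1 (by rw [h1]; norm_num)
  have hqu : ¬ (q : ℤ) ∣ T ^ 2 - Q := by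
    have hqQ : ¬ (q : ℤ) ∣ Q := (hv q (by rcases hdq with ⟨-, rfl⟩ | ⟨-, rfl⟩ <;> norm_num) hqv).2
    clear * - hqv hqQ hdq
    simp only [← ZMod.intCast_zmod_eq_zero_iff_dvd] at *
    push_cast at *
    generalize (T : ZMod q) = T at *
    generalize (Q : ZMod q) = Q at *
    rcases hdq with ⟨-, rfl⟩ | ⟨-, rfl⟩ <;> revert T Q <;> decide +kernel
  have hu5 : ¬ ((5 : ℕ) : ℤ) ∣ T ^ 2 - Q := hu.not_prime_dvd 5 (by norm_num) (by norm_num)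
  have hΦ1 : (T ^ 2 - Q) ^ 4 - 5 * Q * T ^ 2 * (T ^ 2 - 2 * Q) ^ 2 = 1 := by
    refine hΦ.resolve_right fun h1 => ?_
    have h2 := congrArg (Int.cast : ℤ → ZMod 5) h1
    rw [← ZMod.intCast_zmod_eq_zero_iff_dvd] at hu5
    push_cast at h2 hu5
    generalize (T : ZMod 5) = T at *
    generalize (Q : ZMod 5) = Q at *
    clear * - h2 hu5
    revert T Q
    decide +kernel
  have hu8 : (T ^ 2 - Q) % 8 = 6 := by
    have h2 := congrArg (Int.cast : ℤ → ZMod 8) hΦ1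
    have key : ∀ T Q : ZMod 8, T = 1 ∨ T = 3 ∨ T = 5 ∨ T = 7 → Q = 1 ∨ Q = 3 ∨ Q = 5 ∨ Q = 7 →
        (T ^ 2 - Q) ^ 4 - 5 * Q * T ^ 2 * (T ^ 2 - 2 * Q) ^ 2 = 1 → T ^ 2 - Q = 6 := by
      decide +kernel
    have odd8 : ∀ w : ℤ, Odd w → (w : ZMod 8) = 1 ∨ (w : ZMod 8) = 3 ∨ (w : ZMod 8) = 5 ∨
        (w : ZMod 8) = 7 := by
      intro w hw
      have h3 : w % 8 = 1 ∨ w % 8 = 3 ∨ w % 8 = 5 ∨ w % 8 = 7 := by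
        have := Int.odd_iff.mp hw; omega
      rw [← ZMod.intCast_mod w 8]
      push_cast
      rcases h3 with h3 | h3 | h3 | h3 <;> rw [h3] <;> simp
    push_cast at h2
    have h4 := key _ _ (odd8 T hT) (odd8 Q hQo) h2
    have := (ZMod.intCast_eq_intCast_iff' (T ^ 2 - Q) 6 8).mp (by push_cast; exact h4)
    simpa using this
  obtain ⟨w, hw⟩ : ∃ w, T ^ 2 - Q = 2 * (4 * w + 3) := ⟨(T ^ 2 - Q) / 8, by omega⟩
  have hws : SmoothPrimeTo Q (4 * w + 3) := hu.of_dvd ⟨2, by rw [hw, mul_comm]⟩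
  have hun : ∀ ℓ : ℕ, ℓ = d ∨ ℓ = q → ¬ (ℓ : ℤ) ∣ 4 * w + 3 := by
    rintro ℓ hℓ h1
    have h2 : (ℓ : ℤ) ∣ T ^ 2 - Q := hw ▸ h1.mul_left 2
    rcases hℓ with rfl | rfl
    · exact hdu.1 h2
    · exact hqu h2
  have hw1 : 4 * w + 3 = 1 ∨ 4 * w + 3 = -1 :=
    hws.eq_one_or ⟨2 * w + 1, by ring⟩ (hun 11 (by omega)) (hun 19 (by omega))
  obtain rfl : w = -1 := by omega
  obtain rfl : Q = T ^ 2 + 2 := by linarith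
  have hT1 : 1 ≤ T ^ 2 := by
    have := sq_pos_of_ne_zero (a := T) (by rintro rfl; exact absurd hT (by decide))
    linarith
  generalize T ^ 2 = S at *
  have hS := mul_nonneg (by linarith : 0 ≤ S + 2) (sq_nonneg (S + 4))
  nlinarith [mul_nonneg hS (by linarith : 0 ≤ S - 1)]

end ExponentFifteen

theorem not_isSolution_fifteen {d : ℕ} {x b z : ℤ} (h38 : d ≠ 38) (h209 : d ≠ 209) :
    ¬ IsSolution d x b z 15 := by
  intro h
  obtain ⟨T, c₀, hr⟩ := h.exists_root (by decide) (fun h' => absurd h' h38)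
    (fun h' => absurd h' h209)
  have hU := hr.smooth_U h.smoothPrimeTo (m := 15) dvd_rfl
  by_cases hT : (d = 11 ∨ d = 19) ∧ Odd T
  · obtain ⟨hd, hT⟩ := hT
    have hdQ : ¬ (d : ℤ) ∣ z := h.not_dvd_y (by rcases hd with rfl | rfl <;> norm_num)
      (Dvd.intro _ rfl)
    rcases hd with rfl | rfl
    · exact ExponentFifteen.false_of_odd (q := 19) hT h.odd h.three_le hr.disc (by simp)
        (Dvd.intro _ rfl |>.neg_right) hdQ hU
    · exact ExponentFifteen.false_of_odd (q := 11) hT h.odd h.three_le hr.disc (by simp)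
        (Dvd.intro _ rfl |>.neg_right) hdQ hU
  obtain ⟨a, c, hr⟩ := hr.exists_even h.mem h.odd fun h' => Or.inl (by
    by_contra h0; exact hT ⟨h', Int.not_even_iff_odd.mp h0⟩)
  have hU := hr.isRoot.smooth_U h.smoothPrimeTo (m := 15) dvd_rfl
  have hΦ := ExponentFifteen.primitive_eq_one_or hU
  have hcb := hr.c_dvd
  have hc : c ≠ 0 := by rintro rfl; exact h.b_pos.ne' (by rw [← hr.im, zero_mul])
  have hB0 : (0 : ℤ) < d * c ^ 2 := by have := h.d_pos; positivity
  have hBs : SmoothPrimeTo z (d * c ^ 2) := by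
    intro ℓ hℓ hdv
    refine ⟨h.prime_mem hcb hℓ hdv, h.not_dvd_y hℓ ?_⟩
    have hp := Nat.prime_iff_prime_int.mp hℓ
    rcases hp.dvd_or_dvd hdv with h1 | h1
    · exact h1.mul_right _
    · exact ((hp.dvd_of_dvd_pow h1).trans hcb).mul_left _
  rw [ExponentFifteen.U_fifteen] at hU
  have hu := hU.of_dvd (Dvd.intro _ (mul_assoc _ _ _).symm)
  have hv := (hU.of_dvd (Dvd.intro _ rfl)).of_dvd (Dvd.intro_left _ rfl)
  have hN := hr.norm
  have hz := h.odd
  generalize (d : ℤ) * c ^ 2 = B at *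
  have hu' : SmoothPrimeTo z (3 * a ^ 2 - B) := by
    rwa [show 3 * a ^ 2 - B = (2 * a) ^ 2 - z by rw [← hN]; ring]
  have hv' : SmoothPrimeTo z (5 * (a ^ 2 - B) ^ 2 - 4 * B ^ 2) := by
    rwa [show 5 * (a ^ 2 - B) ^ 2 - 4 * B ^ 2 =
      (2 * a) ^ 4 - 3 * (2 * a) ^ 2 * z + z ^ 2 by rw [← hN]; ring]
  refine ExponentFifteen.false_of_even hN hB0 h.three_le hz hBs hu' hv' ?_
  have key : ∀ k : ℤ, z = 2 * k + 1 → ((2 * a) ^ 2 - z) ^ 4 - 5 * z * (2 * a) ^ 2 *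
      ((2 * a) ^ 2 - 2 * z) ^ 2 ≠ -1 := by
    intro k hk h1
    have h2 := congrArg (Int.cast : ℤ → ZMod 4) h1
    rw [hk] at h2
    push_cast at h2
    generalize (a : ZMod 4) = a at *
    generalize (k : ZMod 4) = k at *
    clear * - h2
    revert a k
    decide +kernel
  obtain ⟨k, hk⟩ := hz
  have h1 := hΦ.resolve_right (key k hk)
  rw [← hN] at h1 ⊢
  linear_combination -h1

theorem IsSolution.false_of_prime_mul {d n p q : ℕ} {x b y : ℤ} (h : IsSolution d x b y n)
    (hp : p.Prime) (h7 : 7 ≤ p) (hq : q.Prime) (hle : q ≤ p) (hdvd : p * q ∣ n) : False := by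
  obtain ⟨m, rfl⟩ := hdvd
  have hy := h.three_le
  have hm : m ≠ 0 := by
    rintro rfl
    have h1 := h.eq
    have h2 : (0 : ℤ) < d * b ^ 2 := by have := h.d_pos; have := h.b_pos; positivity
    have := h.pos
    rw [mul_zero, pow_zero] at h1
    nlinarith
  rw [mul_comm] at h
  have hz := h.root_pow hm
  generalize y ^ m = z at *
  have hb : b ≠ 0 := h.b_pos.ne'
  have ndvd : ∀ r : ℕ, r.Prime → r < 7 → ¬ r ∣ p := fun r hr hr7 hd => by
    have := (Nat.prime_dvd_prime_iff_eq hr hp).mp hd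
    omega
  have hzq : IsSolution d x b (z ^ q) p := by
    rw [mul_comm] at hz
    exact hz.root_pow hq.ne_zero
  have hpo := hp.odd_of_ne_two (by omega)
  rcases hq.eq_two_or_odd' with rfl | hqo
  · obtain ⟨T, c, hr⟩ := hzq.exists_root hpo (fun _ => ndvd 3 (by norm_num) (by norm_num))
      (fun _ => ndvd 5 (by norm_num) (by norm_num))
    obtain ⟨a, c', hr'⟩ := hr.exists_even hzq.mem hzq.odd
      (fun _ => Or.inr (ndvd 3 (by norm_num) (by norm_num)))
    exact not_isEvenRoot_sq hb hz.d_pos hz.smoothPrimeTo hz.three_le hp h7 hzq.eq hr'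
  by_cases h38 : d = 38 ∧ q = 3
  · obtain ⟨rfl, rfl⟩ := h38
    exact not_isSolution_38 hp h7 hzq
  by_cases h209 : d = 209 ∧ q = 5
  · obtain ⟨rfl, rfl⟩ := h209
    exact not_isSolution_209 hp h7 hzq
  have key : ∀ r : ℕ, r.Prime → r < 7 → q ≠ r → ¬ r ∣ p * q := fun r hr hr7 hne hd => by
    rcases hr.dvd_mul.mp hd with h1 | h1
    · exact ndvd r hr hr7 h1
    · exact hne ((Nat.prime_dvd_prime_iff_eq hr hq).mp h1).symm
  obtain ⟨T, c, hr⟩ := hz.exists_root (hpo.mul hqo)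
    (fun hd => key 3 (by norm_num) (by norm_num) fun h' => h38 ⟨hd, h'⟩)
    (fun hd => key 5 (by norm_num) (by norm_num) fun h' => h209 ⟨hd, h'⟩)
  obtain ⟨i, rfl⟩ := hqo
  exact not_isRoot_mul hb hz.smoothPrimeTo hz.three_le hp h7
    (by rintro rfl; exact hq.ne_one rfl) hle hr

theorem odd_of_eq {x y k l m n : ℕ} (hgcd : Nat.gcd x y = 1) (hn : 3 ≤ n)
    (heq : x ^ 2 + 2 ^ k * 11 ^ l * 19 ^ m = y ^ n) : Odd y := by
  by_contra hy
  rw [Nat.not_odd_iff_even] at hy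
  have hx : Odd x := by
    by_contra hx
    have := Nat.dvd_gcd (Nat.not_odd_iff_even.mp hx).two_dvd hy.two_dvd
    rw [hgcd] at this
    omega
  have h8 : 8 ∣ y ^ n := (pow_dvd_pow_of_dvd hy.two_dvd 3).trans (pow_dvd_pow y hn)
  rcases k with - | k
  · have hl : ∀ l : ℕ, 11 ^ l % 8 = 1 ∨ 11 ^ l % 8 = 3 := by
      intro l
      induction l with
      | zero => simp
      | succ l ih => rw [pow_succ]; omega
    have hm : ∀ l : ℕ, 19 ^ l % 8 = 1 ∨ 19 ^ l % 8 = 3 := by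
      intro l
      induction l with
      | zero => simp
      | succ l ih => rw [pow_succ]; omega
    have hx8 : x ^ 2 % 8 = 1 := by
      rw [Nat.pow_mod]
      have : x % 8 = 1 ∨ x % 8 = 3 ∨ x % 8 = 5 ∨ x % 8 = 7 := by
        have := Nat.odd_iff.mp hx; omega
      rcases this with h | h | h | h <;> rw [h]
    have h1 : (11 ^ l * 19 ^ m) % 8 = 1 ∨ (11 ^ l * 19 ^ m) % 8 = 3 := by
      rw [Nat.mul_mod]
      rcases hl l with h | h <;> rcases hm m with h' | h' <;> rw [h, h'] <;> simp
    rw [pow_zero, one_mul] at heq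
    omega
  · have h2 : Even (2 ^ (k + 1) * 11 ^ l * 19 ^ m) := by
      rw [pow_succ]
      exact ((even_two.mul_left _).mul_right _).mul_right _
    have h3 : Odd (y ^ n) := heq ▸ hx.pow.add_even h2
    exact Nat.not_even_iff_odd.mpr h3 (hy.pow_of_ne_zero (by omega))

/-- The squarefree part of `2^k 11^l 19^m`. -/
def squarefreePart (k l m : ℕ) : ℕ := 2 ^ (k % 2) * 11 ^ (l % 2) * 19 ^ (m % 2)

theorem squarefreePart_ne_209 {k l m : ℕ} (h : ¬ (Even k ∧ Odd l ∧ Odd m)) :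
    squarefreePart k l m ≠ 209 := by
  rw [Nat.even_iff, Nat.odd_iff, Nat.odd_iff] at h
  rw [squarefreePart]
  rcases Nat.mod_two_eq_zero_or_one k with hk | hk <;>
    rcases Nat.mod_two_eq_zero_or_one l with hl | hl <;>
    rcases Nat.mod_two_eq_zero_or_one m with hm | hm <;> simp_all

theorem squarefreePart_mul_sq (k l m : ℕ) :
    squarefreePart k l m * (2 ^ (k / 2) * 11 ^ (l / 2) * 19 ^ (m / 2)) ^ 2 =
      2 ^ k * 11 ^ l * 19 ^ m := by
  have key : ∀ q e : ℕ, q ^ (e % 2) * (q ^ (e / 2)) ^ 2 = q ^ e := fun q e => by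
    rw [← pow_mul, ← pow_add, mul_comm (e / 2), Nat.mod_add_div]
  rw [squarefreePart, ← key 2 k, ← key 11 l, ← key 19 m]
  ring

theorem isSolution_of_eq {x y k l m n : ℕ} (hn : 3 ≤ n) (hx : 0 < x)
    (hgcd : Nat.gcd x y = 1) (heq : x ^ 2 + 2 ^ k * 11 ^ l * 19 ^ m = y ^ n) :
    IsSolution (squarefreePart k l m) x
      ((2 ^ (k / 2) * 11 ^ (l / 2) * 19 ^ (m / 2) : ℕ) : ℤ) y n := by
  have hodd := odd_of_eq hgcd hn heq
  rw [← squarefreePart_mul_sq] at heq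
  have hd0 : 0 < squarefreePart k l m := by rw [squarefreePart]; positivity
  have hb0 : 0 < 2 ^ (k / 2) * 11 ^ (l / 2) * 19 ^ (m / 2) := by positivity
  refine ⟨?_, by exact_mod_cast hx, ?_, by exact_mod_cast hodd,
    ⟨k / 2, l / 2, m / 2, by push_cast; rfl⟩, ?_, by exact_mod_cast heq⟩
  · rw [squarefreePart]
    rcases Nat.mod_two_eq_zero_or_one k with hk | hk <;>
      rcases Nat.mod_two_eq_zero_or_one l with hl | hl <;>
      rcases Nat.mod_two_eq_zero_or_one m with hm | hm <;> simp [hk, hl, hm]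
  · have h1 : y ≠ 1 := by
      rintro rfl
      rw [one_pow] at heq
      have : 0 < squarefreePart k l m * (2 ^ (k / 2) * 11 ^ (l / 2) * 19 ^ (m / 2)) ^ 2 := by
        positivity
      have : 0 < x ^ 2 := by positivity
      omega
    obtain ⟨i, hi⟩ := hodd
    have : 3 ≤ y := by omega
    exact_mod_cast this
  · generalize 2 ^ (k / 2) * 11 ^ (l / 2) * 19 ^ (m / 2) = b at *
    have h1 : Nat.Coprime (squarefreePart k l m * b) y := by
      refine Nat.Coprime.of_dvd_left (a₂ := squarefreePart k l m * b ^ 2)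
        ⟨b, by ring⟩ ?_
      by_contra h0
      obtain ⟨ℓ, hℓ, h2, h3⟩ := Nat.Prime.not_coprime_iff_dvd.mp h0
      have h4 : ℓ ∣ x ^ 2 := (Nat.dvd_add_left h2).mp (heq ▸ dvd_pow h3 (by omega))
      have h5 := Nat.dvd_gcd (hℓ.dvd_of_dvd_pow h4) h3
      rw [hgcd] at h5
      exact hℓ.one_lt.ne' (Nat.dvd_one.mp h5)
    exact_mod_cast Nat.isCoprime_iff_coprime.mpr h1

theorem exponents_of_eq {k l m : ℕ} (h : 2 ^ k * 11 ^ l * 19 ^ m = 968) :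
    k = 3 ∧ l = 2 ∧ m = 0 := by
  have aux : ∀ q e i : ℕ, 2 ≤ q → q ^ e ∣ 968 → ¬ q ^ i ∣ 968 → e < i := by
    intro q e i _ hd hn
    by_contra hle
    exact hn ((pow_dvd_pow q (by omega)).trans hd)
  have hk := aux 2 k 4 (by norm_num) (h ▸ (Dvd.intro _ rfl : 2 ^ k ∣ 2 ^ k * 11 ^ l).mul_right _)
    (by norm_num)
  have hl := aux 11 l 3 (by norm_num)
    (h ▸ (Dvd.intro_left _ rfl : 11 ^ l ∣ 2 ^ k * 11 ^ l).mul_right _) (by norm_num)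
  have hm := aux 19 m 1 (by norm_num) (h ▸ Dvd.intro_left _ rfl) (by norm_num)
  interval_cases k <;> interval_cases l <;> interval_cases m <;> simp_all

theorem stmt_8 (p t n : ℕ) (hp : p.Prime) (hp5 : 5 ≤ p) (ht : 2 ≤ t)
    (hn : n = p * t) (x y k l m : ℕ) (hx : 0 < x) (hy : 0 < y)
    (hgcd : Nat.gcd x y = 1)
    (hexc : ¬(Even k ∧ Odd l ∧ Odd m ∧ p = 5))
    (heq : x ^ 2 + 2 ^ k * 11 ^ l * 19 ^ m = y ^ n) :
    (x, y, k, l, m, n) = (241, 3, 3, 2, 0, 10) := by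
  have hn0 : n ≠ 0 := by rw [hn]; positivity
  have hsol := isSolution_of_eq (by nlinarith) hx hgcd heq
  obtain ⟨P, hP, hmax⟩ := Finset.exists_max_image n.primeFactors id
    ⟨p, Nat.mem_primeFactors.mpr ⟨hp, Dvd.intro _ hn.symm, hn0⟩⟩
  obtain ⟨hPp, ⟨s, hs⟩, -⟩ := Nat.mem_primeFactors.mp hP
  have hpP : p ≤ P := hmax p (Nat.mem_primeFactors.mpr ⟨hp, Dvd.intro _ hn.symm, hn0⟩)
  have hs1 : s ≠ 1 := by
    rintro rfl
    rw [mul_one] at hs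
    have h1 : ¬ (p * t).Prime := Nat.not_prime_mul hp.ne_one (by omega)
    exact h1 (hn ▸ hs ▸ hPp)
  obtain ⟨q, hq, s, rfl⟩ := Nat.exists_prime_and_dvd hs1
  have hqP : q ≤ P := hmax q (Nat.mem_primeFactors.mpr ⟨hq, ⟨P * s, by rw [hs]; ring⟩, hn0⟩)
  by_cases h7 : 7 ≤ P
  · exact (hsol.false_of_prime_mul hPp h7 hq hqP ⟨s, by rw [hs]; ring⟩).elim
  obtain rfl : P = 5 := by
    have : P ≠ 6 := by rintro rfl; exact absurd hPp (by norm_num)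
    omega
  obtain rfl : p = 5 := by omega
  have hs0 : s ≠ 0 := by rintro rfl; exact hn0 (by simpa using hs)
  have h209 := squarefreePart_ne_209 (k := k) (l := l) (m := m)
    fun h => hexc ⟨h.1, h.2.1, h.2.2, rfl⟩
  have hred : ∀ r : ℕ, n = s * r → IsSolution (squarefreePart k l m) x
      ((2 ^ (k / 2) * 11 ^ (l / 2) * 19 ^ (m / 2) : ℕ) : ℤ) ((y : ℤ) ^ s) r :=
    fun r hr => by rw [hr] at hsol; exact hsol.root_pow hs0
  have hq5 : q = 2 ∨ q = 3 ∨ q = 5 := by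
    have := hq.two_le
    have : q ≠ 4 := by rintro rfl; exact absurd hq (by norm_num)
    omega
  rcases hq5 with rfl | rfl | rfl
  · obtain ⟨h1, h2, h3, h4⟩ := (hred 10 (by rw [hs]; ring)).eq_of_exponent_ten h209
    have hx' : x = 241 := by exact_mod_cast h2
    have hb : 2 ^ (k / 2) * 11 ^ (l / 2) * 19 ^ (m / 2) = 22 := by exact_mod_cast h3
    have hD := squarefreePart_mul_sq k l m
    rw [h1, hb] at hD
    obtain ⟨rfl, rfl, rfl⟩ := exponents_of_eq hD.symm
    have hys : y ^ s = 3 ^ 1 := by exact_mod_cast h4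
    have hs2 : s = 1 := by
      have h5 : y ∣ 3 := by
        rw [← pow_one 3, ← hys]
        exact dvd_pow_self y hs0
      rcases (Nat.dvd_prime Nat.prime_three).mp h5 with rfl | rfl
      · simp at hys
      · exact Nat.pow_right_injective (by norm_num) hys
    rw [hs2, pow_one] at hys
    rw [hs2] at hs
    norm_num [hx', hys, hs]
  · by_cases h38 : squarefreePart k l m = 38
    · exact (not_isSolution_fifteen_of_eq_38 (h38 ▸ hred 15 (by rw [hs]; ring))).elim
    · exact (not_isSolution_fifteen h38 h209 (hred 15 (by rw [hs]; ring))).elim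
  · exact (not_isSolution_twentyFive h209 (hred 25 (by rw [hs]; ring))).elim
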